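/- Consider a discrete memoryless two-level security wiretap channel with transition probability p(y,z1,z2|x) that satisfies the Markov chains X → Z1 → Z2 and X → Y → Z2. The secrecy capacity region of the channel equals the set of all nonnegative pairs (R1,R2) satisfying R1 ≤ I(V;Y|U) − I(V;Z1|U) and R1 + R2 ≤ I(V;Y) − I(V;Z2) for some joint distribution p(u,v,x), where U and V are auxiliary random variables (over finite alphabets) satisfying the Markov chain U → V → X → (Y,Z1,Z2). -/

import Mathlib

open scoped BigOperators
noncomputable section

/-- A probability mass function on a finite type. -/
def IsPMF {α : Type*} [Fintype α] (p : α → ℝ) : Prop :=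
  (∀ a, 0 ≤ p a) ∧ ∑ a, p a = 1

/-- A discrete channel from `α` to `β`: every input determines a pmf on outputs. -/
def IsChannel {α β : Type*} [Fintype β] (W : α → β → ℝ) : Prop :=
  ∀ a, IsPMF (W a)

/-- Mutual information (in bits) of a joint pmf on `α × β`. -/
def mutInfo {α β : Type*} [Fintype α] [Fintype β] (p : α × β → ℝ) : ℝ :=
  ∑ ab : α × β,
    p ab * Real.logb 2 (p ab / ((∑ b, p (ab.1, b)) * (∑ a, p (a, ab.2))))

variable {𝒳 𝒴 𝒵₁ 𝒵₂ : Type} [Fintype 𝒳] [Fintype 𝒴] [Fintype 𝒵₁] [Fintype 𝒵₂]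

/-- The Markov chain `X → Z₁ → Z₂` for the channel `W : 𝒳 → 𝒴 × 𝒵₁ × 𝒵₂`:
the eavesdropper output `Z₂` is degraded with respect to `Z₁`. -/
def DegradedZ1Z2 (W : 𝒳 → 𝒴 × 𝒵₁ × 𝒵₂ → ℝ) : Prop :=
  ∃ q : 𝒵₁ → 𝒵₂ → ℝ, IsChannel q ∧
    ∀ x z₁ z₂, (∑ y, W x (y, z₁, z₂)) = (∑ y, ∑ z₂', W x (y, z₁, z₂')) * q z₁ z₂

/-- Joint pmf of messages, inputs and outputs induced by a (possibly stochastic) encoder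
`enc` used on the memoryless channel `W` with uniform independent messages. -/
def codeJoint {n K₁ K₂ : ℕ} (W : 𝒳 → 𝒴 × 𝒵₁ × 𝒵₂ → ℝ)
    (enc : Fin K₁ × Fin K₂ → (Fin n → 𝒳) → ℝ)
    (m : Fin K₁ × Fin K₂) (xs : Fin n → 𝒳) (ys : Fin n → 𝒴)
    (z1s : Fin n → 𝒵₁) (z2s : Fin n → 𝒵₂) : ℝ :=
  ((K₁ : ℝ) * (K₂ : ℝ))⁻¹ * enc m xs * ∏ i, W (xs i) (ys i, z1s i, z2s i)

/-- Average probability of a decoding error at the legitimate receiver. -/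
def errProb {n K₁ K₂ : ℕ} (W : 𝒳 → 𝒴 × 𝒵₁ × 𝒵₂ → ℝ)
    (enc : Fin K₁ × Fin K₂ → (Fin n → 𝒳) → ℝ)
    (dec : (Fin n → 𝒴) → Fin K₁ × Fin K₂) : ℝ :=
  ∑ m, ∑ xs, ∑ ys, ∑ z1s, ∑ z2s,
    if dec ys ≠ m then codeJoint W enc m xs ys z1s z2s else 0

/-- The information leakage `I(M₁,M₂; Z₂ⁿ)` to the weak eavesdropper realization. -/
def leakMZ2 {n K₁ K₂ : ℕ} (W : 𝒳 → 𝒴 × 𝒵₁ × 𝒵₂ → ℝ)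
    (enc : Fin K₁ × Fin K₂ → (Fin n → 𝒳) → ℝ) : ℝ :=
  mutInfo (fun q : (Fin K₁ × Fin K₂) × (Fin n → 𝒵₂) =>
    ∑ xs, ∑ ys, ∑ z1s, codeJoint W enc q.1 xs ys z1s q.2)

/-- The information leakage `I(M₁; Z₁ⁿ)` to the strong eavesdropper realization. -/
def leakM1Z1 {n K₁ K₂ : ℕ} (W : 𝒳 → 𝒴 × 𝒵₁ × 𝒵₂ → ℝ)
    (enc : Fin K₁ × Fin K₂ → (Fin n → 𝒳) → ℝ) : ℝ :=
  mutInfo (fun q : Fin K₁ × (Fin n → 𝒵₁) =>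
    ∑ m₂, ∑ xs, ∑ ys, ∑ z2s, codeJoint W enc (q.1, m₂) xs ys q.2 z2s)

/-- A rate pair `(R₁,R₂)` is achievable for the two-level security wiretap channel `W`:
there are codes of blocklength `n` whose rates are arbitrarily close to `(R₁,R₂)`, with
vanishing error probability at the legitimate receiver, vanishing normalized leakage
`(1/n) I(M₁,M₂;Z₂ⁿ)` of both messages to the weak eavesdropper realization, and vanishing
normalized leakage `(1/n) I(M₁;Z₁ⁿ)` of the high-security message to the strong one. -/
def Achievable (W : 𝒳 → 𝒴 × 𝒵₁ × 𝒵₂ → ℝ) (R₁ R₂ : ℝ) : Prop :=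
  ∀ ε > 0, ∃ n : ℕ, 0 < n ∧ ∃ K₁ K₂ : ℕ, 0 < K₁ ∧ 0 < K₂ ∧
    (n : ℝ) * (R₁ - ε) ≤ Real.logb 2 K₁ ∧ (n : ℝ) * (R₂ - ε) ≤ Real.logb 2 K₂ ∧
    ∃ enc : Fin K₁ × Fin K₂ → (Fin n → 𝒳) → ℝ, IsChannel enc ∧
      ∃ dec : (Fin n → 𝒴) → Fin K₁ × Fin K₂,
        errProb W enc dec ≤ ε ∧
        leakMZ2 W enc ≤ (n : ℝ) * ε ∧
        leakM1Z1 W enc ≤ (n : ℝ) * ε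

/-- Conditional mutual information `I(A;B|C)` (in bits) of a joint pmf on `α × β × γ`,
where the conditioning variable is the third coordinate. -/
def condMutInfo {α β γ : Type*} [Fintype α] [Fintype β] [Fintype γ]
    (p : α × β × γ → ℝ) : ℝ :=
  ∑ x : α × β × γ,
    p x * Real.logb 2
      (((∑ a, ∑ b, p (a, b, x.2.2)) * p x) /
        ((∑ b, p (x.1, b, x.2.2)) * (∑ a, p (a, x.2.1, x.2.2))))

/-- Marginal channel to the legitimate receiver. -/
def WY (W : 𝒳 → 𝒴 × 𝒵₁ × 𝒵₂ → ℝ) (x : 𝒳) (y : 𝒴) : ℝ := ∑ z₁, ∑ z₂, W x (y, z₁, z₂)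

/-- Marginal channel to the strong eavesdropper realization. -/
def WZ1 (W : 𝒳 → 𝒴 × 𝒵₁ × 𝒵₂ → ℝ) (x : 𝒳) (z₁ : 𝒵₁) : ℝ := ∑ y, ∑ z₂, W x (y, z₁, z₂)

/-- Marginal channel to the weak eavesdropper realization. -/
def WZ2 (W : 𝒳 → 𝒴 × 𝒵₁ × 𝒵₂ → ℝ) (x : 𝒳) (z₂ : 𝒵₂) : ℝ := ∑ y, ∑ z₁, W x (y, z₁, z₂)
/-- The Markov chain `X → Y → Z₂` for the channel `W`: the weak eavesdropper output `Z₂`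
is degraded with respect to the legitimate receiver output `Y`. -/
def DegradedYZ2 (W : 𝒳 → 𝒴 × 𝒵₁ × 𝒵₂ → ℝ) : Prop :=
  ∃ q : 𝒴 → 𝒵₂ → ℝ, IsChannel q ∧
    ∀ x y z₂, (∑ z₁, W x (y, z₁, z₂)) = (∑ z₁, ∑ z₂', W x (y, z₁, z₂')) * q y z₂


set_option linter.unusedSectionVars false
set_option linter.unusedVariables false

lemma ls_tangent {f g F G : ℝ} (hf : 0 ≤ f) (hg : 0 ≤ g) (h : g = 0 → f = 0) (hF : 0 < F)
    (hG : 0 < G) : f * Real.log (F / G) + f - g * (F / G) ≤ f * Real.log (f / g) := by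
  rcases hf.eq_or_lt with rfl | hf'
  · simp; positivity
  have hg' : 0 < g := lt_of_le_of_ne hg (fun e => hf'.ne' (h e.symm))
  have h1 := Real.one_sub_inv_le_log_of_pos (x := (f / g) / (F / G)) (by positivity)
  rw [Real.log_div (by positivity) (by positivity)] at h1
  have h2 := mul_le_mul_of_nonneg_left h1 hf'.le
  have h3 : f * (1 - ((f / g) / (F / G))⁻¹) = f - g * (F / G) := by field_simp
  nlinarith

/-- log-sum inequality -/
lemma logsum {ι : Type*} [Fintype ι] (f g : ι → ℝ) (hf : ∀ i, 0 ≤ f i) (hg : ∀ i, 0 ≤ g i)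
    (h : ∀ i, g i = 0 → f i = 0) :
    (∑ i, f i) * Real.log ((∑ i, f i) / ∑ i, g i) ≤ ∑ i, f i * Real.log (f i / g i) := by
  rcases (Finset.sum_nonneg (fun i _ => hf i)).eq_or_lt with h0 | h0
  · have : ∀ i, f i = 0 := fun i =>
      (Finset.sum_eq_zero_iff_of_nonneg (fun i _ => hf i)).1 h0.symm i (Finset.mem_univ _)
    simp [this]
  have hG : 0 < ∑ i, g i := by
    rcases (Finset.sum_nonneg (fun i _ => hg i)).eq_or_lt with h1 | h1
    · have : ∀ i, g i = 0 := fun i =>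
        (Finset.sum_eq_zero_iff_of_nonneg (fun i _ => hg i)).1 h1.symm i (Finset.mem_univ _)
      have : ∀ i, f i = 0 := fun i => h i (this i)
      simp [this] at h0
    · exact h1
  have := Finset.sum_le_sum (s := Finset.univ) (fun i _ => ls_tangent (hf i) (hg i) (h i) h0 hG)
  refine le_trans (le_of_eq ?_) this
  rw [Finset.sum_sub_distrib, Finset.sum_add_distrib, ← Finset.sum_mul, ← Finset.sum_mul]
  field_simp
  ring

lemma sum_eq_zero_imp {ι : Type*} [Fintype ι] {f : ι → ℝ} (hf : ∀ i, 0 ≤ f i)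
    (h : ∑ i, f i = 0) (i : ι) : f i = 0 :=
  (Finset.sum_eq_zero_iff_of_nonneg (fun i _ => hf i)).1 h i (Finset.mem_univ _)

/-- data processing, unnormalised -/
lemma dataproc {T Y Z : Type*} [Fintype T] [Fintype Y] [Fintype Z] (f : T → Y → ℝ)
    (hf : ∀ t y, 0 ≤ f t y) (q : Y → Z → ℝ) (hq : IsChannel q) :
    ∑ t, ∑ z, (∑ y, f t y * q y z) * Real.log ((∑ y, f t y * q y z) / ∑ t', ∑ y, f t' y * q y z)
      ≤ ∑ t, ∑ y, f t y * Real.log (f t y / ∑ t', f t' y) := by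
  have key : ∀ t z, (∑ y, f t y * q y z) *
      Real.log ((∑ y, f t y * q y z) / ∑ t', ∑ y, f t' y * q y z) ≤
      ∑ y, q y z * (f t y * Real.log (f t y / ∑ t', f t' y)) := by
    intro t z
    have h := logsum (fun y => f t y * q y z) (fun y => (∑ t', f t' y) * q y z)
      (fun y => mul_nonneg (hf _ _) ((hq y).1 z))
      (fun y => mul_nonneg (Finset.sum_nonneg fun _ _ => hf _ _) ((hq y).1 z)) (by
        intro y hy
        rcases mul_eq_zero.1 hy with h | h
        · simp [sum_eq_zero_imp (fun t => hf t y) h t]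
        · simp [h])
    have e : ∑ t', ∑ y, f t' y * q y z = ∑ y, (∑ t', f t' y) * q y z := by
      rw [Finset.sum_comm]; simp [Finset.sum_mul]
    rw [e]
    refine h.trans (Finset.sum_le_sum fun y _ => ?_)
    by_cases hz : q y z = 0
    · simp [hz]
    · rw [mul_div_mul_right _ _ hz]; apply le_of_eq; ring
  refine Finset.sum_le_sum fun t _ => ?_
  refine (Finset.sum_le_sum fun z _ => key t z).trans ?_
  rw [Finset.sum_comm]
  refine Finset.sum_le_sum fun y _ => ?_
  rw [← Finset.sum_mul, (hq y).2, one_mul]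

/-- unnormalised output entropy -/
def hE {X Y : Type*} [Fintype X] [Fintype Y] (W : X → Y → ℝ) (μ : X → ℝ) : ℝ :=
  ∑ y, Real.negMulLog (∑ x, μ x * W x y)

lemma negMulLog_sum_sub {T : Type*} [Fintype T] (f : T → ℝ) (hf : ∀ t, 0 ≤ f t) :
    Real.negMulLog (∑ t, f t) - ∑ t, Real.negMulLog (f t) =
      ∑ t, f t * Real.log (f t / ∑ t', f t') := by
  have : ∀ t, f t * Real.log (f t / ∑ t', f t') =
      f t * Real.log (f t) - f t * Real.log (∑ t', f t') := by
    intro t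
    by_cases h : f t = 0
    · simp [h]
    · have : ∑ t', f t' ≠ 0 := fun e => h (sum_eq_zero_imp hf e t)
      rw [Real.log_div h this]; ring
  simp_rw [this, Finset.sum_sub_distrib, ← Finset.sum_mul, Real.negMulLog]
  simp [Finset.sum_neg_distrib]; ring

lemma hE_superadd {T X Y Z : Type*} [Fintype T] [Fintype X] [Fintype Y] [Fintype Z]
    (Wy : X → Y → ℝ) (hWy : IsChannel Wy) (Wz : X → Z → ℝ) (q : Y → Z → ℝ) (hq : IsChannel q)
    (hd : ∀ x z, Wz x z = ∑ y, Wy x y * q y z) (μ : T → X → ℝ) (hμ : ∀ t x, 0 ≤ μ t x) :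
    ∑ t, (hE Wy (μ t) - hE Wz (μ t)) ≤ hE Wy (fun x => ∑ t, μ t x) - hE Wz (fun x => ∑ t, μ t x) := by
  have h := dataproc (fun t y => ∑ x, μ t x * Wy x y)
    (fun t y => Finset.sum_nonneg fun x _ => mul_nonneg (hμ _ _) ((hWy x).1 y)) q hq
  have e : ∀ t z, ∑ y, (∑ x, μ t x * Wy x y) * q y z = ∑ x, μ t x * Wz x z := by
    intro t z
    simp_rw [hd, Finset.sum_mul, Finset.mul_sum]
    rw [Finset.sum_comm]; simp_rw [mul_assoc]
  have hz : ∀ x z, 0 ≤ Wz x z := fun x z => by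
    rw [hd]; exact Finset.sum_nonneg fun y _ => mul_nonneg ((hWy x).1 y) ((hq y).1 z)
  simp_rw [e] at h
  rw [Finset.sum_comm] at h
  rw [Finset.sum_comm (s := (Finset.univ : Finset T)) (t := (Finset.univ : Finset Y))] at h
  simp_rw [← negMulLog_sum_sub (fun t => ∑ x, μ t x * Wz x _) (fun t => Finset.sum_nonneg fun x _ => mul_nonneg (hμ _ _) (hz _ _)),
   ← negMulLog_sum_sub (fun t => ∑ x, μ t x * Wy x _) (fun t => Finset.sum_nonneg fun x _ => mul_nonneg (hμ _ _) ((hWy x).1 _))] at h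
  unfold hE
  have e2 : ∀ (y : Y), ∑ x, (∑ t, μ t x) * Wy x y = ∑ t, ∑ x, μ t x * Wy x y := by
    intro y
    rw [Finset.sum_comm]; simp_rw [Finset.sum_mul]
  have e3 : ∀ (y : Z), ∑ x, (∑ t, μ t x) * Wz x y = ∑ t, ∑ x, μ t x * Wz x y := by
    intro y
    rw [Finset.sum_comm]; simp_rw [Finset.sum_mul]
  simp_rw [e2, e3]
  simp_rw [Finset.sum_sub_distrib] at h ⊢
  rw [Finset.sum_comm (s := (Finset.univ : Finset T)) (t := (Finset.univ : Finset Y)), Finset.sum_comm (s := (Finset.univ : Finset T)) (t := (Finset.univ : Finset Z))]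
  linarith

lemma mul_sum2 {A B : Type*} [Fintype A] [Fintype B] (k : ℝ) (T : A → B → ℝ) :
    k * ∑ a, ∑ b, T a b = ∑ a, ∑ b, k * T a b := by simp only [Finset.mul_sum]

lemma mul_sum3 {A B C : Type*} [Fintype A] [Fintype B] [Fintype C] (k : ℝ) (T : A → B → C → ℝ) :
    k * ∑ a, ∑ b, ∑ c, T a b c = ∑ a, ∑ b, ∑ c, k * T a b c := by simp only [Finset.mul_sum]

lemma mutInfo_eq {A B : Type*} [Fintype A] [Fintype B] (p : A × B → ℝ) (hp : ∀ t, 0 ≤ p t) :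
    Real.log 2 * mutInfo p = (∑ a, Real.negMulLog (∑ b, p (a, b))) +
      (∑ b, Real.negMulLog (∑ a, p (a, b))) - ∑ a, ∑ b, Real.negMulLog (p (a, b)) := by
  have h2 : Real.log 2 ≠ 0 := (Real.log_pos (by norm_num)).ne'
  have key : ∀ a b, Real.log 2 * (p (a, b) * Real.logb 2 (p (a, b) / ((∑ b, p (a, b)) * ∑ a, p (a, b)))) =
      -(p (a, b) * Real.log (∑ b, p (a, b))) - p (a, b) * Real.log (∑ a, p (a, b)) - Real.negMulLog (p (a, b)) := by
    intro a b
    by_cases h : p (a, b) = 0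
    · simp [h]
    · have h1 : ∑ b, p (a, b) ≠ 0 := fun e => h (sum_eq_zero_imp (fun b => hp (a, b)) e b)
      have h3 : ∑ a, p (a, b) ≠ 0 := fun e => h (sum_eq_zero_imp (fun a => hp (a, b)) e a)
      rw [Real.logb, Real.log_div h (mul_ne_zero h1 h3), Real.log_mul h1 h3, Real.negMulLog]
      field_simp
      ring
  unfold mutInfo
  rw [Fintype.sum_prod_type, mul_sum2]
  simp_rw [key, Finset.sum_sub_distrib]
  rw [Finset.sum_comm (f := fun a b => p (a, b) * Real.log (∑ a, p (a, b)))]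
  simp_rw [← Finset.sum_mul, Real.negMulLog, Finset.sum_neg_distrib, ← Finset.sum_mul]
  simp_rw [neg_mul, Finset.sum_neg_distrib]
  ring

lemma condMutInfo_eq {A B C : Type*} [Fintype A] [Fintype B] [Fintype C] (p : A × B × C → ℝ)
    (hp : ∀ t, 0 ≤ p t) :
    Real.log 2 * condMutInfo p = (∑ c, ∑ a, Real.negMulLog (∑ b, p (a, b, c))) +
      (∑ c, ∑ b, Real.negMulLog (∑ a, p (a, b, c))) - (∑ c, ∑ a, ∑ b, Real.negMulLog (p (a, b, c)))
      - ∑ c, Real.negMulLog (∑ a, ∑ b, p (a, b, c)) := by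
  have h2 : Real.log 2 ≠ 0 := (Real.log_pos (by norm_num)).ne'
  have key : ∀ c a b, Real.log 2 * (p (a, b, c) * Real.logb 2 (((∑ a, ∑ b, p (a, b, c)) * p (a, b, c))
       / ((∑ b, p (a, b, c)) * ∑ a, p (a, b, c)))) =
      -(p (a, b, c) * Real.log (∑ b, p (a, b, c))) - p (a, b, c) * Real.log (∑ a, p (a, b, c))
        - Real.negMulLog (p (a, b, c)) + p (a, b, c) * Real.log (∑ a, ∑ b, p (a, b, c)) := by
    intro c a b
    by_cases h : p (a, b, c) = 0
    · simp [h]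
    · have h1 : ∑ b, p (a, b, c) ≠ 0 := fun e => h (sum_eq_zero_imp (fun b => hp (a, b, c)) e b)
      have h3 : ∑ a, p (a, b, c) ≠ 0 := fun e => h (sum_eq_zero_imp (fun a => hp (a, b, c)) e a)
      have h4 : ∑ a, ∑ b, p (a, b, c) ≠ 0 := fun e =>
        h1 (sum_eq_zero_imp (fun a => Finset.sum_nonneg fun b _ => hp (a, b, c)) e a)
      rw [Real.logb, Real.log_div (mul_ne_zero h4 h) (mul_ne_zero h1 h3), Real.log_mul h1 h3,
        Real.log_mul h4 h, Real.negMulLog]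
      field_simp
      ring
  have e : ∀ F : A → B → C → ℝ, ∑ x : A × B × C, F x.1 x.2.1 x.2.2 = ∑ c, ∑ a, ∑ b, F a b c := by
    intro F
    simp_rw [Fintype.sum_prod_type]
    rw [Finset.sum_comm' (t' := Finset.univ) (s' := fun _ => Finset.univ) (by simp)]
    rw [Finset.sum_congr rfl (fun b _ => Finset.sum_comm), Finset.sum_comm]
    refine Finset.sum_congr rfl fun c _ => Finset.sum_comm
  unfold condMutInfo
  rw [e (fun a b c => p (a, b, c) * Real.logb 2 (((∑ a, ∑ b, p (a, b, c)) * p (a, b, c))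
       / ((∑ b, p (a, b, c)) * ∑ a, p (a, b, c)))), mul_sum3]
  simp_rw [key, Finset.sum_add_distrib, Finset.sum_sub_distrib]
  have e3 : ∀ c, ∑ a, ∑ b, p (a, b, c) * Real.log (∑ a, p (a, b, c)) =
    ∑ b, ∑ a, p (a, b, c) * Real.log (∑ a, p (a, b, c)) := fun c => Finset.sum_comm
  simp_rw [e3, ← Finset.sum_mul, Real.negMulLog, Finset.sum_neg_distrib, ← Finset.sum_mul]
  simp_rw [neg_mul, Finset.sum_neg_distrib]
  ring

section chan
variable {U V X Y : Type*} [Fintype U] [Fintype V] [Fintype X] [Fintype Y]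

lemma sum_chan (W : X → Y → ℝ) (hW : IsChannel W) (μ : X → ℝ) :
    ∑ y, ∑ x, μ x * W x y = ∑ x, μ x := by
  rw [Finset.sum_comm]
  simp_rw [← Finset.mul_sum, (hW _).2, mul_one]

lemma mutInfo_chan (W : X → Y → ℝ) (hW : IsChannel W) (p : U → V → X → ℝ)
    (hp : ∀ u v x, 0 ≤ p u v x) :
    Real.log 2 * mutInfo (fun q : V × Y => ∑ u, ∑ x, p u q.1 x * W x q.2) =
      (∑ v, Real.negMulLog (∑ x, ∑ u, p u v x)) + hE W (fun x => ∑ v, ∑ u, p u v x)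
        - ∑ v, hE W (fun x => ∑ u, p u v x) := by
  have e : ∀ v y, ∑ u, ∑ x, p u v x * W x y = ∑ x, (∑ u, p u v x) * W x y := by
    intro v y; rw [Finset.sum_comm]; simp_rw [Finset.sum_mul]
  rw [mutInfo_eq _ (fun t => Finset.sum_nonneg fun _ _ => Finset.sum_nonneg fun _ _ =>
    mul_nonneg (hp _ _ _) ((hW _).1 _))]
  simp only [e, sum_chan W hW]
  unfold hE
  congr 2
  refine Finset.sum_congr rfl fun y _ => ?_
  rw [Finset.sum_comm]; simp_rw [Finset.sum_mul]

lemma condMutInfo_chan (W : X → Y → ℝ) (hW : IsChannel W) (p : U → V → X → ℝ)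
    (hp : ∀ u v x, 0 ≤ p u v x) :
    Real.log 2 * condMutInfo (fun t : V × Y × U => ∑ x, p t.2.2 t.1 x * W x t.2.1) =
      (∑ u, ∑ v, Real.negMulLog (∑ x, p u v x)) + (∑ u, hE W (fun x => ∑ v, p u v x))
        - (∑ u, ∑ v, hE W (fun x => p u v x)) - ∑ u, Real.negMulLog (∑ v, ∑ x, p u v x) := by
  rw [condMutInfo_eq _ (fun t => Finset.sum_nonneg fun _ _ =>
    mul_nonneg (hp _ _ _) ((hW _).1 _))]
  simp only [sum_chan W hW]
  unfold hE
  congr 3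
  refine Finset.sum_congr rfl fun u _ => Finset.sum_congr rfl fun y _ => ?_
  rw [Finset.sum_comm]; simp_rw [Finset.sum_mul]
end chan

section W
variable {X Y Z1 Z2 : Type} [Fintype X] [Fintype Y] [Fintype Z1] [Fintype Z2]

lemma WY_chan {W : X → Y × Z1 × Z2 → ℝ} (hW : IsChannel W) : IsChannel (WY W) := by
  refine fun x => ⟨fun y => Finset.sum_nonneg fun _ _ => Finset.sum_nonneg fun _ _ => (hW x).1 _, ?_⟩
  rw [← (hW x).2]; simp [WY, Fintype.sum_prod_type]

lemma WZ1_chan {W : X → Y × Z1 × Z2 → ℝ} (hW : IsChannel W) : IsChannel (WZ1 W) := by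
  refine fun x => ⟨fun y => Finset.sum_nonneg fun _ _ => Finset.sum_nonneg fun _ _ => (hW x).1 _, ?_⟩
  rw [← (hW x).2]; simp only [WZ1, Fintype.sum_prod_type]; rw [Finset.sum_comm]

lemma WZ2_chan {W : X → Y × Z1 × Z2 → ℝ} (hW : IsChannel W) : IsChannel (WZ2 W) := by
  refine fun x => ⟨fun y => Finset.sum_nonneg fun _ _ => Finset.sum_nonneg fun _ _ => (hW x).1 _, ?_⟩
  rw [← (hW x).2]; simp only [WZ2, Fintype.sum_prod_type]
  rw [Finset.sum_comm]
  exact Finset.sum_congr rfl fun y _ => Finset.sum_comm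

lemma degY {W : X → Y × Z1 × Z2 → ℝ} (h : DegradedYZ2 W) : ∃ q : Y → Z2 → ℝ, IsChannel q ∧
    ∀ x z, WZ2 W x z = ∑ y, WY W x y * q y z := by
  obtain ⟨q, hq, h⟩ := h
  exact ⟨q, hq, fun x z => Finset.sum_congr rfl fun y _ => h x y z⟩

lemma degZ {W : X → Y × Z1 × Z2 → ℝ} (h : DegradedZ1Z2 W) : ∃ q : Z1 → Z2 → ℝ, IsChannel q ∧
    ∀ x z, WZ2 W x z = ∑ y, WZ1 W x y * q y z := by
  obtain ⟨q, hq, h⟩ := h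
  refine ⟨q, hq, fun x z => ?_⟩
  unfold WZ2 WZ1
  rw [Finset.sum_comm]
  exact Finset.sum_congr rfl fun y _ => h x y z
end W

section hom
variable {X Y : Type*} [Fintype X] [Fintype Y]

lemma hE_smul (W : X → Y → ℝ) (hW : IsChannel W) (c : ℝ) (μ : X → ℝ) :
    hE W (c • μ) = Real.negMulLog c * (∑ x, μ x) + c * hE W μ := by
  unfold hE
  have : ∀ y, ∑ x, (c • μ) x * W x y = c * ∑ x, μ x * W x y := by
    intro y; rw [Finset.mul_sum]; exact Finset.sum_congr rfl fun x _ => by simp [mul_assoc]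
  simp_rw [this, Real.negMulLog_mul, Finset.sum_add_distrib, ← Finset.sum_mul, sum_chan W hW,
    ← Finset.mul_sum]
  ring

lemma hE_cont (W : X → Y → ℝ) : Continuous (hE W) := by
  unfold hE
  refine continuous_finsetSum _ fun y _ => Real.continuous_negMulLog.comp ?_
  refine continuous_finsetSum _ fun x _ => ?_
  fun_prop
end hom

lemma compact_hull {E : Type*} [NormedAddCommGroup E] [NormedSpace ℝ E] [FiniteDimensional ℝ E]
    {s : Set E} (hs : IsCompact s) : IsCompact (convexHull ℝ s) := by
  rcases s.eq_empty_or_nonempty with rfl | ⟨s0, hs0⟩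
  · simp
  let N := Module.finrank ℝ E + 1
  have hc : IsCompact ((fun t : (Fin N → ℝ) × (Fin N → E) => ∑ i, t.1 i • t.2 i) ''
      (stdSimplex ℝ (Fin N) ×ˢ Set.pi Set.univ (fun _ => s))) := by
    refine IsCompact.image ((isCompact_stdSimplex ℝ _).prod (isCompact_univ_pi fun _ => hs)) ?_
    fun_prop
  convert hc using 1
  ext x
  constructor
  · intro hx
    obtain ⟨ι, _, z, w, hz, haff, hw, hw1, rfl⟩ := eq_pos_convex_span_of_mem_convexHull hx
    have hcard : Fintype.card ι ≤ Fintype.card (Fin N) := by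
      rw [Fintype.card_fin]
      exact haff.card_le_finrank_succ.trans (Nat.succ_le_succ (Submodule.finrank_le _))
    obtain ⟨e⟩ := Function.Embedding.nonempty_of_card_le hcard
    refine ⟨(Function.extend e w 0, Function.extend e z (fun _ => s0)), ⟨⟨fun j => ?_, ?_⟩, ?_⟩, ?_⟩
    · by_cases h : ∃ i, e i = j
      · obtain ⟨i, rfl⟩ := h
        simp only [e.injective.extend_apply]; exact (hw i).le
      · simp only [Function.extend_apply' _ _ _ h]; exact le_rfl
    · rw [← hw1]
      refine (Fintype.sum_of_injective e e.injective w _ ?_ ?_).symm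
      · intro j hj; simp only [Function.extend_apply' _ _ _ hj]; rfl
      · intro i; simp only [e.injective.extend_apply]
    · intro j _
      by_cases h : ∃ i, e i = j
      · obtain ⟨i, rfl⟩ := h
        simp only [e.injective.extend_apply]; exact hz ⟨i, rfl⟩
      · simp only [Function.extend_apply' _ _ _ h]; exact hs0
    · refine (Fintype.sum_of_injective e e.injective (fun i => w i • z i) _ ?_ ?_).symm
      · intro j hj; simp only [Function.extend_apply' _ _ _ hj]; simp
      · intro i; simp only [e.injective.extend_apply]
  · rintro ⟨t, ⟨ht1, ht2⟩, rfl⟩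
    exact (convex_convexHull ℝ s).sum_mem (fun i _ => ht1.1 i) ht1.2
      (fun i _ => subset_convexHull _ _ (ht2 i trivial))

section clos
variable {X Y Z1 Z2 : Type} [Fintype X] [Fintype Y] [Fintype Z1] [Fintype Z2]

def aF (W : X → Y × Z1 × Z2 → ℝ) (μ : X → ℝ) : ℝ := hE (WY W) μ - hE (WZ1 W) μ
def bF (W : X → Y × Z1 × Z2 → ℝ) (μ : X → ℝ) : ℝ := hE (WY W) μ - hE (WZ2 W) μ

variable {W : X → Y × Z1 × Z2 → ℝ}

lemma aF_smul (hW : IsChannel W) (c : ℝ) (μ : X → ℝ) : aF W (c • μ) = c * aF W μ := by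
  simp only [aF, hE_smul _ (WY_chan hW), hE_smul _ (WZ1_chan hW)]; ring
lemma bF_smul (hW : IsChannel W) (c : ℝ) (μ : X → ℝ) : bF W (c • μ) = c * bF W μ := by
  simp only [bF, hE_smul _ (WY_chan hW), hE_smul _ (WZ2_chan hW)]; ring
lemma aF_cont : Continuous (aF W) := (hE_cont _).sub (hE_cont _)
lemma bF_cont : Continuous (bF W) := (hE_cont _).sub (hE_cont _)
lemma aF_zero (hW : IsChannel W) : aF W 0 = 0 := by simpa using aF_smul hW 0 0
lemma bF_zero (hW : IsChannel W) : bF W 0 = 0 := by simpa using bF_smul hW 0 0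

def KG (W : X → Y × Z1 × Z2 → ℝ) : Set ((X → ℝ) × ℝ × ℝ) :=
  convexHull ℝ ((fun q => (q, aF W q, bF W q)) '' stdSimplex ℝ X)
def K2 (W : X → Y × Z1 × Z2 → ℝ) : Set ((X → ℝ) × ℝ × ℝ) :=
  convexHull ℝ ((fun t : (X → ℝ) × ℝ × ℝ => (t.1, aF W t.1 - t.2.1, t.2.2)) '' KG W)

lemma K2_compact : IsCompact (K2 W) := by
  refine compact_hull (IsCompact.image (compact_hull (IsCompact.image ?_ ?_)) ?_)
  · exact isCompact_stdSimplex ℝ X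
  · exact continuous_id.prodMk (aF_cont.prodMk bF_cont)
  · exact continuous_fst.prodMk (((aF_cont.comp continuous_fst).sub (by fun_prop)).prodMk (by fun_prop))

lemma cone_sum {E ι : Type*} [AddCommGroup E] [Module ℝ E] [Fintype ι] {S : Set E}
    (hS : Convex ℝ S) (c : ι → ℝ) (e : ι → E) (hc : ∑ i, c i = 1)
    (h : ∀ i, (c i = 0 ∧ e i = 0) ∨ (0 < c i ∧ (c i)⁻¹ • e i ∈ S)) : ∑ i, e i ∈ S := by
  classical
  have h0 : ∑ i, e i = ∑ i ∈ Finset.univ.filter (fun i => 0 < c i), c i • ((c i)⁻¹ • e i) := by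
    rw [Finset.sum_filter]
    refine Finset.sum_congr rfl fun i _ => ?_
    rcases h i with h | h
    · simp [h.1, h.2]
    · rw [if_pos h.1, smul_smul, mul_inv_cancel₀ h.1.ne', one_smul]
  rw [h0]
  refine hS.sum_mem (fun i hi => (Finset.mem_filter.1 hi).2.le) ?_ ?_
  · rw [← hc, Finset.sum_filter]
    refine Finset.sum_congr rfl fun i _ => ?_
    rcases h i with h | h
    · simp [h.1]
    · simp [h.1]
  · intro i hi
    rcases h i with h | h
    · have := (Finset.mem_filter.1 hi).2; simp [h.1] at this
    · exact h.2

lemma toKG (hW : IsChannel W) {M : Type*} [Fintype M] (μ : M → X → ℝ) (hμ : ∀ m x, 0 ≤ μ m x)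
    (h1 : ∑ m, ∑ x, μ m x = 1) :
    ∑ m, ((μ m, aF W (μ m), bF W (μ m)) : (X → ℝ) × ℝ × ℝ) ∈ KG W := by
  refine cone_sum (convex_convexHull ℝ _) (fun m => ∑ x, μ m x) _ h1 fun m => ?_
  rcases (Finset.sum_nonneg fun x (_ : x ∈ Finset.univ) => hμ m x).eq_or_lt with h | h
  · left
    have : μ m = 0 := funext fun x => sum_eq_zero_imp (hμ m) h.symm x
    refine ⟨h.symm, ?_⟩
    rw [this, aF_zero hW, bF_zero hW]; rfl
  · right
    refine ⟨h, subset_convexHull _ _ ⟨(∑ x, μ m x)⁻¹ • μ m, ⟨fun x => ?_, ?_⟩, ?_⟩⟩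
    · exact mul_nonneg (inv_nonneg.2 h.le) (hμ m x)
    · simp only [Pi.smul_apply, smul_eq_mul, ← Finset.mul_sum]
      exact inv_mul_cancel₀ h.ne'
    · simp [aF_smul hW, bF_smul hW]

lemma toK2 (hW : IsChannel W) {U M : Type*} [Fintype U] [Fintype M] (μ : U → M → X → ℝ)
    (hμ : ∀ u m x, 0 ≤ μ u m x) (h1 : ∑ u, ∑ m, ∑ x, μ u m x = 1) :
    ((fun x => ∑ u, ∑ m, μ u m x, (∑ u, aF W (fun x => ∑ m, μ u m x)) - ∑ u, ∑ m, aF W (μ u m),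
      ∑ u, ∑ m, bF W (μ u m)) : (X → ℝ) × ℝ × ℝ) ∈ K2 W := by
  have key := cone_sum (S := K2 W) (convex_convexHull ℝ _) (fun u => ∑ m, ∑ x, μ u m x)
    (fun u => ((fun x => ∑ m, μ u m x, aF W (fun x => ∑ m, μ u m x) - ∑ m, aF W (μ u m),
      ∑ m, bF W (μ u m)) : (X → ℝ) × ℝ × ℝ)) h1 fun u => ?_
  · convert key using 1
    refine Prod.ext ?_ (Prod.ext ?_ ?_)
    · rw [Prod.fst_sum]; funext x; simp
    · simp [Prod.snd_sum, Prod.fst_sum]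
    · simp [Prod.snd_sum]
  · rcases (Finset.sum_nonneg fun m (_ : m ∈ Finset.univ) => Finset.sum_nonneg fun x
      (_ : x ∈ Finset.univ) => hμ u m x).eq_or_lt with h | h
    · left
      have h0 : ∀ m, μ u m = 0 := fun m => funext fun x => sum_eq_zero_imp (hμ u m)
        (sum_eq_zero_imp (fun m => Finset.sum_nonneg fun x _ => hμ u m x) h.symm m) x
      refine ⟨h.symm, ?_⟩
      have : (fun _ => 0 : X → ℝ) = 0 := rfl
      simp [h0, aF_zero hW, bF_zero hW, this]
    · right
      refine ⟨h, subset_convexHull _ _ ?_⟩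
      set c := ∑ m, ∑ x, μ u m x with hc
      have h2 := toKG hW (fun m => c⁻¹ • μ u m) (fun m x => mul_nonneg (inv_nonneg.2 h.le) (hμ u m x))
        (by simp only [Pi.smul_apply, smul_eq_mul, ← Finset.mul_sum]; exact inv_mul_cancel₀ h.ne')
      refine ⟨_, h2, ?_⟩
      have e : ∑ m, c⁻¹ • μ u m = c⁻¹ • (fun x => ∑ m, μ u m x) := by
        funext x; simp [Finset.mul_sum]
      refine Prod.ext ?_ (Prod.ext ?_ ?_)
      · simp [Prod.fst_sum, e]
      · simp only [Prod.fst_sum, Prod.snd_sum, e, aF_smul hW, Prod.smul_fst, Prod.smul_snd, smul_eq_mul, mul_sub, Finset.mul_sum]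
      · simp [Prod.snd_sum, bF_smul hW, Finset.mul_sum]

open Classical in
lemma toRegionFin (hW : IsChannel W) (kU kV : ℕ) (f : Fin kV → Fin kU) (μ : Fin kV → X → ℝ)
    (hμ : ∀ v x, 0 ≤ μ v x) (h1 : ∑ v, ∑ x, μ v x = 1) :
    ∃ pUVX : Fin kU × Fin kV × X → ℝ, IsPMF pUVX ∧
        (∀ u v x,
          pUVX (u, v, x) * (∑ u', ∑ x', pUVX (u', v, x')) =
            (∑ x', pUVX (u, v, x')) * (∑ u', pUVX (u', v, x))) ∧
        Real.log 2 * (condMutInfo (fun t : Fin kV × Y × Fin kU =>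
              ∑ x, pUVX (t.2.2, t.1, x) * WY W x t.2.1) -
            condMutInfo (fun t : Fin kV × Z1 × Fin kU =>
              ∑ x, pUVX (t.2.2, t.1, x) * WZ1 W x t.2.1)) =
          (∑ u, aF W (fun x => ∑ v, if f v = u then μ v x else 0)) - ∑ v, aF W (μ v) ∧
        Real.log 2 * (mutInfo (fun q : Fin kV × Y => ∑ u, ∑ x, pUVX (u, q.1, x) * WY W x q.2) -
            mutInfo (fun q : Fin kV × Z2 => ∑ u, ∑ x, pUVX (u, q.1, x) * WZ2 W x q.2)) =
          bF W (fun x => ∑ v, μ v x) - ∑ v, bF W (μ v) := by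
  have hs : ∀ v x, ∑ u, (if f v = u then μ v x else 0) = μ v x := by intro v x; simp
  refine ⟨fun t => if f t.2.1 = t.1 then μ t.2.1 t.2.2 else 0, ⟨fun t => ?_, ?_⟩, ?_, ?_, ?_⟩
  · dsimp only; split_ifs; exacts [hμ _ _, le_rfl]
  · rw [Fintype.sum_prod_type]; simp_rw [Fintype.sum_prod_type]
    rw [Finset.sum_comm, ← h1]
    refine Finset.sum_congr rfl fun v _ => ?_
    rw [Finset.sum_comm]
    simp
  · intro u v x
    dsimp only
    rw [Finset.sum_comm]
    simp_rw [hs]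
    split_ifs <;> simp [mul_comm]
  · have hp : ∀ u v x, 0 ≤ (fun u v x => if f v = u then μ v x else 0 : Fin kU → Fin kV → X → ℝ) u v x := by
      intro u v x; dsimp only; split_ifs; exacts [hμ _ _, le_rfl]
    have e1 := condMutInfo_chan (WY W) (WY_chan hW) _ hp
    have e2 := condMutInfo_chan (WZ1 W) (WZ1_chan hW) _ hp
    rw [mul_sub]
    dsimp only at e1 e2 ⊢
    rw [e1, e2]
    have e3 : ∑ v, aF W (μ v) = ∑ u, ∑ v, aF W (fun x => if f v = u then μ v x else 0) := by
      rw [Finset.sum_comm]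
      refine Finset.sum_congr rfl fun v _ => ?_
      rw [Finset.sum_eq_single (f v)]
      · simp
      · intro u _ hu
        simp only [Ne.symm hu, if_false]
        exact aF_zero hW
      · simp
    rw [e3]
    simp only [aF, Finset.sum_sub_distrib]
    ring
  · have hp : ∀ u v x, 0 ≤ (fun u v x => if f v = u then μ v x else 0 : Fin kU → Fin kV → X → ℝ) u v x := by
      intro u v x; dsimp only; split_ifs; exacts [hμ _ _, le_rfl]
    have e1 := mutInfo_chan (WY W) (WY_chan hW) _ hp
    have e2 := mutInfo_chan (WZ2 W) (WZ2_chan hW) _ hp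
    rw [mul_sub]
    dsimp only at e1 e2 ⊢
    rw [e1, e2]
    simp_rw [hs]
    simp only [bF, Finset.sum_sub_distrib]
    ring

open Classical in
lemma toRegion (hW : IsChannel W) {U V : Type} [Fintype U] [Fintype V] (f : V → U) (μ : V → X → ℝ)
    (hμ : ∀ v x, 0 ≤ μ v x) (h1 : ∑ v, ∑ x, μ v x = 1) :
    ∃ (kU kV : ℕ) (pUVX : Fin kU × Fin kV × X → ℝ), IsPMF pUVX ∧
        (∀ u v x,
          pUVX (u, v, x) * (∑ u', ∑ x', pUVX (u', v, x')) =
            (∑ x', pUVX (u, v, x')) * (∑ u', pUVX (u', v, x))) ∧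
        Real.log 2 * (condMutInfo (fun t : Fin kV × Y × Fin kU =>
              ∑ x, pUVX (t.2.2, t.1, x) * WY W x t.2.1) -
            condMutInfo (fun t : Fin kV × Z1 × Fin kU =>
              ∑ x, pUVX (t.2.2, t.1, x) * WZ1 W x t.2.1)) =
          (∑ u, aF W (fun x => ∑ v, if f v = u then μ v x else 0)) - ∑ v, aF W (μ v) ∧
        Real.log 2 * (mutInfo (fun q : Fin kV × Y => ∑ u, ∑ x, pUVX (u, q.1, x) * WY W x q.2) -
            mutInfo (fun q : Fin kV × Z2 => ∑ u, ∑ x, pUVX (u, q.1, x) * WZ2 W x q.2)) =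
          bF W (fun x => ∑ v, μ v x) - ∑ v, bF W (μ v) := by
  let eU := Fintype.equivFin U
  let eV := Fintype.equivFin V
  obtain ⟨p, hp1, hp2, hp3, hp4⟩ := toRegionFin hW (Fintype.card U) (Fintype.card V)
    (fun v => eU (f (eV.symm v))) (fun v => μ (eV.symm v)) (fun v => hμ _)
    (by rw [← h1]; exact Equiv.sum_comp eV.symm (fun v => ∑ x, μ v x))
  refine ⟨_, _, p, hp1, hp2, hp3.trans ?_, hp4.trans ?_⟩
  · congr 1
    · rw [← Equiv.sum_comp eU]
      refine Finset.sum_congr rfl fun u _ => ?_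
      congr 1; funext x
      rw [← Equiv.sum_comp eV]
      simp
    · exact Equiv.sum_comp eV.symm (fun v => aF W (μ v))
  · congr 1
    · congr 1; funext x; exact Equiv.sum_comp eV.symm (fun v => μ v x)
    · exact Equiv.sum_comp eV.symm (fun v => bF W (μ v))

lemma fromK2 (hW : IsChannel W) (t : (X → ℝ) × ℝ × ℝ) (ht : t ∈ K2 W) :
    ∃ (kU kV : ℕ) (pUVX : Fin kU × Fin kV × X → ℝ), IsPMF pUVX ∧
        (∀ u v x,
          pUVX (u, v, x) * (∑ u', ∑ x', pUVX (u', v, x')) =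
            (∑ x', pUVX (u, v, x')) * (∑ u', pUVX (u', v, x))) ∧
        Real.log 2 * (condMutInfo (fun t : Fin kV × Y × Fin kU =>
              ∑ x, pUVX (t.2.2, t.1, x) * WY W x t.2.1) -
            condMutInfo (fun t : Fin kV × Z1 × Fin kU =>
              ∑ x, pUVX (t.2.2, t.1, x) * WZ1 W x t.2.1)) = t.2.1 ∧
        Real.log 2 * (mutInfo (fun q : Fin kV × Y => ∑ u, ∑ x, pUVX (u, q.1, x) * WY W x q.2) -
            mutInfo (fun q : Fin kV × Z2 => ∑ u, ∑ x, pUVX (u, q.1, x) * WZ2 W x q.2)) =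
          bF W t.1 - t.2.2 := by
  classical
  obtain ⟨ι, _, w, a, hw0, hw1, ha, rfl⟩ := mem_convexHull_iff_exists_fintype.1 ht
  choose g hg hga using ha
  choose κ inst c z hc0 hc1 hz hzg using fun i => mem_convexHull_iff_exists_fintype.1 (hg i)
  choose q hq hqz using hz
  have hsum : ∀ i (F : (j : ι) → κ j → ℝ), ∑ v : (Σ i, κ i), (if v.1 = i then F v.1 v.2 else 0) = ∑ l, F i l := by
    intro i F
    rw [Fintype.sum_sigma, Finset.sum_eq_single i]
    · simp
    · intro j _ hj; simp [hj]
    · simp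
  obtain ⟨kU, kV, p, h1, h2, h3, h4⟩ := toRegion hW (U := ι) (V := Σ i, κ i) (fun v => v.1)
    (fun v => (w v.1 * c v.1 v.2) • q v.1 v.2)
    (fun v x => mul_nonneg (mul_nonneg (hw0 _) (hc0 _ _)) ((hq _ _).1 x)) (by
      simp only [Pi.smul_apply, smul_eq_mul, ← Finset.mul_sum, (hq _ _).2]
      rw [Fintype.sum_sigma]
      simp [← Finset.mul_sum, hc1, hw1])
  have hg1 : ∀ i, (g i).1 = fun x => ∑ l, c i l * q i l x := by
    intro i; rw [← hzg i, Prod.fst_sum]; funext x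
    simp [← hqz]
  have hg2 : ∀ i, (g i).2.1 = ∑ l, c i l * aF W (q i l) := by
    intro i; rw [← hzg i]; simp [Prod.fst_sum, Prod.snd_sum, ← hqz]
  have hg3 : ∀ i, (g i).2.2 = ∑ l, c i l * bF W (q i l) := by
    intro i; rw [← hzg i]; simp [Prod.snd_sum, ← hqz]
  refine ⟨kU, kV, p, h1, h2, h3.trans ?_, h4.trans ?_⟩
  · have e1 : ∀ i, (fun x => ∑ v : (Σ i, κ i), if v.1 = i then ((w v.1 * c v.1 v.2) • q v.1 v.2) x else 0)
        = w i • (g i).1 := by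
      intro i; funext x
      rw [hsum i (fun j l => ((w j * c j l) • q j l) x), hg1]
      simp [Finset.mul_sum, mul_assoc]
    simp only [e1, aF_smul hW]
    rw [Fintype.sum_sigma]
    simp only [Prod.snd_sum, Prod.fst_sum, ← hga, Prod.smul_snd, Prod.smul_fst, smul_eq_mul, mul_sub, Finset.sum_sub_distrib, hg2]
    simp [Finset.mul_sum, mul_assoc]
  · congr 1
    · congr 1; funext x
      rw [Fintype.sum_sigma]
      simp [Prod.fst_sum, ← hga, hg1, Finset.mul_sum, mul_assoc]
    · rw [Fintype.sum_sigma]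
      simp [Prod.snd_sum, ← hga, hg3, Finset.mul_sum, mul_assoc, bF_smul hW]
end clos

section ent
open Classical
variable {Ω α β γ δ : Type*} [Fintype Ω] [Fintype α] [Fintype β] [Fintype γ]

def pr (P : Ω → ℝ) (f : Ω → α) (a : α) : ℝ := ∑ ω, if f ω = a then P ω else 0
def Hn (P : Ω → ℝ) (f : Ω → α) : ℝ := - ∑ ω, P ω * Real.log (pr P f (f ω))

lemma pr_nonneg {P : Ω → ℝ} (hP : ∀ ω, 0 ≤ P ω) (f : Ω → α) (a : α) : 0 ≤ pr P f a :=
  Finset.sum_nonneg fun ω _ => by split_ifs; exacts [hP _, le_rfl]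

lemma pr_expect (P : Ω → ℝ) (f : Ω → α) (F : α → ℝ) : ∑ a, pr P f a * F a = ∑ ω, P ω * F (f ω) := by
  unfold pr
  simp_rw [Finset.sum_mul]
  rw [Finset.sum_comm]
  refine Finset.sum_congr rfl fun ω _ => ?_
  simp

lemma pr_sum (P : Ω → ℝ) (f : Ω → α) : ∑ a, pr P f a = ∑ ω, P ω := by
  simpa using pr_expect P f (fun _ => 1)

lemma Hn_eq (P : Ω → ℝ) (f : Ω → α) : Hn P f = ∑ a, Real.negMulLog (pr P f a) := by
  unfold Hn
  rw [← pr_expect P f (fun a => Real.log (pr P f a)), ← Finset.sum_neg_distrib]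
  simp [Real.negMulLog]

lemma Hn_congr (P : Ω → ℝ) (f : Ω → α) (g : Ω → β) (h : ∀ ω ω', f ω = f ω' ↔ g ω = g ω') :
    Hn P f = Hn P g := by
  unfold Hn pr
  simp_rw [h]

lemma pr_snd (P : Ω → ℝ) (f : Ω → α) (g : Ω → β) (b : β) :
    ∑ a, pr P (fun ω => (f ω, g ω)) (a, b) = pr P g b := by
  unfold pr
  rw [Finset.sum_comm]
  refine Finset.sum_congr rfl fun ω _ => ?_
  by_cases h : g ω = b <;> simp [h]

lemma pr_fst (P : Ω → ℝ) (f : Ω → α) (g : Ω → β) (a : α) :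
    ∑ b, pr P (fun ω => (f ω, g ω)) (a, b) = pr P f a := by
  unfold pr
  rw [Finset.sum_comm]
  refine Finset.sum_congr rfl fun ω _ => ?_
  by_cases h : f ω = a <;> simp [h]

lemma Hn_mono {P : Ω → ℝ} (hP : ∀ ω, 0 ≤ P ω) (g : Ω → β) (k : Ω → γ)
    (h : ∀ ω ω', g ω = g ω' → k ω = k ω') : Hn P k ≤ Hn P g := by
  unfold Hn
  refine neg_le_neg (Finset.sum_le_sum fun ω _ => ?_)
  rcases (hP ω).eq_or_lt with h0 | h0
  · simp [← h0]
  refine mul_le_mul_of_nonneg_left (Real.log_le_log ?_ ?_) h0.le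
  · refine lt_of_lt_of_le h0 ?_
    have := Finset.single_le_sum (s := Finset.univ) (f := fun ω' => if g ω' = g ω then P ω' else 0)
      (fun ω' _ => by split_ifs; exacts [hP _, le_rfl]) (Finset.mem_univ ω)
    simpa [pr] using this
  · refine Finset.sum_le_sum fun ω' _ => ?_
    by_cases hg : g ω' = g ω
    · simp [hg, h _ _ hg]
    · simp only [hg, if_false]; split_ifs; exacts [hP _, le_rfl]

/-- conditioning on less increases entropy -/
lemma condH_anti {P : Ω → ℝ} (hP : ∀ ω, 0 ≤ P ω) (f : Ω → α) (g : Ω → β) (e : β → γ) :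
    Hn P (fun ω => (f ω, g ω)) - Hn P g ≤
      Hn P (fun ω => (f ω, e (g ω))) - Hn P (fun ω => e (g ω)) := by
  have h := dataproc (fun a b => pr P (fun ω => (f ω, g ω)) (a, b)) (fun a b => pr_nonneg hP _ _)
    (fun b c => if e b = c then 1 else 0) (fun b => ⟨fun c => by dsimp only; split_ifs <;> norm_num, by simp⟩)
  have e1 : ∀ a c, ∑ b, pr P (fun ω => (f ω, g ω)) (a, b) * (if e b = c then 1 else 0) =
      pr P (fun ω => (f ω, e (g ω))) (a, c) := by
    intro a c
    unfold pr
    simp_rw [Finset.sum_mul]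
    rw [Finset.sum_comm]
    refine Finset.sum_congr rfl fun ω _ => ?_
    rw [Finset.sum_eq_single (g ω)]
    · by_cases h1 : f ω = a <;> by_cases h2 : e (g ω) = c <;> simp [h1, h2]
    · intro b _ hb; simp [Ne.symm hb]
    · simp
  simp_rw [e1] at h
  rw [Finset.sum_comm] at h
  rw [Finset.sum_comm (s := (Finset.univ : Finset α)) (t := (Finset.univ : Finset β))] at h
  simp_rw [← negMulLog_sum_sub (fun a => pr P (fun ω => (f ω, g ω)) (a, _)) (fun _ => pr_nonneg hP _ _),
    ← negMulLog_sum_sub (fun a => pr P (fun ω => (f ω, e (g ω))) (a, _)) (fun _ => pr_nonneg hP _ _),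
    pr_snd, Finset.sum_sub_distrib] at h
  simp only [Hn_eq, Fintype.sum_prod_type]
  rw [Finset.sum_comm, Finset.sum_comm (s := (Finset.univ : Finset α)) (t := (Finset.univ : Finset γ))]
  linarith

lemma Hn_le_card {P : Ω → ℝ} (hP : ∀ ω, 0 ≤ P ω) (h1 : ∑ ω, P ω = 1) (f : Ω → α) :
    Hn P f ≤ Real.log (Fintype.card α) := by
  have h := logsum (pr P f) (fun _ => 1) (pr_nonneg hP f) (fun _ => zero_le_one) (by simp)
  rw [pr_sum, h1] at h
  simp only [Finset.sum_const, Finset.card_univ, nsmul_eq_mul, mul_one, one_div, Real.log_inv, div_one, one_mul] at h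
  rw [Hn_eq]
  simp only [Real.negMulLog, neg_mul, Finset.sum_neg_distrib]
  linarith

lemma Hn_deg {P : Ω → ℝ} (F : Ω → α) (h : Ω → γ) (q : α → γ → ℝ) (hq : ∀ a, ∑ c, q a c = 1)
    (hd : ∀ a c, pr P (fun ω => (F ω, h ω)) (a, c) = pr P F a * q a c) :
    Hn P (fun ω => (F ω, h ω)) = Hn P F + ∑ ω, P ω * ∑ c, Real.negMulLog (q (F ω) c) := by
  rw [← pr_expect P F (fun a => ∑ c, Real.negMulLog (q a c))]
  simp only [Hn_eq, Fintype.sum_prod_type, hd, Real.negMulLog_mul, Finset.sum_add_distrib,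
    ← Finset.sum_mul, hq, one_mul, ← Finset.mul_sum]

lemma fano {P : Ω → ℝ} (hP : ∀ ω, 0 ≤ P ω) (h1 : ∑ ω, P ω = 1) (f : Ω → α) (g : Ω → β) (d : β → α)
    {ε : ℝ} (h0 : 0 < ε) (h2 : ε < 1) (he : (∑ ω, if d (g ω) ≠ f ω then P ω else 0) ≤ ε)
    (hα : 0 < Fintype.card α) :
    Hn P (fun ω => (f ω, g ω)) - Hn P g ≤
      - Real.log (1 - ε) + Real.negMulLog ε + ε * Real.log (Fintype.card α) := by
  set K : ℝ := (Fintype.card α : ℝ) with hKdef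
  have hK : (1 : ℝ) ≤ K := by rw [hKdef]; exact_mod_cast hα
  have hK0 : 0 < K := by linarith
  let Q : α → β → ℝ := fun a b => if d b = a then 1 - ε else ε / K
  have hQ : ∀ a b, 0 < Q a b := by
    intro a b; dsimp only [Q]; split_ifs; linarith; positivity
  have hQs : ∀ b, ∑ a, Q a b ≤ 1 := by
    intro b
    have : ∀ a, Q a b ≤ (if d b = a then 1 - ε else 0) + ε / K := by
      intro a; dsimp only [Q]; split_ifs
      · have : 0 ≤ ε / K := by positivity
        linarith
      · linarith
    refine (Finset.sum_le_sum fun a _ => this a).trans ?_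
    rw [Finset.sum_add_distrib]
    simp only [Finset.sum_ite_eq, Finset.mem_univ, if_true, Finset.sum_const, Finset.card_univ, nsmul_eq_mul]
    have : (Fintype.card α : ℝ) * (ε / K) = ε := by
      change K * (ε / K) = ε
      field_simp
    rw [this]; linarith
  let p : α → β → ℝ := fun a b => pr P (fun ω => (f ω, g ω)) (a, b)
  have hp : ∀ a b, 0 ≤ p a b := fun a b => pr_nonneg hP _ _
  have hb : ∀ b, (∑ a, Real.negMulLog (p a b)) - Real.negMulLog (pr P g b) ≤ ∑ a, p a b * (- Real.log (Q a b)) := by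
    intro b
    have e : ∑ a, p a b = pr P g b := pr_snd P f g b
    have h3 := negMulLog_sum_sub (fun a => p a b) (fun a => hp a b)
    simp only [e] at h3
    have h4 := logsum (fun a => p a b) (fun a => pr P g b * Q a b) (fun a => hp a b)
      (fun a => mul_nonneg (pr_nonneg hP _ _) (hQ a b).le) (by
        intro a ha
        rcases mul_eq_zero.1 ha with h | h
        · rw [← e] at h; exact sum_eq_zero_imp (fun a => hp a b) h a
        · exact absurd h (hQ a b).ne')
    have h5 : ∑ a, p a b * Real.log (p a b / (pr P g b * Q a b)) =
        ∑ a, p a b * Real.log (p a b / pr P g b) + ∑ a, p a b * (- Real.log (Q a b)) := by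
      rw [← Finset.sum_add_distrib]
      refine Finset.sum_congr rfl fun a _ => ?_
      by_cases h : p a b = 0
      · simp [h]
      have h' : pr P g b ≠ 0 := fun h' => h (by rw [← e] at h'; exact sum_eq_zero_imp (fun a => hp a b) h' a)
      rw [← div_div, Real.log_div (div_ne_zero h h') (hQ a b).ne']; ring
    have h6 : 0 ≤ (∑ a, p a b) * Real.log ((∑ a, p a b) / ∑ a, pr P g b * Q a b) := by
      rw [e, ← Finset.mul_sum]
      rcases (pr_nonneg hP g b).eq_or_lt with h | h
      · simp [← h]
      · refine mul_nonneg h.le (Real.log_nonneg ?_)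
        have hQp : 0 < ∑ a, Q a b := Finset.sum_pos (fun a _ => hQ a b) ⟨d b, Finset.mem_univ _⟩
        rw [le_div_iff₀ (by positivity)]
        nlinarith [hQs b]
    linarith
  have hs := Finset.sum_le_sum (s := Finset.univ) fun b _ => hb b
  rw [Finset.sum_sub_distrib] at hs
  simp only [Hn_eq, Fintype.sum_prod_type]
  rw [Finset.sum_comm]
  refine hs.trans ?_
  rw [Finset.sum_comm]
  have e2 := pr_expect P (fun ω => (f ω, g ω)) (fun t => - Real.log (Q t.1 t.2))
  rw [Fintype.sum_prod_type] at e2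
  dsimp only [p]
  rw [e2]
  have h7 : ∀ ω, P ω * -Real.log (Q (f ω) (g ω)) ≤ P ω * (-Real.log (1 - ε)) +
      (if d (g ω) ≠ f ω then P ω else 0) * (Real.log K - Real.log ε) := by
    intro ω
    dsimp only [Q]
    by_cases h : d (g ω) = f ω
    · simp [h]
    · simp only [h, if_false, ne_eq, not_false_eq_true, if_true]
      rw [Real.log_div h0.ne' hK0.ne']
      have := mul_nonneg (hP ω) (neg_nonneg.2 (Real.log_nonpos (by linarith : 0 ≤ 1 - ε) (by linarith)))
      linarith
  refine (Finset.sum_le_sum fun ω _ => h7 ω).trans ?_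
  rw [Finset.sum_add_distrib, ← Finset.sum_mul, ← Finset.sum_mul, h1]
  have h8 : 0 ≤ Real.log K - Real.log ε := by
    have := Real.log_nonneg hK; have := Real.log_nonpos h0.le h2.le; linarith
  have := mul_le_mul_of_nonneg_right he h8
  simp only [Real.negMulLog]
  linarith

end ent

section conv
open Classical
variable {M X O C D A B α β γ : Type*} [Fintype M] [Fintype X] [Fintype O] [Fintype C] [Fintype D]
  [Fintype A] [Fintype B] [Fintype α] [Fintype β] [Fintype γ]

lemma sum_coord {n : ℕ} (i : Fin n) (F : (Fin n → O) → ℝ) (hF : ∀ os os', (∀ j, j ≠ i → os j = os' j) → F os = F os')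
    (w : Fin n → O → ℝ) (hw : ∑ o, w i o = 1) (h : O → ℝ) :
    ∑ os, F os * h (os i) * ∏ j, w j (os j) = (∑ os, F os * ∏ j, w j (os j)) * ∑ o, w i o * h o := by
  have key : ∀ h : O → ℝ, ∑ os, F os * h (os i) * ∏ j, w j (os j) =
      (∑ o, w i o * h o) * ∑ r : {j // j ≠ i} → O, (∏ j : {j // j ≠ i}, w j (r j)) *
        (if hO : Nonempty O then F ((Equiv.funSplitAt i O).symm (hO.some, r)) else 0) := by
    intro h
    rw [← (Equiv.funSplitAt i O).symm.sum_comp, Fintype.sum_prod_type, Finset.sum_mul_sum]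
    refine Finset.sum_congr rfl fun o _ => Finset.sum_congr rfl fun r _ => ?_
    have hO : Nonempty O := ⟨o⟩
    rw [dif_pos hO, hF _ ((Equiv.funSplitAt i O).symm (hO.some, r)), Fintype.prod_eq_mul_prod_subtype_ne _ i]
    · have : ∀ j : {j // j ≠ i}, (Equiv.funSplitAt i O).symm (o, r) j = r j := by
        intro j; simp [Equiv.funSplitAt, Equiv.piSplitAt, j.2]
      simp only [this]
      simp [Equiv.funSplitAt, Equiv.piSplitAt]
      ring
    · intro j hj
      simp [Equiv.funSplitAt, Equiv.piSplitAt, hj]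
  have k1 := key (fun _ => 1)
  simp only [mul_one, hw, one_mul] at k1
  rw [key h, ← k1]; ring

/-- joint law of message, inputs and outputs -/
def jl {n : ℕ} (W : X → O → ℝ) (k : M → (Fin n → X) → ℝ) (ω : M × (Fin n → X) × (Fin n → O)) : ℝ :=
  k ω.1 ω.2.1 * ∏ i, W (ω.2.1 i) (ω.2.2 i)

def chmap (W : X → O → ℝ) (φ : O → C) (x : X) (c : C) : ℝ := ∑ o, if φ o = c then W x o else 0

lemma chmap_chan {W : X → O → ℝ} (hW : IsChannel W) (φ : O → C) : IsChannel (chmap W φ) := by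
  intro x
  refine ⟨fun c => Finset.sum_nonneg fun o _ => ?_, ?_⟩
  · split_ifs; exacts [(hW x).1 o, le_rfl]
  · unfold chmap
    rw [Finset.sum_comm, ← (hW x).2]
    simp

variable {n : ℕ} {W : X → O → ℝ} {k : M → (Fin n → X) → ℝ}

lemma jl_nonneg (hW : IsChannel W) (hk : ∀ m xs, 0 ≤ k m xs) (ω) : 0 ≤ jl W k ω :=
  mul_nonneg (hk _ _) (Finset.prod_nonneg fun _ _ => (hW _).1 _)

lemma sum_prod_chan (hW : IsChannel W) (xs : Fin n → X) : ∑ os : Fin n → O, ∏ i, W (xs i) (os i) = 1 := by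
  rw [← Fintype.prod_sum]
  simp [(hW _).2]

lemma jl_sum (hW : IsChannel W) (h1 : ∑ m, ∑ xs, k m xs = 1) : ∑ ω, jl W k ω = 1 := by
  simp only [jl, Fintype.sum_prod_type, ← Finset.mul_sum, sum_prod_chan hW, mul_one, h1]

lemma memless (hW : IsChannel W) (i : Fin n) (g : M × (Fin n → O) → α)
    (hg : ∀ m os os', (∀ j, j ≠ i → os j = os' j) → g (m, os) = g (m, os')) (φ : O → C) (a : α) (c : C) :
    pr (jl W k) (fun ω => (g (ω.1, ω.2.2), φ (ω.2.2 i))) (a, c) =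
      ∑ x, pr (jl W k) (fun ω => (g (ω.1, ω.2.2), ω.2.1 i)) (a, x) * chmap W φ x c := by
  unfold pr
  simp_rw [Finset.sum_mul]
  rw [Finset.sum_comm]
  trans ∑ ω : M × (Fin n → X) × (Fin n → O), (if g (ω.1, ω.2.2) = a then jl W k ω else 0) * chmap W φ (ω.2.1 i) c
  swap
  · refine Finset.sum_congr rfl fun ω _ => ?_
    rw [Finset.sum_eq_single (ω.2.1 i)]
    · simp
    · intro x _ hx; simp [Ne.symm hx]
    · simp
  simp_rw [Fintype.sum_prod_type]
  refine Finset.sum_congr rfl fun m _ => Finset.sum_congr rfl fun xs _ => ?_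
  have h := sum_coord i (fun os => if g (m, os) = a then k m xs else 0) (by
    intro os os' h; simp only [hg m os os' h]) (fun j => W (xs j)) ((hW _).2) (fun o => if φ o = c then 1 else 0)
  simp only [jl]
  rw [← Finset.sum_mul]
  convert h using 1
  · refine Finset.sum_congr rfl fun os _ => ?_
    by_cases h1 : g (m, os) = a <;> by_cases h2 : φ (os i) = c <;> simp [h1, h2]
  · congr 1
    · refine Finset.sum_congr rfl fun os _ => ?_
      by_cases h1 : g (m, os) = a <;> simp [h1]
    · simp [chmap]

lemma letterwise (ψ : M → α) (φ : O → C) (a : α) (c : Fin n → C) :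
    pr (jl W k) (fun ω => (ψ ω.1, fun i => φ (ω.2.2 i))) (a, c) =
      ∑ m, ∑ xs, if ψ m = a then k m xs * ∏ i, chmap W φ (xs i) (c i) else 0 := by
  unfold pr
  simp_rw [Fintype.sum_prod_type]
  refine Finset.sum_congr rfl fun m _ => Finset.sum_congr rfl fun xs _ => ?_
  by_cases h : ψ m = a
  · simp only [h, Prod.mk.injEq, true_and, if_true, jl, chmap]
    rw [Fintype.prod_sum, Finset.mul_sum]
    refine Finset.sum_congr rfl fun os _ => ?_
    by_cases h2 : (fun i => φ (os i)) = c
    · simp [← h2]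
    · obtain ⟨i, hi⟩ := Function.ne_iff.1 h2
      rw [if_neg h2, Finset.prod_eq_zero (Finset.mem_univ i) (by simp [hi]), mul_zero]
  · simp [h]

lemma deg_n (φ : O → C) (φ2 : O → D) (q : C → D → ℝ) (hq : IsChannel q)
    (hd : ∀ x c d, chmap W (fun o => (φ o, φ2 o)) x (c, d) = chmap W φ x c * q c d) (ψ : M → α) :
    Hn (jl W k) (fun ω => (ψ ω.1, fun i => (φ (ω.2.2 i), φ2 (ω.2.2 i)))) =
      Hn (jl W k) (fun ω => (ψ ω.1, fun i => φ (ω.2.2 i))) +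
        ∑ ω, jl W k ω * ∑ d : Fin n → D, Real.negMulLog (∏ i, q (φ (ω.2.2 i)) (d i)) := by
  have h := Hn_deg (P := jl W k) (fun ω => (ψ ω.1, fun i => φ (ω.2.2 i))) (fun ω i => φ2 (ω.2.2 i))
    (fun a d => ∏ i, q (a.2 i) (d i)) (fun a => sum_prod_chan hq a.2) (by
      rintro ⟨a, c⟩ d
      have e : pr (jl W k) (fun ω => ((ψ ω.1, fun i => φ (ω.2.2 i)), fun i => φ2 (ω.2.2 i))) ((a, c), d) =
          pr (jl W k) (fun ω => (ψ ω.1, fun i => (φ (ω.2.2 i), φ2 (ω.2.2 i)))) (a, fun i => (c i, d i)) := by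
        unfold pr
        refine Finset.sum_congr rfl fun ω _ => ?_
        congr 1
        simp only [Prod.mk.injEq, funext_iff, eq_iff_iff]
        grind
      rw [e, letterwise ψ (fun o => (φ o, φ2 o)), letterwise]
      simp only [hd, Finset.prod_mul_distrib, Finset.sum_mul]
      refine Finset.sum_congr rfl fun m _ => Finset.sum_congr rfl fun xs _ => ?_
      split_ifs <;> ring)
  rw [← h]
  refine Hn_congr _ _ _ fun ω ω' => ?_
  simp only [Prod.mk.injEq, funext_iff]
  grind

lemma hE_pair (Wp : X → C × D → ℝ) (Wc : X → C → ℝ) (q : C → D → ℝ) (hq : IsChannel q)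
    (hd : ∀ x c d, Wp x (c, d) = Wc x c * q c d) (μ : X → ℝ) :
    hE Wp μ = hE Wc μ + ∑ x, μ x * ∑ c, Wc x c * ∑ d, Real.negMulLog (q c d) := by
  unfold hE
  simp only [Fintype.sum_prod_type, hd, ← mul_assoc, ← Finset.sum_mul, Real.negMulLog_mul,
    Finset.sum_add_distrib, (hq _).2, one_mul, ← Finset.mul_sum]
  congr 1
  simp_rw [Finset.sum_mul, Finset.mul_sum]
  rw [Finset.sum_comm]
  simp only [mul_assoc]

/-- hybrid sequence -/
def hyb (a : O → A) (b : O → B) (t : ℕ) (os : Fin n → O) (j : Fin n) : A ⊕ B :=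
  if (j : ℕ) < t then Sum.inl (a (os j)) else Sum.inr (b (os j))
def hybU (a : O → A) (b : O → B) (i : Fin n) (os : Fin n → O) (j : Fin n) : Option (A ⊕ B) :=
  if j = i then none else if (j : ℕ) < i then some (Sum.inl (a (os j))) else some (Sum.inr (b (os j)))

lemma hybU_indep (a : O → A) (b : O → B) (i : Fin n) (os os' : Fin n → O) (h : ∀ j, j ≠ i → os j = os' j) :
    hybU a b i os = hybU a b i os' := by
  funext j
  unfold hybU
  by_cases hj : j = i
  · simp [hj]
  · simp [hj, h j hj]

lemma hyb_tele {Ω : Type*} [Fintype Ω] (P : Ω → ℝ) (a : O → A) (b : O → B) (v : Ω → α) (f : Ω → (Fin n → O)) :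
    Hn P (fun ω => (v ω, fun i => a (f ω i))) - Hn P (fun ω => (v ω, fun i => b (f ω i))) =
    ∑ i : Fin n, (Hn P (fun ω => ((v ω, hybU a b i (f ω)), a (f ω i))) -
      Hn P (fun ω => ((v ω, hybU a b i (f ω)), b (f ω i)))) := by
  have h1 : ∀ i : Fin n, Hn P (fun ω => ((v ω, hybU a b i (f ω)), a (f ω i))) =
      Hn P (fun ω => (v ω, hyb a b (i + 1) (f ω))) := by
    intro i
    refine Hn_congr _ _ _ fun ω ω' => ?_
    simp only [Prod.mk.injEq, funext_iff, and_assoc, hybU, hyb]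
    refine and_congr_right fun _ => ⟨fun h j => ?_, fun h => ⟨fun j => ?_, ?_⟩⟩
    · by_cases hj : j = i
      · subst hj; simp [h.2]
      · have := h.1 j
        have h2 : (j : ℕ) ≠ i := fun h => hj (Fin.ext h)
        by_cases h3 : (j : ℕ) < i
        · simpa [hj, h3, Nat.lt_succ_of_lt h3] using this
        · have h4 : ¬ (j : ℕ) < i + 1 := by omega
          simpa [hj, h3, h4] using this
    · have := h j
      by_cases hj : j = i
      · simp [hj]
      · have h2 : (j : ℕ) ≠ i := fun h => hj (Fin.ext h)
        by_cases h3 : (j : ℕ) < i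
        · simpa [hj, h3, Nat.lt_succ_of_lt h3] using this
        · have h4 : ¬ (j : ℕ) < i + 1 := by omega
          simpa [hj, h3, h4] using this
    · simpa using h i
  have h2 : ∀ i : Fin n, Hn P (fun ω => ((v ω, hybU a b i (f ω)), b (f ω i))) =
      Hn P (fun ω => (v ω, hyb a b i (f ω))) := by
    intro i
    refine Hn_congr _ _ _ fun ω ω' => ?_
    simp only [Prod.mk.injEq, funext_iff, and_assoc, hybU, hyb]
    refine and_congr_right fun _ => ⟨fun h j => ?_, fun h => ⟨fun j => ?_, ?_⟩⟩
    · by_cases hj : j = i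
      · subst hj; simp [h.2]
      · have := h.1 j
        by_cases h3 : (j : ℕ) < i <;> simpa [hj, h3] using this
    · have := h j
      by_cases hj : j = i
      · simp [hj]
      · by_cases h3 : (j : ℕ) < i <;> simpa [hj, h3] using this
    · simpa using h i
  simp_rw [h1, h2]
  rw [Fin.sum_univ_eq_sum_range (fun i => Hn P (fun ω => (v ω, hyb a b (i + 1) (f ω))) -
    Hn P (fun ω => (v ω, hyb a b i (f ω)))) n, Finset.sum_range_sub (fun i => Hn P (fun ω => (v ω, hyb a b i (f ω))))]
  congr 1 <;> refine Hn_congr _ _ _ fun ω ω' => ?_ <;> simp [funext_iff, hyb]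

end conv

section conv2
open Classical
variable {M : Type*} {X Y Z1 Z2 : Type} [Fintype M] [Fintype X] [Fintype Y] [Fintype Z1] [Fintype Z2]
  {α C : Type*} [Fintype α] [Fintype C]
variable {n : ℕ} {W : X → Y × Z1 × Z2 → ℝ} {k : M → (Fin n → X) → ℝ}

def phiY (o : Y × Z1 × Z2) : Y × Z2 := (o.1, o.2.2)
def phiO (o : Y × Z1 × Z2) : Z1 × Z2 := (o.2.1, o.2.2)
def phiZ (o : Y × Z1 × Z2) : Z2 := o.2.2

lemma chmap_Y : chmap W (fun o => o.1) = WY W := by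
  funext x y
  simp only [chmap, WY, Fintype.sum_prod_type]
  rw [Finset.sum_eq_single y]
  · simp
  · intro b _ hb; simp [hb]
  · simp
lemma chmap_Z1 : chmap W (fun o => o.2.1) = WZ1 W := by
  funext x y
  simp only [chmap, WZ1, Fintype.sum_prod_type]
  refine Finset.sum_congr rfl fun _ _ => ?_
  rw [Finset.sum_eq_single y]
  · simp
  · intro b _ hb; simp [hb]
  · simp
lemma chmap_Z : chmap W phiZ = WZ2 W := by
  funext x y
  simp only [chmap, WZ2, Fintype.sum_prod_type, phiZ]
  refine Finset.sum_congr rfl fun _ _ => Finset.sum_congr rfl fun _ _ => ?_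
  rw [Finset.sum_eq_single y]; simp; intro b _ hb; simp [hb]; simp
lemma chmap_phiY (x : X) (y : Y) (z : Z2) : chmap W phiY x (y, z) = ∑ z1, W x (y, z1, z) := by
  simp only [chmap, Fintype.sum_prod_type, phiY, Prod.mk.injEq]
  rw [Finset.sum_eq_single y]
  · simp
  · intro b _ hb; simp [hb]
  · simp
lemma chmap_phiO (x : X) (z1 : Z1) (z : Z2) : chmap W phiO x (z1, z) = ∑ y, W x (y, z1, z) := by
  simp only [chmap, Fintype.sum_prod_type, phiO, Prod.mk.injEq]
  refine Finset.sum_congr rfl fun _ _ => ?_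
  rw [Finset.sum_eq_single z1]
  · simp
  · intro b _ hb; simp [hb]
  · simp

lemma ent_hE {O : Type*} [Fintype O] {W : X → O → ℝ} (hW : IsChannel W) (i : Fin n) (g : M × (Fin n → O) → α)
    (hg : ∀ m os os', (∀ j, j ≠ i → os j = os' j) → g (m, os) = g (m, os')) (φ : O → C) :
    Hn (jl W k) (fun ω => (g (ω.1, ω.2.2), φ (ω.2.2 i))) =
      ∑ a, hE (chmap W φ) (fun x => pr (jl W k) (fun ω => (g (ω.1, ω.2.2), ω.2.1 i)) (a, x)) := by
  rw [Hn_eq, Fintype.sum_prod_type]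
  simp only [memless hW i g hg, hE]

lemma pr_unit {Ω U : Type*} [Fintype Ω] [Fintype U] (P : Ω → ℝ) (m : Ω → M) (u : Ω → U) (x : Ω → X) (b : U) (c : X) :
    pr P (fun ω => (((), u ω), x ω)) (((), b), c) = ∑ a, pr P (fun ω => ((m ω, u ω), x ω)) ((a, b), c) := by
  unfold pr
  rw [Finset.sum_comm]
  refine Finset.sum_congr rfl fun ω _ => ?_
  rw [Finset.sum_eq_single (m ω)]
  · simp
  · intro b _ hb; simp [Ne.symm hb]
  · simp

abbrev UT (n : ℕ) (Y Z1 Z2 : Type) := Fin n → Option ((Y × Z2) ⊕ (Z1 × Z2))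
def muC (W : X → Y × Z1 × Z2 → ℝ) (k : M → (Fin n → X) → ℝ) (i : Fin n) (u : UT n Y Z1 Z2) (m : M) (x : X) : ℝ :=
  pr (jl W k) (fun ω => ((ω.1, hybU phiY phiO i ω.2.2), ω.2.1 i)) ((m, u), x)


lemma lin_sum {T : Type*} [Fintype T] (μ : T → X → ℝ) (L : X → ℝ) :
    ∑ t, ∑ x, μ t x * L x = ∑ x, (∑ t, μ t x) * L x := by
  rw [Finset.sum_comm]; simp only [Finset.sum_mul]

lemma convA (hW : IsChannel W) (h1 : DegradedZ1Z2 W) (h2 : DegradedYZ2 W) :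
    (Hn (jl W k) (fun ω => ((), fun i => phiY (ω.2.2 i))) - Hn (jl W k) (fun ω => (ω.1, fun i => phiY (ω.2.2 i)))) -
    (Hn (jl W k) (fun ω => ((), fun i => phiO (ω.2.2 i))) - Hn (jl W k) (fun ω => (ω.1, fun i => phiO (ω.2.2 i)))) =
    ∑ i, ((∑ u, aF W (fun x => ∑ m, muC W k i u m x)) - ∑ u, ∑ m, aF W (muC W k i u m)) := by
  have t1 := hyb_tele (jl W k) phiY phiO (fun _ => ()) (fun ω => ω.2.2)
  have t2 := hyb_tele (jl W k) phiY phiO (fun ω => ω.1) (fun ω => ω.2.2)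
  rw [sub_sub_sub_comm, t1, t2, ← Finset.sum_sub_distrib]
  refine Finset.sum_congr rfl fun i _ => ?_
  rw [ent_hE hW i (fun t => ((), hybU phiY phiO i t.2)) (fun m os os' h => by simp only [hybU_indep _ _ i os os' h]),
    ent_hE hW i (fun t => ((), hybU phiY phiO i t.2)) (fun m os os' h => by simp only [hybU_indep _ _ i os os' h]),
    ent_hE hW i (fun t => (t.1, hybU phiY phiO i t.2)) (fun m os os' h => by simp only [hybU_indep _ _ i os os' h]),
    ent_hE hW i (fun t => (t.1, hybU phiY phiO i t.2)) (fun m os os' h => by simp only [hybU_indep _ _ i os os' h])]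
  obtain ⟨q1, hq1, h1⟩ := h1
  obtain ⟨q2, hq2, h2⟩ := h2
  have eY := hE_pair (chmap W phiY) (WY W) q2 hq2 (fun x c d => by rw [chmap_phiY, h2]; rfl)
  have eO := hE_pair (chmap W phiO) (WZ1 W) q1 hq1 (fun x c d => by rw [chmap_phiO, h1]; rfl)
  simp only [Fintype.sum_prod_type, Finset.univ_unique, Finset.sum_singleton]
  have e : ∀ u x, pr (jl W k) (fun ω => (((), hybU phiY phiO i ω.2.2), ω.2.1 i)) (((), u), x) = ∑ m, muC W k i u m x :=
    fun u x => pr_unit (jl W k) (fun ω => ω.1) (fun ω => hybU phiY phiO i ω.2.2) (fun ω => ω.2.1 i) u x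
  rw [Finset.sum_comm (s := (Finset.univ : Finset M)), Finset.sum_comm (s := (Finset.univ : Finset M))]
  have e' : ∀ u m, (fun x => pr (jl W k) (fun ω => ((ω.1, hybU phiY phiO i ω.2.2), ω.2.1 i)) ((m, u), x)) = muC W k i u m := fun _ _ => rfl
  have e3 : ∀ u : UT n Y Z1 Z2, (fun x => pr (jl W k) (fun ω => (((), hybU phiY phiO i ω.2.2), ω.2.1 i)) ((default, u), x)) =
    (fun x => ∑ m, muC W k i u m x) := fun u => funext (e u)
  simp only [e3, e', eY, eO, aF, ← Finset.sum_sub_distrib]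
  refine Finset.sum_congr rfl fun u _ => ?_
  simp only [Finset.sum_add_distrib, Finset.sum_sub_distrib, lin_sum]
  ring

lemma convB (hW : IsChannel W) (hk : ∀ m xs, 0 ≤ k m xs) (h2 : DegradedYZ2 W) :
    (Hn (jl W k) (fun ω => ((), fun i => phiY (ω.2.2 i))) - Hn (jl W k) (fun ω => (ω.1, fun i => phiY (ω.2.2 i)))) -
    (Hn (jl W k) (fun ω => ((), fun i => phiZ (ω.2.2 i))) - Hn (jl W k) (fun ω => (ω.1, fun i => phiZ (ω.2.2 i)))) ≤
    ∑ i, (bF W (fun x => ∑ u, ∑ m, muC W k i u m x) - ∑ u, ∑ m, bF W (muC W k i u m)) := by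
  have t1 := hyb_tele (jl W k) phiY phiZ (fun _ => ()) (fun ω => ω.2.2)
  have t2 := hyb_tele (jl W k) phiY phiZ (fun ω => ω.1) (fun ω => ω.2.2)
  rw [sub_sub_sub_comm, t1, t2, ← Finset.sum_sub_distrib]
  refine Finset.sum_le_sum fun i _ => ?_
  have hP : ∀ ω, 0 ≤ jl W k ω := jl_nonneg hW hk
  -- step 1: drop conditioning
  have s1 : Hn (jl W k) (fun ω => (((), hybU phiY phiZ i ω.2.2), phiY (ω.2.2 i))) -
      Hn (jl W k) (fun ω => (((), hybU phiY phiZ i ω.2.2), phiZ (ω.2.2 i))) ≤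
      Hn (jl W k) (fun ω => ((), phiY (ω.2.2 i))) - Hn (jl W k) (fun ω => ((), phiZ (ω.2.2 i))) := by
    have h := condH_anti hP (fun ω => phiY (ω.2.2 i)) (fun ω => (hybU phiY phiZ i ω.2.2, phiZ (ω.2.2 i))) Prod.snd
    convert h using 2 <;> refine Hn_congr _ _ _ fun ω ω' => ?_ <;>
      simp only [phiY, phiZ, Prod.mk.injEq] <;> tauto
  have s2 : Hn (jl W k) (fun ω => ((ω.1, hybU phiY phiO i ω.2.2), phiY (ω.2.2 i))) -
      Hn (jl W k) (fun ω => ((ω.1, hybU phiY phiO i ω.2.2), phiZ (ω.2.2 i))) ≤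
      Hn (jl W k) (fun ω => ((ω.1, hybU phiY phiZ i ω.2.2), phiY (ω.2.2 i))) -
      Hn (jl W k) (fun ω => ((ω.1, hybU phiY phiZ i ω.2.2), phiZ (ω.2.2 i))) := by
    have h := condH_anti hP (fun ω => phiY (ω.2.2 i)) (fun ω => ((ω.1, hybU phiY phiO i ω.2.2), phiZ (ω.2.2 i)))
      (fun t => ((t.1.1, fun j => (t.1.2 j).map (Sum.map id Prod.snd)), t.2))
    have e : ∀ os : Fin n → Y × Z1 × Z2, (fun j => (hybU phiY phiO i os j).map (Sum.map id Prod.snd)) = hybU phiY phiZ i os := by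
      intro os; funext j
      unfold hybU
      split_ifs <;> simp [phiO, phiZ]
    simp only [e] at h
    convert h using 2 <;> refine Hn_congr _ _ _ fun ω ω' => ?_ <;>
      simp only [phiY, phiZ, Prod.mk.injEq] <;> tauto
  refine (sub_le_sub s1 s2).trans (le_of_eq ?_)
  rw [ent_hE hW i (fun t => ((t.1, hybU phiY phiO i t.2) : M × UT n Y Z1 Z2)) (fun m os os' h => by simp only [hybU_indep _ _ i os os' h]),
    ent_hE hW i (fun t => ((t.1, hybU phiY phiO i t.2) : M × UT n Y Z1 Z2)) (fun m os os' h => by simp only [hybU_indep _ _ i os os' h]),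
    ent_hE hW i (fun t => ()) (fun m os os' h => rfl), ent_hE hW i (fun t => ()) (fun m os os' h => rfl)]
  obtain ⟨q2, hq2, h2⟩ := h2
  have eY := hE_pair (chmap W phiY) (WY W) q2 hq2 (fun x c d => by rw [chmap_phiY, h2]; rfl)
  simp only [Fintype.sum_prod_type, Finset.univ_unique, Finset.sum_singleton]
  rw [Finset.sum_comm (s := (Finset.univ : Finset M)), Finset.sum_comm (s := (Finset.univ : Finset M))]
  have e' : ∀ u m, (fun x => pr (jl W k) (fun ω => ((ω.1, hybU phiY phiO i ω.2.2), ω.2.1 i)) ((m, u), x)) = muC W k i u m := fun _ _ => rfl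
  have e3 : (fun x => pr (jl W k) (fun ω => ((), ω.2.1 i)) (default, x)) =
    (fun x => ∑ u, ∑ m, muC W k i u m x) := by
    funext x
    unfold muC pr
    simp_rw [Finset.sum_comm (t := (Finset.univ : Finset (M × (Fin n → X) × (Fin n → Y × Z1 × Z2))))]
    refine Finset.sum_congr rfl fun ω _ => ?_
    rw [Finset.sum_eq_single (hybU phiY phiO i ω.2.2), Finset.sum_eq_single ω.1]
    · simp
    · intro b _ hb; simp [Ne.symm hb]
    · simp
    · intro b _ hb; simp [Ne.symm hb]
    · simp
  simp only [e3, e', eY, bF, chmap_Z]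
  simp only [Finset.sum_add_distrib, Finset.sum_sub_distrib, lin_sum]
  ring

end conv2

section conv3
open Classical
variable {X Y Z1 Z2 : Type} [Fintype X] [Fintype Y] [Fintype Z1] [Fintype Z2]
variable {n K1 K2' : ℕ} {W : X → Y × Z1 × Z2 → ℝ}

lemma prod_WZ2 (xs : Fin n → X) (z : Fin n → Z2) :
    ∑ ys : Fin n → Y, ∑ z1s : Fin n → Z1, ∏ i, W (xs i) (ys i, z1s i, z i) = ∏ i, WZ2 W (xs i) (z i) := by
  unfold WZ2
  rw [Fintype.prod_sum]
  refine Finset.sum_congr rfl fun ys _ => ?_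
  rw [Fintype.prod_sum]
lemma prod_WZ1 (xs : Fin n → X) (z : Fin n → Z1) :
    ∑ ys : Fin n → Y, ∑ z2s : Fin n → Z2, ∏ i, W (xs i) (ys i, z i, z2s i) = ∏ i, WZ1 W (xs i) (z i) := by
  unfold WZ1
  rw [Fintype.prod_sum]
  refine Finset.sum_congr rfl fun ys _ => ?_
  rw [Fintype.prod_sum]
lemma prod_WY (xs : Fin n → X) (y : Fin n → Y) :
    ∑ z1s : Fin n → Z1, ∑ z2s : Fin n → Z2, ∏ i, W (xs i) (y i, z1s i, z2s i) = ∏ i, WY W (xs i) (y i) := by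
  unfold WY
  rw [Fintype.prod_sum]
  refine Finset.sum_congr rfl fun ys _ => ?_
  rw [Fintype.prod_sum]

lemma leak2_eq (enc : Fin K1 × Fin K2' → (Fin n → X) → ℝ) :
    leakMZ2 W enc = mutInfo (fun q : (Fin K1 × Fin K2') × (Fin n → Z2) =>
      ∑ xs, ((K1 : ℝ) * K2')⁻¹ * enc q.1 xs * ∏ i, WZ2 W (xs i) (q.2 i)) := by
  unfold leakMZ2 codeJoint
  congr 1; funext q
  simp only [← Finset.mul_sum, prod_WZ2]

lemma leak1_eq (enc : Fin K1 × Fin K2' → (Fin n → X) → ℝ) :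
    leakM1Z1 W enc = mutInfo (fun q : Fin K1 × (Fin n → Z1) =>
      ∑ m2, ∑ xs, ((K1 : ℝ) * K2')⁻¹ * enc (q.1, m2) xs * ∏ i, WZ1 W (xs i) (q.2 i)) := by
  unfold leakM1Z1 codeJoint
  congr 1; funext q
  simp only [← Finset.mul_sum, prod_WZ1]

lemma err_eq (enc : Fin K1 × Fin K2' → (Fin n → X) → ℝ) (dec : (Fin n → Y) → Fin K1 × Fin K2') :
    errProb W enc dec = ∑ m, ∑ ys, if dec ys ≠ m then
      ∑ xs, ((K1 : ℝ) * K2')⁻¹ * enc m xs * ∏ i, WY W (xs i) (ys i) else 0 := by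
  unfold errProb codeJoint
  refine Finset.sum_congr rfl fun m _ => ?_
  rw [Finset.sum_comm]
  refine Finset.sum_congr rfl fun ys _ => ?_
  by_cases h : dec ys = m
  · simp [h]
  · simp only [h, ne_eq, not_false_eq_true, if_true, ← Finset.mul_sum, prod_WY]

lemma mutInfo_pr {Ω α β : Type*} [Fintype Ω] [Fintype α] [Fintype β] {P : Ω → ℝ} (hP : ∀ ω, 0 ≤ P ω)
    (f : Ω → α) (g : Ω → β) :
    Real.log 2 * mutInfo (pr P (fun ω => (f ω, g ω))) = Hn P f + Hn P g - Hn P (fun ω => (f ω, g ω)) := by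
  rw [mutInfo_eq _ (fun t => pr_nonneg hP _ t)]
  simp only [pr_fst, pr_snd, Hn_eq, Fintype.sum_prod_type]

variable {enc : Fin K1 × Fin K2' → (Fin n → X) → ℝ}

/-- message/input weight of a code -/
def kc (enc : Fin K1 × Fin K2' → (Fin n → X) → ℝ) (m : Fin K1 × Fin K2') (xs : Fin n → X) : ℝ :=
  ((K1 : ℝ) * K2')⁻¹ * enc m xs

lemma leak2_H (hW : IsChannel W) (he : IsChannel enc) :
    Real.log 2 * leakMZ2 W enc = Hn (jl W (kc enc)) (fun ω => ω.1) + Hn (jl W (kc enc)) (fun ω i => phiZ (ω.2.2 i))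
      - Hn (jl W (kc enc)) (fun ω => (ω.1, fun i => phiZ (ω.2.2 i))) := by
  have hP : ∀ ω, 0 ≤ jl W (kc enc) ω := jl_nonneg hW (fun m xs => mul_nonneg (by positivity) ((he m).1 xs))
  rw [← mutInfo_pr hP, leak2_eq]
  congr 2
  funext q
  rw [letterwise (fun m => m) phiZ q.1 q.2]
  rw [Finset.sum_eq_single q.1]
  · simp only [if_true, chmap_Z, kc]
  · intro b _ hb; simp [hb]
  · simp

lemma leak1_H (hW : IsChannel W) (he : IsChannel enc) :
    Real.log 2 * leakM1Z1 W enc = Hn (jl W (kc enc)) (fun ω => ω.1.1) + Hn (jl W (kc enc)) (fun ω i => (ω.2.2 i).2.1)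
      - Hn (jl W (kc enc)) (fun ω => (ω.1.1, fun i => (ω.2.2 i).2.1)) := by
  have hP : ∀ ω, 0 ≤ jl W (kc enc) ω := jl_nonneg hW (fun m xs => mul_nonneg (by positivity) ((he m).1 xs))
  rw [← mutInfo_pr hP, leak1_eq]
  congr 2
  funext q
  rw [letterwise (fun m : Fin K1 × Fin K2' => m.1) (fun o : Y × Z1 × Z2 => o.2.1) q.1 q.2]
  rw [Fintype.sum_prod_type, Finset.sum_eq_single q.1]
  · simp only [if_true, chmap_Z1, kc]
  · intro b _ hb; simp [hb]
  · simp

lemma err_pr (dec : (Fin n → Y) → Fin K1 × Fin K2') :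
    (∑ ω, if dec (fun i => (ω.2.2 i).1) ≠ ω.1 then jl W (kc enc) ω else 0) = errProb W enc dec := by
  have h := pr_expect (jl W (kc enc)) (fun ω => (ω.1, fun i => (ω.2.2 i).1)) (fun t => if dec t.2 ≠ t.1 then 1 else 0)
  simp only [mul_ite, mul_one, mul_zero] at h
  rw [← h, err_eq, Fintype.sum_prod_type]
  refine Finset.sum_congr rfl fun m _ => Finset.sum_congr rfl fun ys _ => ?_
  rw [letterwise (fun m => m) (fun o : Y × Z1 × Z2 => o.1) m ys, Finset.sum_eq_single m]
  · simp only [if_true, chmap_Y, kc]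
  · intro b _ hb; simp [hb]
  · simp

lemma kc_sum (h1 : 0 < K1) (h2 : 0 < K2') (he : IsChannel enc) : ∑ m, ∑ xs, kc enc m xs = 1 := by
  simp only [kc, ← Finset.mul_sum, (he _).2]
  simp
  field_simp

lemma pr_msg (hW : IsChannel W) (he : IsChannel enc) (m) :
    pr (jl W (kc enc)) (fun ω => ω.1) m = ((K1 : ℝ) * K2')⁻¹ := by
  unfold pr
  simp only [Fintype.sum_prod_type (α₂ := (Fin n → X) × (Fin n → Y × Z1 × Z2))]
  rw [Finset.sum_eq_single m]
  · simp only [if_true, jl, Fintype.sum_prod_type, ← Finset.mul_sum, sum_prod_chan hW, mul_one, kc, (he _).2]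
  · intro b _ hb; simp [hb]
  · simp

lemma H_msg (h1 : 0 < K1) (h2 : 0 < K2') (hW : IsChannel W) (he : IsChannel enc) :
    Hn (jl W (kc enc)) (fun ω => ω.1) = Real.log K1 + Real.log K2' := by
  rw [Hn_eq]
  simp only [pr_msg hW he, Real.negMulLog, Real.log_inv]
  have a : (0 : ℝ) < K1 := by exact_mod_cast h1
  have b : (0 : ℝ) < K2' := by exact_mod_cast h2
  rw [Real.log_mul a.ne' b.ne']
  simp
  field_simp
  ring

lemma H_msg1 (h1 : 0 < K1) (h2 : 0 < K2') (hW : IsChannel W) (he : IsChannel enc) :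
    Hn (jl W (kc enc)) (fun ω => ω.1.1) = Real.log K1 := by
  rw [Hn_eq]
  have a : (0 : ℝ) < K1 := by exact_mod_cast h1
  have b : (0 : ℝ) < K2' := by exact_mod_cast h2
  have : ∀ m1, pr (jl W (kc enc)) (fun ω => ω.1.1) m1 = (K1 : ℝ)⁻¹ := by
    intro m1
    rw [← pr_fst (jl W (kc enc)) (fun ω => ω.1.1) (fun ω => ω.1.2) m1]
    have : ∀ m2, pr (jl W (kc enc)) (fun ω => (ω.1.1, ω.1.2)) (m1, m2) = ((K1 : ℝ) * K2')⁻¹ := fun m2 => pr_msg hW he _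
    simp only [this]
    simp
    field_simp
  simp only [this, Real.negMulLog, Real.log_inv]
  simp
  field_simp

lemma conv_main (h1 : 0 < K1) (h2 : 0 < K2') (hW : IsChannel W) (hd1 : DegradedZ1Z2 W) (hd2 : DegradedYZ2 W)
    (he : IsChannel enc) (dec : (Fin n → Y) → Fin K1 × Fin K2') {ε : ℝ} (h0 : 0 < ε) (hε : ε ≤ 1 / 2)
    (her : errProb W enc dec ≤ ε) (hl2 : leakMZ2 W enc ≤ n * ε) (hl1 : leakM1Z1 W enc ≤ n * ε) (hn : 0 < n) :
    ∃ F : ℝ, F ≤ n * ((- Real.log (1 - ε) + Real.negMulLog ε) + 2 * ε * ((- Real.log (1 - ε) + Real.negMulLog ε) +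
       Real.log (Fintype.card (Y × Z2)))) ∧
     Real.log K1 ≤ (∑ i, ((∑ u, aF W (fun x => ∑ m, muC W (kc enc) i u m x)) - ∑ u, ∑ m, aF W (muC W (kc enc) i u m)))
        + F + Real.log 2 * (n * ε) ∧
     Real.log K1 + Real.log K2' ≤ ∑ i, (bF W (fun x => ∑ u, ∑ m, muC W (kc enc) i u m x) - ∑ u, ∑ m, bF W (muC W (kc enc) i u m))
        + F + Real.log 2 * (n * ε) := by
  have hk : ∀ m xs, 0 ≤ kc enc m xs := (fun m xs => mul_nonneg (by positivity) ((he m).1 xs))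
  have hP : ∀ ω, 0 ≤ jl W (kc enc) ω := jl_nonneg hW hk
  have hs : ∑ ω, jl W (kc enc) ω = 1 := jl_sum hW (kc_sum h1 h2 he)
  have l2 : (0 : ℝ) < Real.log 2 := Real.log_pos (by norm_num)
  have A := convA (k := kc enc) hW hd1 hd2
  have B := convB (k := kc enc) hW hk hd2
  rw [← A]
  have uY : Hn (jl W (kc enc)) (fun ω => ((), fun i => phiY (ω.2.2 i))) = Hn (jl W (kc enc)) (fun ω i => phiY (ω.2.2 i)) :=
    Hn_congr _ _ _ fun ω ω' => by simp
  have uO : Hn (jl W (kc enc)) (fun ω => ((), fun i => phiO (ω.2.2 i))) = Hn (jl W (kc enc)) (fun ω i => phiO (ω.2.2 i)) :=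
    Hn_congr _ _ _ fun ω ω' => by simp
  have uZ : Hn (jl W (kc enc)) (fun ω => ((), fun i => phiZ (ω.2.2 i))) = Hn (jl W (kc enc)) (fun ω i => phiZ (ω.2.2 i)) :=
    Hn_congr _ _ _ fun ω ω' => by simp
  rw [uY, uO]
  rw [uY, uZ] at B
  have fa := fano hP hs (fun ω => ω.1) (fun ω i => phiY (ω.2.2 i)) (fun y => dec (fun i => (y i).1)) h0 (by linarith)
    (by rw [← err_pr] at her; convert her; rfl) (by simp; exact ⟨h1, h2⟩)
  have lk2 := leak2_H hW he
  have lk1 := leak1_H hW he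
  have hl2' := mul_le_mul_of_nonneg_left hl2 l2.le
  have hl1' := mul_le_mul_of_nonneg_left hl1 l2.le
  rw [lk2] at hl2'
  rw [lk1] at hl1'
  rw [H_msg h1 h2 hW he] at hl2'
  rw [H_msg1 h1 h2 hW he] at hl1'
  have hlogK : Real.log (Fintype.card (Fin K1 × Fin K2') : ℝ) = Real.log K1 + Real.log K2' := by
    rw [Fintype.card_prod, Fintype.card_fin, Fintype.card_fin, Nat.cast_mul, Real.log_mul] <;> positivity
  rw [hlogK] at fa
  have mono := Hn_mono hP (fun ω => (ω.1, fun i => phiY (ω.2.2 i))) (fun ω => ω.1) (fun ω ω' h => (Prod.mk.inj h).1)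
  rw [H_msg h1 h2 hW he] at mono
  have card := Hn_le_card hP hs (fun ω i => phiY (ω.2.2 i))
  rw [Fintype.card_fun, Fintype.card_fin, Nat.cast_pow, Real.log_pow] at card
  refine ⟨- Real.log (1 - ε) + Real.negMulLog ε + ε * (Real.log K1 + Real.log K2'), ?_, ?_, ?_⟩
  · set c := - Real.log (1 - ε) + Real.negMulLog ε with hc
    set L := Real.log (Fintype.card (Y × Z2) : ℝ)
    have hc0 : 0 ≤ c := by
      have := Real.log_nonpos (by linarith : 0 ≤ 1 - ε) (by linarith)
      have := Real.negMulLog_nonneg h0.le (by linarith : ε ≤ 1)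
      linarith
    have hL : 0 ≤ L := Real.log_natCast_nonneg _
    have n1 : (1 : ℝ) ≤ n := by exact_mod_cast hn
    have hk0 : 0 ≤ Real.log K1 + Real.log K2' := add_nonneg (Real.log_natCast_nonneg _) (Real.log_natCast_nonneg _)
    have : Real.log K1 + Real.log K2' ≤ 2 * (c + n * L) := by
      have := mul_le_mul_of_nonneg_right hε hk0
      linarith
    have h3 := mul_le_mul_of_nonneg_left this h0.le
    have h4 : c ≤ n * c := by nlinarith
    have h5 : ε * c ≤ n * (ε * c) := by nlinarith [mul_nonneg h0.le hc0]
    nlinarith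
  · obtain ⟨q1, hq1, hd1⟩ := hd1
    have dg : ∀ x c d, chmap W (fun o => (o.2.1, o.2.2)) x (c, d) = chmap W (fun o => o.2.1) x c * q1 c d := by
      intro x c d
      rw [chmap_Z1]
      exact (chmap_phiO x c d).trans (hd1 x c d)
    have d1 := deg_n (k := kc enc) (W := W) (fun o => o.2.1) (fun o => o.2.2) q1 hq1 dg (fun m => m.1)
    have d2 := deg_n (k := kc enc) (W := W) (fun o => o.2.1) (fun o => o.2.2) q1 hq1 dg (fun m => ())
    have e1 : Hn (jl W (kc enc)) (fun ω => (ω.1.1, fun i => phiO (ω.2.2 i))) ≤ Hn (jl W (kc enc)) (fun ω => (ω.1, fun i => phiO (ω.2.2 i))) :=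
      Hn_mono hP _ _ fun ω ω' h => by
        obtain ⟨h1, h2⟩ := Prod.mk.inj h
        simp only [h1, h2]
    have u1 : Hn (jl W (kc enc)) (fun ω => ((), fun i => (ω.2.2 i).2.1)) = Hn (jl W (kc enc)) (fun ω i => (ω.2.2 i).2.1) :=
      Hn_congr _ _ _ fun ω ω' => by simp
    rw [u1] at d2
    change Hn (jl W (kc enc)) (fun ω => (ω.1.1, fun i => phiO (ω.2.2 i))) = _ at d1
    change Hn (jl W (kc enc)) (fun ω => ((), fun i => phiO (ω.2.2 i))) = _ at d2
    rw [uO] at d2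
    linarith
  · linarith

lemma conv_single (h1 : 0 < K1) (h2 : 0 < K2') (hW : IsChannel W) (hd1 : DegradedZ1Z2 W) (hd2 : DegradedYZ2 W)
    (he : IsChannel enc) (dec : (Fin n → Y) → Fin K1 × Fin K2') {ε : ℝ} (h0 : 0 < ε) (hε : ε ≤ 1 / 2)
    (her : errProb W enc dec ≤ ε) (hl2 : leakMZ2 W enc ≤ n * ε) (hl1 : leakM1Z1 W enc ≤ n * ε) (hn : 0 < n) :
    ∃ t ∈ K2 W, 
     Real.log K1 ≤ n * (t.2.1 + (((- Real.log (1 - ε) + Real.negMulLog ε) + 2 * ε * ((- Real.log (1 - ε) + Real.negMulLog ε) +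
       Real.log (Fintype.card (Y × Z2)))) + Real.log 2 * ε)) ∧
     Real.log K1 + Real.log K2' ≤ n * (bF W t.1 - t.2.2 + (((- Real.log (1 - ε) + Real.negMulLog ε) + 2 * ε * ((- Real.log (1 - ε) + Real.negMulLog ε) +
       Real.log (Fintype.card (Y × Z2)))) + Real.log 2 * ε)) := by
  obtain ⟨F, hF, hA, hB⟩ := conv_main h1 h2 hW hd1 hd2 he dec h0 hε her hl2 hl1 hn
  have hk : ∀ m xs, 0 ≤ kc enc m xs := (fun m xs => mul_nonneg (by positivity) ((he m).1 xs))
  have hP : ∀ ω, 0 ≤ jl W (kc enc) ω := jl_nonneg hW hk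
  have hs : ∑ ω, jl W (kc enc) ω = 1 := jl_sum hW (kc_sum h1 h2 he)
  have n0 : (0 : ℝ) < n := by exact_mod_cast hn
  have mu0 : ∀ i u m x, 0 ≤ muC W (kc enc) i u m x := fun i u m x => pr_nonneg hP _ _
  have mu1 : ∀ i, ∑ u, ∑ m, ∑ x, muC W (kc enc) i u m x = 1 := by
    intro i
    rw [← hs, ← pr_sum (jl W (kc enc)) (fun ω => ((ω.1, hybU phiY phiO i ω.2.2), ω.2.1 i))]
    rw [Fintype.sum_prod_type, Fintype.sum_prod_type, Finset.sum_comm]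
    rfl
  refine ⟨_, toK2 hW (U := Fin n × UT n Y Z1 Z2) (fun u m => (n : ℝ)⁻¹ • muC W (kc enc) u.1 u.2 m) ?_ ?_, ?_, ?_⟩
  · intro u m x
    exact mul_nonneg (by positivity) (mu0 _ _ _ _)
  · rw [Fintype.sum_prod_type]
    simp only [Pi.smul_apply, smul_eq_mul, ← Finset.mul_sum]
    rw [Finset.sum_congr rfl fun i _ => mu1 i]
    simp
    field_simp
  · have e : ∀ u : Fin n × UT n Y Z1 Z2, (fun x => ∑ m, ((n : ℝ)⁻¹ • muC W (kc enc) u.1 u.2 m) x) =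
        (n : ℝ)⁻¹ • (fun x => ∑ m, muC W (kc enc) u.1 u.2 m x) := by
      intro u; funext x; simp [Finset.mul_sum]
    simp only [e, aF_smul hW, ← Finset.mul_sum, ← mul_sub]
    rw [mul_add, mul_inv_cancel_left₀ n0.ne', Fintype.sum_prod_type, Fintype.sum_prod_type, ← Finset.sum_sub_distrib]
    linarith
  · simp only [bF_smul hW, ← Finset.mul_sum]
    obtain ⟨q, hq, hd⟩ := degY hd2
    have sa := hE_superadd (WY W) (WY_chan hW) (WZ2 W) q hq hd (fun (i : Fin n) => (n : ℝ)⁻¹ • fun x => ∑ u, ∑ m, muC W (kc enc) i u m x)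
      (fun i x => mul_nonneg (by positivity) (Finset.sum_nonneg fun _ _ => Finset.sum_nonneg fun _ _ => mu0 _ _ _ _))
    have e : (fun x => ∑ u : Fin n × UT n Y Z1 Z2, ∑ m, ((n : ℝ)⁻¹ • muC W (kc enc) u.1 u.2 m) x) =
      (fun x => ∑ i : Fin n, ((n : ℝ)⁻¹ • fun x => ∑ u, ∑ m, muC W (kc enc) i u m x) x) := by
      funext x
      rw [Fintype.sum_prod_type]
      simp [Finset.mul_sum]
    rw [e]
    change ∑ i : Fin n, bF W ((n : ℝ)⁻¹ • fun x => ∑ u, ∑ m, muC W (kc enc) i u m x) ≤ bF W _ at sa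
    simp only [bF_smul hW, ← Finset.mul_sum] at sa
    have sa' := mul_le_mul_of_nonneg_left sa n0.le
    rw [mul_inv_cancel_left₀ n0.ne'] at sa'
    rw [mul_add, mul_sub, mul_inv_cancel_left₀ n0.ne', Fintype.sum_prod_type]
    rw [Finset.sum_sub_distrib] at hB
    linarith

lemma converse (hW : IsChannel W) (hd1 : DegradedZ1Z2 W) (hd2 : DegradedYZ2 W) (R1 R2 : ℝ) (hA : Achievable W R1 R2) :
    ∃ t ∈ K2 W, Real.log 2 * R1 ≤ t.2.1 ∧ Real.log 2 * (R1 + R2) ≤ bF W t.1 - t.2.2 := by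
  let D : ℝ → ℝ := fun ε => (((- Real.log (1 - ε) + Real.negMulLog ε) + 2 * ε * ((- Real.log (1 - ε) + Real.negMulLog ε) +
       Real.log (Fintype.card (Y × Z2)))) + Real.log 2 * ε) + 2 * Real.log 2 * ε
  have l2 : (0 : ℝ) < Real.log 2 := Real.log_pos (by norm_num)
  have key : ∀ ε, 0 < ε → ε ≤ 1 / 2 → ∃ t ∈ K2 W, Real.log 2 * R1 ≤ t.2.1 + D ε ∧ Real.log 2 * (R1 + R2) ≤ bF W t.1 - t.2.2 + D ε := by
    intro ε h0 hε
    obtain ⟨n, hn, K1, K2', h1, h2, r1, r2, enc, he, dec, her, hl2, hl1⟩ := hA ε h0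
    obtain ⟨t, ht, a, b⟩ := conv_single h1 h2 hW hd1 hd2 he dec h0 hε her hl2 hl1 hn
    have n0 : (0 : ℝ) < n := by exact_mod_cast hn
    refine ⟨t, ht, ?_, ?_⟩
    · have : Real.log K1 = Real.log 2 * Real.logb 2 K1 := by unfold Real.logb; field_simp
      rw [this] at a
      have r1' := mul_le_mul_of_nonneg_left r1 l2.le
      have : (n : ℝ) * (Real.log 2 * (R1 - ε)) ≤ n * (t.2.1 + (((- Real.log (1 - ε) + Real.negMulLog ε) + 2 * ε * ((- Real.log (1 - ε) + Real.negMulLog ε) +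
       Real.log (Fintype.card (Y × Z2)))) + Real.log 2 * ε)) := by linarith
      have := le_of_mul_le_mul_left this n0
      have : 0 ≤ Real.log 2 * ε := by positivity
      dsimp only [D]
      linarith
    · have e1 : Real.log K1 = Real.log 2 * Real.logb 2 K1 := by unfold Real.logb; field_simp
      have e2 : Real.log K2' = Real.log 2 * Real.logb 2 K2' := by unfold Real.logb; field_simp
      rw [e1, e2] at b
      have r1' := mul_le_mul_of_nonneg_left r1 l2.le
      have r2' := mul_le_mul_of_nonneg_left r2 l2.le
      have : (n : ℝ) * (Real.log 2 * (R1 + R2 - 2 * ε)) ≤ n * (bF W t.1 - t.2.2 + (((- Real.log (1 - ε) + Real.negMulLog ε) + 2 * ε * ((- Real.log (1 - ε) + Real.negMulLog ε) +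
       Real.log (Fintype.card (Y × Z2)))) + Real.log 2 * ε)) := by linarith
      have := le_of_mul_le_mul_left this n0
      dsimp only [D]
      linarith
  have hne : (K2 W).Nonempty := by
    obtain ⟨t, ht, _⟩ := key (1 / 2) (by norm_num) le_rfl
    exact ⟨t, ht⟩
  obtain ⟨t, ht, hmax⟩ := K2_compact.exists_isMaxOn hne
    (f := fun t : (X → ℝ) × ℝ × ℝ => min (t.2.1 - Real.log 2 * R1) (bF W t.1 - t.2.2 - Real.log 2 * (R1 + R2)))
    (Continuous.continuousOn (by
      have := (bF_cont (W := W)).comp (continuous_fst (X := X → ℝ) (Y := ℝ × ℝ))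
      exact Continuous.min (by fun_prop) ((this.sub (by fun_prop)).sub continuous_const)))
  have hlim : Filter.Tendsto (fun ε => - D ε) (nhdsWithin 0 (Set.Ioi 0)) (nhds 0) := by
    have hc : ContinuousAt (fun ε => - D ε) 0 := by
      have : ContinuousAt (fun ε : ℝ => Real.log (1 - ε)) 0 :=
        ContinuousAt.log (by fun_prop) (by norm_num)
      have h3 := Real.continuous_negMulLog.continuousAt (x := 0)
      have h4 : ContinuousAt (fun ε : ℝ => - Real.log (1 - ε) + Real.negMulLog ε) 0 := this.neg.add h3
      dsimp only [D]
      refine ContinuousAt.neg (((h4.add (ContinuousAt.mul (by fun_prop) (h4.add (by fun_prop)))).add (by fun_prop)).add (by fun_prop))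
    have := hc.tendsto
    have e : - D 0 = 0 := by simp [D]
    rw [e] at this
    exact this.mono_left nhdsWithin_le_nhds
  have hge := le_of_tendsto hlim (b := min (t.2.1 - Real.log 2 * R1) (bF W t.1 - t.2.2 - Real.log 2 * (R1 + R2))) (by
    have : Set.Ioc (0 : ℝ) (1 / 2) ∈ nhdsWithin (0 : ℝ) (Set.Ioi 0) := Ioc_mem_nhdsGT (by norm_num)
    filter_upwards [this] with ε hε
    obtain ⟨s, hs, a, b⟩ := key ε hε.1 hε.2
    have := hmax hs
    refine le_trans ?_ this
    exact le_min (by linarith) (by linarith))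
  exact ⟨t, ht, by linarith [min_le_left (t.2.1 - Real.log 2 * R1) (bF W t.1 - t.2.2 - Real.log 2 * (R1 + R2))],
    by linarith [min_le_right (t.2.1 - Real.log 2 * R1) (bF W t.1 - t.2.2 - Real.log 2 * (R1 + R2))]⟩
end conv3

section prodlaw
open Classical
variable {ι O : Type*} [Fintype ι] [Fintype O]

lemma sum_coordG (i : ι) (H : (ι → O) → O → ℝ) (hH : ∀ os os', (∀ j, j ≠ i → os j = os' j) → H os = H os')
    (w : ι → O → ℝ) (hw : ∑ o, w i o = 1) :
    ∑ os, (∏ j, w j (os j)) * H os (os i) = ∑ os, (∏ j, w j (os j)) * ∑ o, w i o * H os o := by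
  have key : ∀ H : (ι → O) → O → ℝ, (∀ os os', (∀ j, j ≠ i → os j = os' j) → H os = H os') →
      ∑ os, (∏ j, w j (os j)) * H os (os i) =
      ∑ r : {j // j ≠ i} → O, (∏ j : {j // j ≠ i}, w j (r j)) *
        (if hO : Nonempty O then ∑ o, w i o * H ((Equiv.funSplitAt i O).symm (hO.some, r)) o else 0) := by
    intro H hH
    rw [← (Equiv.funSplitAt i O).symm.sum_comp, Fintype.sum_prod_type, Finset.sum_comm]
    refine Finset.sum_congr rfl fun r _ => ?_
    by_cases hO : Nonempty O
    · rw [dif_pos hO, Finset.mul_sum]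
      refine Finset.sum_congr rfl fun o _ => ?_
      rw [hH _ ((Equiv.funSplitAt i O).symm (hO.some, r)), Fintype.prod_eq_mul_prod_subtype_ne _ i]
      · have : ∀ j : {j // j ≠ i}, (Equiv.funSplitAt i O).symm (o, r) j = r j := by
          intro j; simp [Equiv.funSplitAt, Equiv.piSplitAt, j.2]
        simp only [this]
        simp [Equiv.funSplitAt, Equiv.piSplitAt]
        ring
      · intro j hj
        simp [Equiv.funSplitAt, Equiv.piSplitAt, hj]
    · have := not_nonempty_iff.1 hO
      simp
  rw [key H hH, key (fun os _ => ∑ o, w i o * H os o) (fun os os' h => by simp only [hH os os' h])]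
  refine Finset.sum_congr rfl fun r _ => ?_
  congr 1
  split_ifs
  · rw [← Finset.sum_mul, hw, one_mul]
  · rfl

lemma prod_law_sum (w : ι → O → ℝ) (hw : ∀ i, ∑ o, w i o = 1) : ∑ os : ι → O, ∏ j, w j (os j) = 1 := by
  rw [← Fintype.prod_sum]; simp [hw]

lemma prod_law1 (w : ι → O → ℝ) (hw : ∀ i, ∑ o, w i o = 1) (i : ι) (g : O → ℝ) :
    ∑ os : ι → O, (∏ j, w j (os j)) * g (os i) = ∑ o, w i o * g o := by
  rw [sum_coordG i (fun _ => g) (fun _ _ _ => rfl) w (hw i), ← Finset.sum_mul, prod_law_sum w hw, one_mul]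

lemma prod_law2 (w : ι → O → ℝ) (hw : ∀ i, ∑ o, w i o = 1) {i i' : ι} (h : i ≠ i') (g : O → O → ℝ) :
    ∑ os : ι → O, (∏ j, w j (os j)) * g (os i) (os i') = ∑ o, w i o * ∑ o', w i' o' * g o o' := by
  rw [sum_coordG i (fun os o => g o (os i')) (fun os os' h' => by rw [h' i' (Ne.symm h)]) w (hw i),
    prod_law1 w hw i' (fun o' => ∑ o, w i o * g o o')]
  simp_rw [Finset.mul_sum]
  rw [Finset.sum_comm]
  refine Finset.sum_congr rfl fun _ _ => Finset.sum_congr rfl fun _ _ => by ring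
end prodlaw

section oneshot
open Classical
variable {U V Y Z A B : Type*} [Fintype U] [Fintype V] [Fintype Y] [Fintype Z] [Fintype A] [Fintype B]

def wS (pU : U → ℝ) (QV : U → V → ℝ) (s : U × (B → V)) : ℝ := pU s.1 * ∏ b, QV s.1 (s.2 b)
def wC (pU : U → ℝ) (QV : U → V → ℝ) (c : A → U × (B → V)) : ℝ := ∏ a, wS pU QV (c a)
def PUz (QV : U → V → ℝ) (P : V → Z → ℝ) (u : U) (z : Z) : ℝ := ∑ v, QV u v * P v z
def PRz (pU : U → ℝ) (QV : U → V → ℝ) (P : V → Z → ℝ) (z : Z) : ℝ := ∑ u, pU u * PUz QV P u z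

variable {pU : U → ℝ} {QV : U → V → ℝ}

lemma PUz_chan (hQ : IsChannel QV) {P : V → Z → ℝ} (hP : IsChannel P) : IsChannel (PUz QV P) := by
  intro u
  refine ⟨fun z => Finset.sum_nonneg fun v _ => mul_nonneg ((hQ u).1 v) ((hP v).1 z), ?_⟩
  unfold PUz
  rw [Finset.sum_comm]
  simp only [← Finset.mul_sum, (hP _).2, mul_one, (hQ u).2]

lemma PRz_pmf (hp : IsPMF pU) (hQ : IsChannel QV) {P : V → Z → ℝ} (hP : IsChannel P) : IsPMF (PRz pU QV P) := by
  refine ⟨fun z => Finset.sum_nonneg fun v _ => mul_nonneg (hp.1 v) ((PUz_chan hQ hP v).1 z), ?_⟩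
  unfold PRz
  rw [Finset.sum_comm]
  simp only [← Finset.mul_sum, (PUz_chan hQ hP _).2, mul_one, hp.2]

lemma wS_nonneg (hp : IsPMF pU) (hQ : IsChannel QV) (s : U × (B → V)) : 0 ≤ wS pU QV s :=
  mul_nonneg (hp.1 _) (Finset.prod_nonneg fun _ _ => (hQ _).1 _)
lemma wC_nonneg (hp : IsPMF pU) (hQ : IsChannel QV) (c : A → U × (B → V)) : 0 ≤ wC pU QV c :=
  Finset.prod_nonneg fun _ _ => wS_nonneg hp hQ _
lemma wS_sum (hp : IsPMF pU) (hQ : IsChannel QV) : ∑ s : U × (B → V), wS pU QV s = 1 := by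
  simp only [wS, Fintype.sum_prod_type, ← Finset.mul_sum]
  simp only [prod_law_sum (fun _ => QV _) (fun _ => (hQ _).2), mul_one, hp.2]
lemma wC_sum (hp : IsPMF pU) (hQ : IsChannel QV) : ∑ c : A → U × (B → V), wC pU QV c = 1 :=
  prod_law_sum (fun _ => wS pU QV) (fun _ => wS_sum hp hQ)

lemma wS1 (hQ : IsChannel QV) (b : B) (g : U → V → ℝ) :
    ∑ s : U × (B → V), wS pU QV s * g s.1 (s.2 b) = ∑ u, ∑ v, pU u * QV u v * g u v := by
  simp only [wS, Fintype.sum_prod_type, mul_assoc, ← Finset.mul_sum]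
  refine Finset.sum_congr rfl fun u _ => ?_
  rw [prod_law1 (fun _ => QV u) (fun _ => (hQ u).2) b (g u)]

lemma wS2 (hQ : IsChannel QV) {b b' : B} (h : b ≠ b') (g : U → V → V → ℝ) :
    ∑ s : U × (B → V), wS pU QV s * g s.1 (s.2 b) (s.2 b') = ∑ u, ∑ v, pU u * QV u v * ∑ v', QV u v' * g u v v' := by
  simp only [wS, Fintype.sum_prod_type, mul_assoc, ← Finset.mul_sum]
  refine Finset.sum_congr rfl fun u _ => ?_
  rw [prod_law2 (fun _ => QV u) (fun _ => (hQ u).2) h (g u)]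

/-- single codeword expectation -/
lemma wC1 (hp : IsPMF pU) (hQ : IsChannel QV) (a : A) (b : B) (g : U → V → ℝ) :
    ∑ c : A → U × (B → V), wC pU QV c * g (c a).1 ((c a).2 b) = ∑ u, ∑ v, pU u * QV u v * g u v := by
  unfold wC
  rw [prod_law1 (fun _ => wS pU QV) (fun _ => wS_sum hp hQ) a (fun s => g s.1 (s.2 b)), wS1 hQ]

lemma wC2 (hp : IsPMF pU) (hQ : IsChannel QV) (a : A) {b b' : B} (h : b ≠ b') (g : U → V → V → ℝ) :
    ∑ c : A → U × (B → V), wC pU QV c * g (c a).1 ((c a).2 b) ((c a).2 b') =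
      ∑ u, ∑ v, pU u * QV u v * ∑ v', QV u v' * g u v v' := by
  unfold wC
  rw [prod_law1 (fun _ => wS pU QV) (fun _ => wS_sum hp hQ) a (fun s => g s.1 (s.2 b) (s.2 b')), wS2 hQ h]

lemma wC3 (hp : IsPMF pU) (hQ : IsChannel QV) {a a' : A} (h : a ≠ a') (b b' : B) (g : U → V → V → ℝ) :
    ∑ c : A → U × (B → V), wC pU QV c * g (c a).1 ((c a).2 b) ((c a').2 b') =
      ∑ u, ∑ v, pU u * QV u v * ∑ u', ∑ v', pU u' * QV u' v' * g u v v' := by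
  unfold wC
  rw [prod_law2 (fun _ => wS pU QV) (fun _ => wS_sum hp hQ) h (fun s s' => g s.1 (s.2 b) (s'.2 b'))]
  rw [← wS1 hQ b]
  refine Finset.sum_congr rfl fun s _ => ?_
  rw [← wS1 hQ b' (fun _ v' => g s.1 (s.2 b) v')]

lemma wC_supp (c : A → U × (B → V)) (h : wC pU QV c ≠ 0) (a : A) (b : B) :
    pU (c a).1 ≠ 0 ∧ QV (c a).1 ((c a).2 b) ≠ 0 := by
  have h1 := Finset.prod_ne_zero_iff.1 h a (Finset.mem_univ _)
  exact ⟨left_ne_zero_of_mul h1, Finset.prod_ne_zero_iff.1 (right_ne_zero_of_mul h1) b (Finset.mem_univ _)⟩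

lemma PU_zero (hQ : IsChannel QV) {P : V → Z → ℝ} (hP : IsChannel P) {u : U} {v : V} {z : Z}
    (hq : QV u v ≠ 0) (h : PUz QV P u z = 0) : P v z = 0 := by
  have := sum_eq_zero_imp (fun v => mul_nonneg ((hQ u).1 v) ((hP v).1 z)) h v
  exact (mul_eq_zero.1 this).resolve_left hq

lemma PR_zero (hp : IsPMF pU) (hQ : IsChannel QV) {P : V → Z → ℝ} (hP : IsChannel P) {u : U} {z : Z}
    (hu : pU u ≠ 0) (h : PRz pU QV P z = 0) : PUz QV P u z = 0 := by
  have := sum_eq_zero_imp (fun u => mul_nonneg (hp.1 u) ((PUz_chan hQ hP u).1 z)) h u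
  exact (mul_eq_zero.1 this).resolve_left hu

end oneshot

section oneshot2
open Classical
variable {U V Y Z A B : Type*} [Fintype U] [Fintype V] [Fintype Y] [Fintype Z] [Fintype A] [Fintype B]
variable {pU : U → ℝ} {QV : U → V → ℝ}

lemma err_same (hp : IsPMF pU) (hQ : IsChannel QV) {P : V → Y → ℝ} (hP : IsChannel P) {τ : ℝ} (hτ : 0 < τ)
    (a : A) {b b' : B} (h : b ≠ b') :
    ∑ c : A → U × (B → V), wC pU QV c * ∑ y, P ((c a).2 b) y *
      (if τ * PUz QV P (c a).1 y ≤ P ((c a).2 b') y then 1 else 0) ≤ τ⁻¹ := by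
  rw [wC2 hp hQ a h (fun u v v' => ∑ y, P v y * (if τ * PUz QV P u y ≤ P v' y then 1 else 0))]
  have : ∀ u, ∑ v, pU u * QV u v * ∑ v', QV u v' * ∑ y, P v y * (if τ * PUz QV P u y ≤ P v' y then 1 else 0) ≤ pU u * τ⁻¹ := by
    intro u
    have e : ∑ v, pU u * QV u v * ∑ v', QV u v' * ∑ y, P v y * (if τ * PUz QV P u y ≤ P v' y then 1 else 0) =
        pU u * ∑ v', QV u v' * ∑ y, PUz QV P u y * (if τ * PUz QV P u y ≤ P v' y then 1 else 0) := by
      conv_rhs => arg 2; arg 2; ext v'; arg 2; arg 2; ext y; arg 1; unfold PUz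
      simp_rw [Finset.mul_sum, Finset.sum_mul, Finset.mul_sum]
      rw [Finset.sum_comm]
      refine Finset.sum_congr rfl fun v' _ => ?_
      rw [Finset.sum_comm]
      refine Finset.sum_congr rfl fun y _ => Finset.sum_congr rfl fun v _ => by ring
    rw [e]
    refine mul_le_mul_of_nonneg_left ?_ (hp.1 u)
    calc _ ≤ ∑ v', QV u v' * ∑ y, τ⁻¹ * P v' y := by
          refine Finset.sum_le_sum fun v' _ => mul_le_mul_of_nonneg_left (Finset.sum_le_sum fun y _ => ?_) ((hQ u).1 v')
          split_ifs with h
          · rw [mul_one, inv_mul_eq_div, le_div_iff₀ hτ]; linarith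
          · rw [mul_zero]; exact mul_nonneg (by positivity) ((hP v').1 y)
      _ = τ⁻¹ := by
          simp only [← Finset.mul_sum, (hP _).2, mul_one, ← Finset.sum_mul, (hQ u).2, one_mul]
  refine (Finset.sum_le_sum fun u _ => this u).trans ?_
  rw [← Finset.sum_mul, hp.2, one_mul]

lemma err_diff (hp : IsPMF pU) (hQ : IsChannel QV) {P : V → Y → ℝ} (hP : IsChannel P) {τ : ℝ} (hτ : 0 < τ)
    {a a' : A} (h : a ≠ a') (b b' : B) :
    ∑ c : A → U × (B → V), wC pU QV c * ∑ y, P ((c a).2 b) y *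
      (if τ * PRz pU QV P y ≤ P ((c a').2 b') y then 1 else 0) ≤ τ⁻¹ := by
  rw [wC3 hp hQ h b b' (fun u v v' => ∑ y, P v y * (if τ * PRz pU QV P y ≤ P v' y then 1 else 0))]
  have e : ∑ u, ∑ v, pU u * QV u v * ∑ u', ∑ v', pU u' * QV u' v' * ∑ y, P v y * (if τ * PRz pU QV P y ≤ P v' y then 1 else 0) =
      ∑ u', ∑ v', pU u' * QV u' v' * ∑ y, PRz pU QV P y * (if τ * PRz pU QV P y ≤ P v' y then 1 else 0) := by
    conv_rhs => arg 2; ext u'; arg 2; ext v'; arg 2; arg 2; ext y; arg 1; unfold PRz PUz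
    simp_rw [Finset.mul_sum, Finset.sum_mul, Finset.mul_sum]
    calc _ = ∑ u, ∑ u', ∑ v, ∑ v', ∑ y, pU u * QV u v * (pU u' * QV u' v' * (P v y * (if τ * PRz pU QV P y ≤ P v' y then 1 else 0))) :=
          Finset.sum_congr rfl fun u _ => Finset.sum_comm
      _ = ∑ u', ∑ u, ∑ v, ∑ v', ∑ y, pU u * QV u v * (pU u' * QV u' v' * (P v y * (if τ * PRz pU QV P y ≤ P v' y then 1 else 0))) := Finset.sum_comm
      _ = _ := by
        refine Finset.sum_congr rfl fun u' _ => ?_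
        rw [Finset.sum_congr rfl fun u _ => Finset.sum_comm]
        rw [Finset.sum_comm]
        refine Finset.sum_congr rfl fun v' _ => ?_
        rw [Finset.sum_congr rfl fun u _ => Finset.sum_comm]
        rw [Finset.sum_comm]
        refine Finset.sum_congr rfl fun y _ => Finset.sum_congr rfl fun u _ => Finset.sum_congr rfl fun v _ => by ring
  rw [e]
  calc _ ≤ ∑ u', ∑ v', pU u' * QV u' v' * ∑ y, τ⁻¹ * P v' y := by
        refine Finset.sum_le_sum fun u' _ => Finset.sum_le_sum fun v' _ =>
          mul_le_mul_of_nonneg_left (Finset.sum_le_sum fun y _ => ?_) (mul_nonneg (hp.1 _) ((hQ u').1 v'))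
        split_ifs with h
        · rw [mul_one, inv_mul_eq_div, le_div_iff₀ hτ]; linarith
        · rw [mul_zero]; exact mul_nonneg (by positivity) ((hP v').1 y)
    _ = τ⁻¹ := by
        simp only [← Finset.mul_sum, (hP _).2, mul_one, ← Finset.sum_mul, (hQ _).2, hp.2, one_mul]

/-- the threshold test -/
def passT (pU : U → ℝ) (QV : U → V → ℝ) (P : V → Y → ℝ) (τ1 τ2 : ℝ) (c : A → U × (B → V)) (y : Y) (j : A × B) : Prop :=
  τ1 * PUz QV P (c j.1).1 y ≤ P ((c j.1).2 j.2) y ∧ τ2 * PRz pU QV P y ≤ P ((c j.1).2 j.2) y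

/-- the threshold decoder -/
def decI [Nonempty (A × B)] (pU : U → ℝ) (QV : U → V → ℝ) (P : V → Y → ℝ) (τ1 τ2 : ℝ) (c : A → U × (B → V)) (y : Y) : A × B :=
  if h : ∃ j, passT pU QV P τ1 τ2 c y j then h.choose else Classical.arbitrary _

def Pi1 (pU : U → ℝ) (QV : U → V → ℝ) (P : V → Y → ℝ) (τ : ℝ) : ℝ :=
  ∑ u, ∑ v, pU u * QV u v * ∑ y, P v y * (if P v y < τ * PUz QV P u y then 1 else 0)
def Pi2 (pU : U → ℝ) (QV : U → V → ℝ) (P : V → Y → ℝ) (τ : ℝ) : ℝ :=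
  ∑ u, ∑ v, pU u * QV u v * ∑ y, P v y * (if P v y < τ * PRz pU QV P y then 1 else 0)

lemma decI_le [Nonempty (A × B)] (P : V → Y → ℝ) (τ1 τ2 : ℝ) (c : A → U × (B → V)) (y : Y) (a : A) (b : B) :
    (if decI pU QV P τ1 τ2 c y ≠ (a, b) then (1 : ℝ) else 0) ≤
      (if P ((c a).2 b) y < τ1 * PUz QV P (c a).1 y then 1 else 0) +
      (if P ((c a).2 b) y < τ2 * PRz pU QV P y then 1 else 0) +
      (∑ b', if b ≠ b' then (if τ1 * PUz QV P (c a).1 y ≤ P ((c a).2 b') y then 1 else 0) else 0) +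
      (∑ a', ∑ b', if a ≠ a' then (if τ2 * PRz pU QV P y ≤ P ((c a').2 b') y then 1 else 0) else 0) := by
  have n1 : (0 : ℝ) ≤ (if P ((c a).2 b) y < τ1 * PUz QV P (c a).1 y then 1 else 0) := by split_ifs <;> norm_num
  have n2 : (0 : ℝ) ≤ (if P ((c a).2 b) y < τ2 * PRz pU QV P y then 1 else 0) := by split_ifs <;> norm_num
  have n3' : ∀ b', (0 : ℝ) ≤ if b ≠ b' then (if τ1 * PUz QV P (c a).1 y ≤ P ((c a).2 b') y then 1 else 0) else 0 := by
    intro b'; split_ifs <;> norm_num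
  have n4' : ∀ a' b', (0 : ℝ) ≤ if a ≠ a' then (if τ2 * PRz pU QV P y ≤ P ((c a').2 b') y then 1 else 0) else 0 := by
    intro a' b'; split_ifs <;> norm_num
  have n3 := Finset.sum_nonneg fun b' (_ : b' ∈ Finset.univ) => n3' b'
  have n4 := Finset.sum_nonneg fun a' (_ : a' ∈ Finset.univ) => Finset.sum_nonneg fun b' (_ : b' ∈ Finset.univ) => n4' a' b'
  by_cases hd : decI pU QV P τ1 τ2 c y = (a, b)
  · simp only [hd, ne_eq, not_true_eq_false, if_false]; linarith
  rw [if_pos hd]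
  by_cases hp : passT pU QV P τ1 τ2 c y (a, b)
  · have hex : ∃ j, passT pU QV P τ1 τ2 c y j := ⟨_, hp⟩
    have hc : passT pU QV P τ1 τ2 c y (decI pU QV P τ1 τ2 c y) := by
      unfold decI; rw [dif_pos hex]; exact hex.choose_spec
    rcases hdi : decI pU QV P τ1 τ2 c y with ⟨a', b'⟩
    rw [hdi] at hc hd
    by_cases ha : a = a'
    · subst ha
      have hb : b ≠ b' := fun h => hd (by rw [h])
      have := Finset.single_le_sum (fun b' (_ : b' ∈ Finset.univ) => n3' b') (Finset.mem_univ b')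
      rw [if_pos hb, if_pos hc.1] at this
      linarith
    · have h1 := Finset.single_le_sum (fun a' (_ : a' ∈ Finset.univ) => Finset.sum_nonneg fun b' (_ : b' ∈ Finset.univ) => n4' a' b')
        (Finset.mem_univ a')
      have h2 := Finset.single_le_sum (fun b'' (_ : b'' ∈ Finset.univ) => n4' a' b'') (Finset.mem_univ b')
      rw [if_pos ha, if_pos hc.2] at h2
      linarith
  · unfold passT at hp
    rw [not_and_or, not_le, not_le] at hp
    rcases hp with h | h
    · rw [if_pos h]; linarith
    · rw [if_pos h]; linarith

lemma err_bound [Nonempty (A × B)] (hp : IsPMF pU) (hQ : IsChannel QV) {P : V → Y → ℝ} (hP : IsChannel P) {τ1 τ2 : ℝ}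
    (h1 : 0 < τ1) (h2 : 0 < τ2) (a : A) (b : B) :
    ∑ c : A → U × (B → V), wC pU QV c * ∑ y, P ((c a).2 b) y * (if decI pU QV P τ1 τ2 c y ≠ (a, b) then (1 : ℝ) else 0) ≤
      Pi1 pU QV P τ1 + Pi2 pU QV P τ2 + ((Fintype.card B : ℝ) - 1) * τ1⁻¹ + ((Fintype.card A : ℝ) - 1) * (Fintype.card B) * τ2⁻¹ := by
  calc _ ≤ ∑ c : A → U × (B → V), wC pU QV c * ∑ y, P ((c a).2 b) y *
      ((if P ((c a).2 b) y < τ1 * PUz QV P (c a).1 y then 1 else 0) +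
      (if P ((c a).2 b) y < τ2 * PRz pU QV P y then 1 else 0) +
      (∑ b', if b ≠ b' then (if τ1 * PUz QV P (c a).1 y ≤ P ((c a).2 b') y then 1 else 0) else 0) +
      (∑ a', ∑ b', if a ≠ a' then (if τ2 * PRz pU QV P y ≤ P ((c a').2 b') y then 1 else 0) else 0)) :=
        Finset.sum_le_sum fun c _ => mul_le_mul_of_nonneg_left (Finset.sum_le_sum fun y _ =>
          mul_le_mul_of_nonneg_left (decI_le P τ1 τ2 c y a b) ((hP _).1 y)) (wC_nonneg hp hQ c)
    _ = Pi1 pU QV P τ1 + Pi2 pU QV P τ2 +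
      (∑ b', if b ≠ b' then ∑ c : A → U × (B → V), wC pU QV c * ∑ y, P ((c a).2 b) y *
        (if τ1 * PUz QV P (c a).1 y ≤ P ((c a).2 b') y then 1 else 0) else 0) +
      (∑ a', ∑ b', if a ≠ a' then ∑ c : A → U × (B → V), wC pU QV c * ∑ y, P ((c a).2 b) y *
        (if τ2 * PRz pU QV P y ≤ P ((c a').2 b') y then 1 else 0) else 0) := by
        simp only [mul_add, Finset.sum_add_distrib]
        congr 1
        · congr 1
          · congr 1
            · exact wC1 hp hQ a b (fun u v => ∑ y, P v y * (if P v y < τ1 * PUz QV P u y then 1 else 0))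
            · exact wC1 hp hQ a b (fun u v => ∑ y, P v y * (if P v y < τ2 * PRz pU QV P y then 1 else 0))
          · simp_rw [Finset.mul_sum]
            rw [Finset.sum_congr rfl fun c _ => Finset.sum_comm, Finset.sum_comm]
            refine Finset.sum_congr rfl fun b' _ => ?_
            by_cases hb : b = b' <;> simp [hb]
        · simp_rw [Finset.mul_sum]
          rw [Finset.sum_congr rfl fun c _ => Finset.sum_comm, Finset.sum_comm]
          refine Finset.sum_congr rfl fun a' _ => ?_
          rw [Finset.sum_congr rfl fun c _ => Finset.sum_comm, Finset.sum_comm]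
          refine Finset.sum_congr rfl fun b' _ => ?_
          by_cases hb : a = a' <;> simp [hb]
    _ ≤ Pi1 pU QV P τ1 + Pi2 pU QV P τ2 + (∑ b', if b ≠ b' then τ1⁻¹ else 0) + (∑ a' : A, ∑ b' : B, if a ≠ a' then τ2⁻¹ else 0) := by
        refine add_le_add (add_le_add le_rfl (Finset.sum_le_sum fun b' _ => ?_)) (Finset.sum_le_sum fun a' _ => Finset.sum_le_sum fun b' _ => ?_)
        · by_cases hb : b = b'
          · simp [hb]
          · rw [if_pos hb, if_pos hb]; exact err_same hp hQ hP h1 a hb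
        · by_cases hb : a = a'
          · simp [hb]
          · rw [if_pos hb, if_pos hb]; exact err_diff hp hQ hP h2 hb b b'
    _ = _ := by
        have e : ∀ {T : Type _} [Fintype T] (t : T) (x : ℝ), (∑ t', if t ≠ t' then x else 0) = ((Fintype.card T : ℝ) - 1) * x := by
          intro T _ t x
          have : ∀ t', (if t ≠ t' then x else 0) = x - (if t = t' then x else 0) := by
            intro t'; by_cases h : t = t' <;> simp [h]
          simp only [this, Finset.sum_sub_distrib, Finset.sum_ite_eq, Finset.mem_univ, if_true, Finset.sum_const, Finset.card_univ, nsmul_eq_mul]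
          ring
        rw [e, Finset.sum_comm]
        congr 1
        have e2 : ∀ b' : B, (∑ a' : A, if a ≠ a' then τ2⁻¹ else 0) = ((Fintype.card A : ℝ) - 1) * τ2⁻¹ := by
          intro b'
          have : ∀ t', (if a ≠ t' then τ2⁻¹ else 0) = τ2⁻¹ - (if a = t' then τ2⁻¹ else 0) := by
            intro t'; by_cases h : a = t' <;> simp [h]
          simp only [this, Finset.sum_sub_distrib, Finset.sum_ite_eq, Finset.mem_univ, if_true, Finset.sum_const, Finset.card_univ, nsmul_eq_mul]
          ring
        rw [Finset.sum_congr rfl fun b' _ => e2 b']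
        simp
        ring
end oneshot2

section leak1
open Classical

lemma tang {C J Z : Type*} [Fintype C] [Fintype J] [Nonempty J] [Fintype Z] (w : C → ℝ) (hw : ∀ c, 0 ≤ w c)
    (f : C → J → Z → ℝ) (hf : ∀ c j z, 0 ≤ f c j z) (G : C → Z → ℝ) (hG : ∀ c z, 0 ≤ G c z)
    (hs : ∀ c j z, w c ≠ 0 → f c j z ≠ 0 → G c z ≠ 0)
    (x0 : C → J → Z → ℝ) (hx : ∀ c j z, 0 < x0 c j z)
    (hk : ∀ j, ∑ j', ∑ c, w c * ∑ z, f c j z / (G c z * x0 c j z) * f c j' z ≤ (Fintype.card J : ℝ) * ∑ c, w c * ∑ z, f c j z) :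
    ∑ c, w c * ∑ z, ((Fintype.card J : ℝ)⁻¹ * ∑ j, f c j z) * Real.log (((Fintype.card J : ℝ)⁻¹ * ∑ j, f c j z) / G c z) ≤
      (Fintype.card J : ℝ)⁻¹ * ∑ j, ∑ c, w c * ∑ z, f c j z * Real.log (x0 c j z) := by
  have hN : (0 : ℝ) < Fintype.card J := by exact_mod_cast Fintype.card_pos
  generalize hNd : (Fintype.card J : ℝ) = N at *
  have e : ∑ c, w c * ∑ z, (N⁻¹ * ∑ j, f c j z) * Real.log ((N⁻¹ * ∑ j, f c j z) / G c z) =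
      N⁻¹ * ∑ j, ∑ c, w c * ∑ z, f c j z * Real.log ((N⁻¹ * ∑ j, f c j z) / G c z) := by
    rw [Finset.sum_comm, Finset.mul_sum]
    refine Finset.sum_congr rfl fun c _ => ?_
    rw [← Finset.mul_sum, mul_left_comm, Finset.sum_comm, Finset.mul_sum (a := N⁻¹)]
    congr 1
    refine Finset.sum_congr rfl fun z _ => ?_
    rw [← Finset.sum_mul, mul_assoc]
  rw [e]
  refine mul_le_mul_of_nonneg_left (Finset.sum_le_sum fun j _ => ?_) (by positivity)
  have key : ∀ c, w c * ∑ z, f c j z * Real.log ((N⁻¹ * ∑ j, f c j z) / G c z) ≤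
      w c * ∑ z, f c j z * Real.log (x0 c j z) +
      (N⁻¹ * (∑ j', w c * ∑ z, f c j z / (G c z * x0 c j z) * f c j' z) - w c * ∑ z, f c j z) := by
    intro c
    by_cases h0 : w c = 0
    · simp [h0]
    have e2 : N⁻¹ * (∑ j', w c * ∑ z, f c j z / (G c z * x0 c j z) * f c j' z) =
        w c * ∑ z, f c j z * ((N⁻¹ * ∑ j', f c j' z) / G c z / x0 c j z) := by
      rw [← Finset.mul_sum, Finset.sum_comm, Finset.mul_sum, Finset.mul_sum, Finset.mul_sum]
      refine Finset.sum_congr rfl fun z _ => ?_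
      rw [← Finset.mul_sum]
      field_simp
    rw [e2, ← mul_sub, ← mul_add, ← Finset.sum_sub_distrib, ← Finset.sum_add_distrib]
    refine mul_le_mul_of_nonneg_left (Finset.sum_le_sum fun z _ => ?_) (hw c)
    by_cases h1 : f c j z = 0
    · simp [h1]
    have hf1 := lt_of_le_of_ne (hf c j z) (Ne.symm h1)
    have hG1 := lt_of_le_of_ne (hG c z) (Ne.symm (hs c j z h0 h1))
    have hT : 0 < N⁻¹ * ∑ j', f c j' z := mul_pos (by positivity)
      (lt_of_lt_of_le hf1 (Finset.single_le_sum (fun j' _ => hf c j' z) (Finset.mem_univ j)))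
    have hq : 0 < (N⁻¹ * ∑ j', f c j' z) / G c z := div_pos hT hG1
    have := Real.log_le_sub_one_of_pos (div_pos hq (hx c j z))
    rw [Real.log_div hq.ne' (hx c j z).ne'] at this
    have := mul_le_mul_of_nonneg_left this hf1.le
    linarith
  refine (Finset.sum_le_sum fun c _ => key c).trans ?_
  rw [Finset.sum_add_distrib, Finset.sum_sub_distrib, ← Finset.mul_sum, Finset.sum_comm (γ := C)]
  have h3 := mul_le_mul_of_nonneg_left (hk j) (inv_nonneg.2 hN.le)
  rw [← mul_assoc, inv_mul_cancel₀ hN.ne', one_mul] at h3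
  linarith

variable {U V Z A B A0 B0 : Type*} [Fintype U] [Fintype V] [Fintype Z] [Fintype A] [Fintype B] [Fintype A0] [Fintype B0]
variable {pU : U → ℝ} {QV : U → V → ℝ}

lemma pair1 (hp : IsPMF pU) (hQ : IsChannel QV) {P : V → Z → ℝ} (hP : IsChannel P)
    (h : U → V → Z → ℝ) (hh : ∀ u v z, 0 ≤ h u v z) (a : A) (b b' : B) :
    ∑ c : A → U × (B → V), wC pU QV c * ∑ z, h (c a).1 ((c a).2 b) z * P ((c a).2 b') z ≤
      ∑ u, ∑ v, pU u * QV u v * ∑ z, h u v z * ((if b = b' then P v z else 0) + PUz QV P u z) := by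
  by_cases hb : b = b'
  · subst hb
    rw [wC1 hp hQ a b (fun u v => ∑ z, h u v z * P v z)]
    refine Finset.sum_le_sum fun u _ => Finset.sum_le_sum fun v _ => mul_le_mul_of_nonneg_left
      (Finset.sum_le_sum fun z _ => mul_le_mul_of_nonneg_left ?_ (hh _ _ _)) (mul_nonneg (hp.1 u) ((hQ u).1 v))
    rw [if_pos rfl]
    linarith [(PUz_chan hQ hP u).1 z]
  · rw [wC2 hp hQ a hb (fun u v v' => ∑ z, h u v z * P v' z)]
    refine le_of_eq (Finset.sum_congr rfl fun u _ => Finset.sum_congr rfl fun v _ => ?_)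
    congr 1
    simp only [if_neg hb, zero_add]
    unfold PUz
    simp_rw [Finset.mul_sum]
    rw [Finset.sum_comm]
    refine Finset.sum_congr rfl fun z _ => Finset.sum_congr rfl fun v' _ => by ring

lemma pair2 (hp : IsPMF pU) (hQ : IsChannel QV) {P : V → Z → ℝ} (hP : IsChannel P)
    (h : U → V → Z → ℝ) (hh : ∀ u v z, 0 ≤ h u v z) (a a' : A) (b b' : B) :
    ∑ c : A → U × (B → V), wC pU QV c * ∑ z, h (c a).1 ((c a).2 b) z * P ((c a').2 b') z ≤
      ∑ u, ∑ v, pU u * QV u v * ∑ z, h u v z * ((if a = a' ∧ b = b' then P v z else 0) +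
        (if a = a' then PUz QV P u z else 0) + PRz pU QV P z) := by
  by_cases ha : a = a'
  · subst ha
    refine (pair1 hp hQ hP h hh a b b').trans ?_
    refine Finset.sum_le_sum fun u _ => Finset.sum_le_sum fun v _ => mul_le_mul_of_nonneg_left
      (Finset.sum_le_sum fun z _ => mul_le_mul_of_nonneg_left ?_ (hh _ _ _)) (mul_nonneg (hp.1 u) ((hQ u).1 v))
    simp only [true_and, if_true]
    linarith [(PRz_pmf hp hQ hP).1 z]
  · rw [wC3 hp hQ ha b b' (fun u v v' => ∑ z, h u v z * P v' z)]
    refine le_of_eq (Finset.sum_congr rfl fun u _ => Finset.sum_congr rfl fun v _ => ?_)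
    congr 1
    have hn : ¬ (a = a' ∧ b = b') := fun h => ha h.1
    simp only [if_neg ha, if_neg hn, zero_add]
    unfold PRz PUz
    simp_rw [Finset.mul_sum]
    rw [Finset.sum_congr rfl fun _ _ => Finset.sum_comm, Finset.sum_comm]
    refine Finset.sum_congr rfl fun z _ => Finset.sum_congr rfl fun v' _ => Finset.sum_congr rfl fun v' _ => by ring

def x1 (QV : U → V → ℝ) (P : V → Z → ℝ) (N : ℝ) (u : U) (v : V) (z : Z) : ℝ := 1 + P v z / (N * PUz QV P u z)
def x2 (pU : U → ℝ) (QV : U → V → ℝ) (P : V → Z → ℝ) (N M : ℝ) (u : U) (v : V) (z : Z) : ℝ :=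
  1 + P v z / (N * PRz pU QV P z) + PUz QV P u z / (M * PRz pU QV P z)
def Lam1 (pU : U → ℝ) (QV : U → V → ℝ) (P : V → Z → ℝ) (N : ℝ) : ℝ :=
  ∑ u, ∑ v, pU u * QV u v * ∑ z, P v z * Real.log (x1 QV P N u v z)
def Lam2 (pU : U → ℝ) (QV : U → V → ℝ) (P : V → Z → ℝ) (N M : ℝ) : ℝ :=
  ∑ u, ∑ v, pU u * QV u v * ∑ z, P v z * Real.log (x2 pU QV P N M u v z)

lemma x1_pos (hQ : IsChannel QV) {P : V → Z → ℝ} (hP : IsChannel P) {N : ℝ} (hN : 0 ≤ N) (u : U) (v : V) (z : Z) :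
    0 < x1 QV P N u v z := by
  have := (PUz_chan hQ hP u).1 z
  have := (hP v).1 z
  unfold x1; positivity
lemma x2_pos (hp : IsPMF pU) (hQ : IsChannel QV) {P : V → Z → ℝ} (hP : IsChannel P) {N M : ℝ} (hN : 0 ≤ N) (hM : 0 ≤ M) (u : U) (v : V) (z : Z) :
    0 < x2 pU QV P N M u v z := by
  have := (PUz_chan hQ hP u).1 z
  have := (PRz_pmf hp hQ hP).1 z
  have := (hP v).1 z
  unfold x2; positivity

lemma leakL1 [Nonempty B0] (hp : IsPMF pU) (hQ : IsChannel QV) {P : V → Z → ℝ} (hP : IsChannel P)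
    (a : A) (β : B0 → B) (hβ : Function.Injective β) :
    ∑ c : A → U × (B → V), wC pU QV c * ∑ z, ((Fintype.card B0 : ℝ)⁻¹ * ∑ b0, P ((c a).2 (β b0)) z) *
      Real.log (((Fintype.card B0 : ℝ)⁻¹ * ∑ b0, P ((c a).2 (β b0)) z) / PUz QV P (c a).1 z) ≤
      Lam1 pU QV P (Fintype.card B0) := by
  have hN : (0 : ℝ) < Fintype.card B0 := by exact_mod_cast Fintype.card_pos
  have hx := fun u v z => x1_pos (u := u) (v := v) (z := z) hQ hP hN.le
  refine (tang (fun c => wC pU QV c) (wC_nonneg hp hQ) (fun c b0 z => P ((c a).2 (β b0)) z) (fun c b0 z => (hP _).1 z)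
    (fun c z => PUz QV P (c a).1 z) (fun c z => (PUz_chan hQ hP _).1 z) ?_
    (fun c b0 z => x1 QV P (Fintype.card B0) (c a).1 ((c a).2 (β b0)) z) (fun c b0 z => hx _ _ _) ?_).trans ?_
  · intro c b0 z hc hf hG
    exact hf (PU_zero hQ hP (wC_supp c hc a (β b0)).2 hG)
  · intro j
    refine (Finset.sum_le_sum fun j' _ => pair1 hp hQ hP (fun u v z => P v z / (PUz QV P u z * x1 QV P (Fintype.card B0) u v z))
      (fun u v z => div_nonneg ((hP v).1 z) (mul_nonneg ((PUz_chan hQ hP u).1 z) (hx u v z).le)) a (β j) (β j')).trans ?_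
    rw [wC1 hp hQ a (β j) (fun u v => ∑ z, P v z)]
    rw [Finset.sum_comm, Finset.mul_sum]
    refine Finset.sum_le_sum fun u _ => ?_
    rw [Finset.sum_comm, Finset.mul_sum]
    refine Finset.sum_le_sum fun v _ => ?_
    rw [← Finset.mul_sum, Finset.sum_comm, mul_left_comm]
    by_cases h0 : pU u * QV u v = 0
    · simp [h0]
    refine mul_le_mul_of_nonneg_left ?_ (mul_nonneg (hp.1 u) ((hQ u).1 v))
    rw [Finset.mul_sum]
    refine Finset.sum_le_sum fun z _ => ?_
    rw [← Finset.mul_sum, Finset.sum_add_distrib]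
    simp only [hβ.eq_iff, Finset.sum_ite_eq, Finset.mem_univ, if_true, Finset.sum_const, Finset.card_univ, nsmul_eq_mul]
    by_cases h1 : P v z = 0
    · simp [h1]
    have hU : 0 < PUz QV P u z := lt_of_le_of_ne ((PUz_chan hQ hP u).1 z) (Ne.symm fun h => h1 (PU_zero hQ hP (right_ne_zero_of_mul h0) h))
    apply le_of_eq
    have hx' := hx u v z
    rw [div_mul_eq_mul_div, div_eq_iff (mul_pos hU hx').ne']
    unfold x1
    field_simp
    ring
  · have : ∀ j, ∑ c : A → U × (B → V), wC pU QV c * ∑ z, P ((c a).2 (β j)) z * Real.log (x1 QV P (Fintype.card B0) (c a).1 ((c a).2 (β j)) z) =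
        Lam1 pU QV P (Fintype.card B0) := fun j =>
      wC1 hp hQ a (β j) (fun u v => ∑ z, P v z * Real.log (x1 QV P (Fintype.card B0) u v z))
    simp only [this, Finset.sum_const, Finset.card_univ, nsmul_eq_mul]
    rw [← mul_assoc, inv_mul_cancel₀ hN.ne', one_mul]

lemma leakL2 [Nonempty A0] [Nonempty B0] (hp : IsPMF pU) (hQ : IsChannel QV) {P : V → Z → ℝ} (hP : IsChannel P)
    (α : A0 → A) (hα : Function.Injective α) (β : B0 → B) (hβ : Function.Injective β) :
    ∑ c : A → U × (B → V), wC pU QV c * ∑ z, ((Fintype.card (A0 × B0) : ℝ)⁻¹ * ∑ j : A0 × B0, P ((c (α j.1)).2 (β j.2)) z) *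
      Real.log (((Fintype.card (A0 × B0) : ℝ)⁻¹ * ∑ j : A0 × B0, P ((c (α j.1)).2 (β j.2)) z) / PRz pU QV P z) ≤
      Lam2 pU QV P (Fintype.card (A0 × B0)) (Fintype.card A0) := by
  have hN : (0 : ℝ) < Fintype.card (A0 × B0) := by exact_mod_cast Fintype.card_pos
  have hM : (0 : ℝ) < Fintype.card A0 := by exact_mod_cast Fintype.card_pos
  have hx := fun u v z => x2_pos (u := u) (v := v) (z := z) hp hQ hP hN.le hM.le
  refine (tang (fun c => wC pU QV c) (wC_nonneg hp hQ) (fun c (j : A0 × B0) z => P ((c (α j.1)).2 (β j.2)) z) (fun c b0 z => (hP _).1 z)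
    (fun c z => PRz pU QV P z) (fun c z => (PRz_pmf hp hQ hP).1 z) ?_
    (fun c j z => x2 pU QV P (Fintype.card (A0 × B0)) (Fintype.card A0) (c (α j.1)).1 ((c (α j.1)).2 (β j.2)) z) (fun c b0 z => hx _ _ _) ?_).trans ?_
  · intro c b0 z hc hf hG
    have hs := wC_supp c hc (α b0.1) (β b0.2)
    exact hf (PU_zero hQ hP hs.2 (PR_zero hp hQ hP hs.1 hG))
  · intro j
    refine (Finset.sum_le_sum fun j' _ => pair2 hp hQ hP (fun u v z => P v z / (PRz pU QV P z * x2 pU QV P (Fintype.card (A0 × B0)) (Fintype.card A0) u v z))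
      (fun u v z => div_nonneg ((hP v).1 z) (mul_nonneg ((PRz_pmf hp hQ hP).1 z) (hx u v z).le)) (α j.1) (α j'.1) (β j.2) (β j'.2)).trans ?_
    rw [wC1 hp hQ (α j.1) (β j.2) (fun u v => ∑ z, P v z)]
    rw [Finset.sum_comm, Finset.mul_sum]
    refine Finset.sum_le_sum fun u _ => ?_
    rw [Finset.sum_comm, Finset.mul_sum]
    refine Finset.sum_le_sum fun v _ => ?_
    rw [← Finset.mul_sum, Finset.sum_comm, mul_left_comm]
    by_cases h0 : pU u * QV u v = 0
    · simp [h0]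
    refine mul_le_mul_of_nonneg_left ?_ (mul_nonneg (hp.1 u) ((hQ u).1 v))
    rw [Finset.mul_sum]
    refine Finset.sum_le_sum fun z _ => ?_
    rw [← Finset.mul_sum, Finset.sum_add_distrib, Finset.sum_add_distrib]
    have s1 : ∑ j' : A0 × B0, (if α j.1 = α j'.1 ∧ β j.2 = β j'.2 then P v z else 0) = P v z := by
      rw [Finset.sum_eq_single j]
      · simp
      · intro j' _ hj'
        refine if_neg fun h => hj' (Prod.ext (hα h.1).symm (hβ h.2).symm)
      · simp
    have s2 : ∑ j' : A0 × B0, (if α j.1 = α j'.1 then PUz QV P u z else 0) = Fintype.card B0 * PUz QV P u z := by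
      rw [Fintype.sum_prod_type]
      simp only [hα.eq_iff, Finset.sum_const, Finset.card_univ, nsmul_eq_mul, ← Finset.mul_sum, Finset.sum_ite_eq, Finset.mem_univ, if_true]
    rw [s1, s2]
    simp only [Finset.sum_const, Finset.card_univ, nsmul_eq_mul]
    by_cases h1 : P v z = 0
    · simp [h1]
    have hU : 0 < PRz pU QV P z := lt_of_le_of_ne ((PRz_pmf hp hQ hP).1 z)
      (Ne.symm fun h => h1 (PU_zero hQ hP (right_ne_zero_of_mul h0) (PR_zero hp hQ hP (left_ne_zero_of_mul h0) h)))
    apply le_of_eq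
    have hx' := hx u v z
    have hc : (Fintype.card (A0 × B0) : ℝ) = Fintype.card A0 * Fintype.card B0 := by rw [Fintype.card_prod]; push_cast; rfl
    rw [div_mul_eq_mul_div, div_eq_iff (mul_pos hU hx').ne']
    unfold x2
    rw [hc] at hN ⊢
    have hB : (Fintype.card B0 : ℝ) ≠ 0 := (right_ne_zero_of_mul hN.ne')
    field_simp
    ring
  · have : ∀ j : A0 × B0, ∑ c : A → U × (B → V), wC pU QV c * ∑ z, P ((c (α j.1)).2 (β j.2)) z *
        Real.log (x2 pU QV P (Fintype.card (A0 × B0)) (Fintype.card A0) (c (α j.1)).1 ((c (α j.1)).2 (β j.2)) z) =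
        Lam2 pU QV P (Fintype.card (A0 × B0)) (Fintype.card A0) := fun j =>
      wC1 hp hQ (α j.1) (β j.2) (fun u v => ∑ z, P v z * Real.log (x2 pU QV P (Fintype.card (A0 × B0)) (Fintype.card A0) u v z))
    simp only [this, Finset.sum_const, Finset.card_univ, nsmul_eq_mul]
    rw [← mul_assoc, inv_mul_cancel₀ hN.ne', one_mul]
end leak1

section KL
open Classical

lemma mi_form {M Z : Type*} [Fintype M] [Nonempty M] [Fintype Z] (T : M → Z → ℝ) (hT : IsChannel T) :
    Real.log 2 * mutInfo (fun q : M × Z => (Fintype.card M : ℝ)⁻¹ * T q.1 q.2) =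
      (Fintype.card M : ℝ)⁻¹ * ∑ m, ∑ z, T m z * Real.log (T m z / ((Fintype.card M : ℝ)⁻¹ * ∑ m', T m' z)) := by
  have hN : (0 : ℝ) < Fintype.card M := by exact_mod_cast Fintype.card_pos
  unfold mutInfo
  rw [Fintype.sum_prod_type, Finset.mul_sum, Finset.mul_sum]
  refine Finset.sum_congr rfl fun m _ => ?_
  rw [Finset.mul_sum, Finset.mul_sum]
  refine Finset.sum_congr rfl fun z _ => ?_
  simp only [← Finset.mul_sum, (hT m).2, mul_one]
  rw [mul_div_mul_left _ _ (inv_ne_zero hN.ne'), Real.logb]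
  have : Real.log 2 ≠ 0 := by positivity
  field_simp

lemma mi_nonneg {M Z : Type*} [Fintype M] [Nonempty M] [Fintype Z] (T : M → Z → ℝ) (hT : IsChannel T) :
    0 ≤ mutInfo (fun q : M × Z => (Fintype.card M : ℝ)⁻¹ * T q.1 q.2) := by
  have hN : (0 : ℝ) < Fintype.card M := by exact_mod_cast Fintype.card_pos
  have h2 : 0 < Real.log 2 := by positivity
  have h := mi_form T hT
  have : 0 ≤ Real.log 2 * mutInfo (fun q : M × Z => (Fintype.card M : ℝ)⁻¹ * T q.1 q.2) := by
    rw [h]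
    refine mul_nonneg (by positivity) (Finset.sum_nonneg fun m _ => ?_)
    have hs : ∑ z, (Fintype.card M : ℝ)⁻¹ * ∑ m', T m' z = 1 := by
      rw [← Finset.mul_sum, Finset.sum_comm]
      simp only [(hT _).2, Finset.sum_const, Finset.card_univ, nsmul_eq_mul, mul_one]
      exact inv_mul_cancel₀ hN.ne'
    have := logsum (T m) (fun z => (Fintype.card M : ℝ)⁻¹ * ∑ m', T m' z) (hT m).1
      (fun z => mul_nonneg (by positivity) (Finset.sum_nonneg fun m' _ => (hT m').1 z)) (fun z hz => by
        rcases mul_eq_zero.1 hz with h | h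
        · exact absurd h (by positivity)
        · exact sum_eq_zero_imp (fun m' => (hT m').1 z) h m)
    rw [(hT m).2, hs] at this
    simpa using this
  exact nonneg_of_mul_nonneg_right this h2

lemma mi_KL {M Z : Type*} [Fintype M] [Nonempty M] [Fintype Z] (T : M → Z → ℝ) (hT : IsChannel T)
    (G : Z → ℝ) (hG : IsPMF G) (h0 : ∀ m z, G z = 0 → T m z = 0) :
    Real.log 2 * mutInfo (fun q : M × Z => (Fintype.card M : ℝ)⁻¹ * T q.1 q.2) ≤
      (Fintype.card M : ℝ)⁻¹ * ∑ m, ∑ z, T m z * Real.log (T m z / G z) := by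
  have hN : (0 : ℝ) < Fintype.card M := by exact_mod_cast Fintype.card_pos
  rw [mi_form T hT]
  set S : Z → ℝ := fun z => (Fintype.card M : ℝ)⁻¹ * ∑ m', T m' z with hS
  have hs : ∑ z, S z = 1 := by
    rw [hS, ← Finset.mul_sum, Finset.sum_comm]
    simp only [(hT _).2, Finset.sum_const, Finset.card_univ, nsmul_eq_mul, mul_one]
    exact inv_mul_cancel₀ hN.ne'
  have hS0 : ∀ z, 0 ≤ S z := fun z => mul_nonneg (by positivity) (Finset.sum_nonneg fun m' _ => (hT m').1 z)
  have hl := logsum S G hS0 hG.1 (fun z hz => by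
    simp only [hS]; rw [Finset.sum_eq_zero fun m _ => h0 m z hz, mul_zero])
  rw [hs, hG.2] at hl
  simp only [div_one, Real.log_one, mul_zero] at hl
  have e : (Fintype.card M : ℝ)⁻¹ * ∑ m, ∑ z, T m z * Real.log (T m z / G z) =
      (Fintype.card M : ℝ)⁻¹ * ∑ m, ∑ z, T m z * Real.log (T m z / S z) + ∑ z, S z * Real.log (S z / G z) := by
    have : ∑ z, S z * Real.log (S z / G z) = (Fintype.card M : ℝ)⁻¹ * ∑ m, ∑ z, T m z * Real.log (S z / G z) := by
      rw [Finset.sum_comm, Finset.mul_sum]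
      refine Finset.sum_congr rfl fun z _ => ?_
      rw [← Finset.sum_mul, ← mul_assoc]
    rw [this, ← mul_add, ← Finset.sum_add_distrib]
    congr 1
    refine Finset.sum_congr rfl fun m _ => ?_
    rw [← Finset.sum_add_distrib]
    refine Finset.sum_congr rfl fun z _ => ?_
    by_cases ht : T m z = 0
    · simp [ht]
    have hg : G z ≠ 0 := fun h => ht (h0 m z h)
    have hsz : S z ≠ 0 := by
      intro h
      simp only [hS] at h
      rcases mul_eq_zero.1 h with h | h
      · exact absurd h (by positivity)
      · exact ht (sum_eq_zero_imp (fun m' => (hT m').1 z) h m)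
    rw [Real.log_div ht hg, Real.log_div ht hsz, Real.log_div hsz hg]; ring
  rw [e]; linarith

/-- joint convexity -/
lemma KL_convex {A Z : Type*} [Fintype A] [Nonempty A] [Fintype Z] (T G : A → Z → ℝ) (hT : ∀ a z, 0 ≤ T a z) (hG : ∀ a z, 0 ≤ G a z)
    (h0 : ∀ a z, G a z = 0 → T a z = 0) :
    ∑ z, ((Fintype.card A : ℝ)⁻¹ * ∑ a, T a z) * Real.log (((Fintype.card A : ℝ)⁻¹ * ∑ a, T a z) / ((Fintype.card A : ℝ)⁻¹ * ∑ a, G a z)) ≤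
      (Fintype.card A : ℝ)⁻¹ * ∑ a, ∑ z, T a z * Real.log (T a z / G a z) := by
  have hN : (0 : ℝ) < Fintype.card A := by exact_mod_cast Fintype.card_pos
  rw [Finset.sum_comm, Finset.mul_sum]
  refine Finset.sum_le_sum fun z _ => ?_
  rw [mul_div_mul_left _ _ (inv_ne_zero hN.ne'), mul_assoc]
  refine mul_le_mul_of_nonneg_left (logsum _ _ (fun a => hT a z) (fun a => hG a z) (fun a => h0 a z)) (by positivity)

lemma avg_exists {C : Type*} [Fintype C] (w F : C → ℝ) (hw : IsPMF w) (t : ℝ) (h : ∑ c, w c * F c ≤ t) : ∃ c, F c ≤ t := by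
  by_contra hc
  push Not at hc
  have : ∃ c, w c ≠ 0 := by
    by_contra hh
    push Not at hh
    have := hw.2
    simp [hh] at this
  obtain ⟨c0, hc0⟩ := this
  have : ∑ c, w c * t < ∑ c, w c * F c := by
    refine Finset.sum_lt_sum (fun c _ => mul_le_mul_of_nonneg_left (hc c).le (hw.1 c)) ⟨c0, Finset.mem_univ _, ?_⟩
    exact mul_lt_mul_of_pos_left (hc c0) (lt_of_le_of_ne (hw.1 c0) (Ne.symm hc0))
  rw [← Finset.sum_mul, hw.2, one_mul] at this
  linarith
end KL

section oneshot3
open Classical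
variable {U V Y Z Z1 Z2 A2 A0 M1 B2 B0 M2 A B : Type*} [Fintype U] [Fintype V] [Fintype Y] [Fintype Z] [Fintype Z1] [Fintype Z2]
  [Fintype A2] [Fintype A0] [Fintype M1] [Fintype B2] [Fintype B0] [Fintype M2] [Fintype A] [Fintype B]
  [Nonempty A2] [Nonempty A0] [Nonempty M1] [Nonempty B2] [Nonempty B0]

/-- output law given the messages -/
def Tc (eA : A ≃ A2 × A0) (eB : B ≃ M1 × B2 × B0) (e : M2 ≃ A2 × B2) (P : V → Z → ℝ) (v : A → B → V) (m : M1 × M2) (z : Z) : ℝ :=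
  (Fintype.card (A0 × B0) : ℝ)⁻¹ * ∑ j : A0 × B0, P (v (eA.symm ((e m.2).1, j.1)) (eB.symm (m.1, (e m.2).2, j.2))) z

lemma avg_chan {J : Type*} [Fintype J] [Nonempty J] (f : J → Z → ℝ) (hf : IsChannel f) :
    IsPMF (fun z => (Fintype.card J : ℝ)⁻¹ * ∑ j, f j z) := by
  have hN : (0 : ℝ) < Fintype.card J := by exact_mod_cast Fintype.card_pos
  refine ⟨fun z => mul_nonneg (by positivity) (Finset.sum_nonneg fun j _ => (hf j).1 z), ?_⟩
  rw [← Finset.mul_sum, Finset.sum_comm]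
  simp only [(hf _).2, Finset.sum_const, Finset.card_univ, nsmul_eq_mul, mul_one]
  exact inv_mul_cancel₀ hN.ne'

lemma Tc_chan (eA : A ≃ A2 × A0) (eB : B ≃ M1 × B2 × B0) (e : M2 ≃ A2 × B2) {P : V → Z → ℝ} (hP : IsChannel P) (v : A → B → V) :
    IsChannel (Tc eA eB e P v) := fun m =>
  avg_chan (fun j : A0 × B0 => P (v (eA.symm ((e m.2).1, j.1)) (eB.symm (m.1, (e m.2).2, j.2)))) (fun j => hP _)

/-- output law given the first message -/
def T1c (eB : B ≃ M1 × B2 × B0) (P : V → Z → ℝ) (v : A → B → V) (k : M1) (z : Z) : ℝ :=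
  (Fintype.card A : ℝ)⁻¹ * ∑ a, (Fintype.card (B2 × B0) : ℝ)⁻¹ * ∑ b : B2 × B0, P (v a (eB.symm (k, b.1, b.2))) z

lemma T1c_chan [Nonempty A] (eB : B ≃ M1 × B2 × B0) {P : V → Z → ℝ} (hP : IsChannel P) (v : A → B → V) :
    IsChannel (T1c eB P v) := fun k =>
  avg_chan (fun a z => (Fintype.card (B2 × B0) : ℝ)⁻¹ * ∑ b : B2 × B0, P (v a (eB.symm (k, b.1, b.2))) z) (fun a =>
    avg_chan (fun b : B2 × B0 => P (v a (eB.symm (k, b.1, b.2)))) (fun b => hP _))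

lemma T1c_eq (eA : A ≃ A2 × A0) (eB : B ≃ M1 × B2 × B0) (e : M2 ≃ A2 × B2) (P : V → Z → ℝ) (v : A → B → V) (k : M1) (z : Z) :
    (Fintype.card M2 : ℝ)⁻¹ * ∑ m2, Tc eA eB e P v (k, m2) z = T1c eB P v k z := by
  have hc : Fintype.card M2 = Fintype.card A2 * Fintype.card B2 := by rw [Fintype.card_congr e, Fintype.card_prod]
  unfold Tc T1c
  simp only [← Finset.mul_sum]
  rw [e.sum_comp (fun x : A2 × B2 => ∑ j : A0 × B0, P (v (eA.symm (x.1, j.1)) (eB.symm (k, x.2, j.2))) z)]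
  have hcA : Fintype.card A = Fintype.card A2 * Fintype.card A0 := by rw [Fintype.card_congr eA, Fintype.card_prod]
  rw [← eA.symm.sum_comp (fun a => ∑ b : B2 × B0, P (v a (eB.symm (k, b.1, b.2))) z)]
  simp only [Fintype.card_prod, hc, hcA]
  simp only [Fintype.sum_prod_type]
  rw [Finset.sum_congr rfl fun a2 _ => Finset.sum_comm]
  push_cast
  rw [← mul_assoc, ← mul_assoc, ← mul_inv, ← mul_inv]
  congr 2
  ring

def err3 (eA : A ≃ A2 × A0) (eB : B ≃ M1 × B2 × B0) (e : M2 ≃ A2 × B2) (P : V → Y → ℝ) (v : A → B → V) (dec : Y → M1 × M2) : ℝ :=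
  ∑ m, ∑ y, if dec y ≠ m then ((Fintype.card M1 : ℝ) * Fintype.card M2)⁻¹ * Tc eA eB e P v m y else 0
def leak3 (eA : A ≃ A2 × A0) (eB : B ≃ M1 × B2 × B0) (e : M2 ≃ A2 × B2) (P : V → Z → ℝ) (v : A → B → V) : ℝ :=
  mutInfo (fun q : (M1 × M2) × Z => ((Fintype.card M1 : ℝ) * Fintype.card M2)⁻¹ * Tc eA eB e P v q.1 q.2)
def leak31 (eA : A ≃ A2 × A0) (eB : B ≃ M1 × B2 × B0) (e : M2 ≃ A2 × B2) (P : V → Z → ℝ) (v : A → B → V) : ℝ :=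
  mutInfo (fun q : M1 × Z => ∑ m2, ((Fintype.card M1 : ℝ) * Fintype.card M2)⁻¹ * Tc eA eB e P v (q.1, m2) q.2)

lemma leak3_eq (eA : A ≃ A2 × A0) (eB : B ≃ M1 × B2 × B0) (e : M2 ≃ A2 × B2) (P : V → Z → ℝ) (v : A → B → V) :
    leak3 eA eB e P v = mutInfo (fun q : (M1 × M2) × Z => (Fintype.card (M1 × M2) : ℝ)⁻¹ * Tc eA eB e P v q.1 q.2) := by
  unfold leak3; rw [Fintype.card_prod]; push_cast; rfl
lemma leak31_eq (eA : A ≃ A2 × A0) (eB : B ≃ M1 × B2 × B0) (e : M2 ≃ A2 × B2) (P : V → Z → ℝ) (v : A → B → V) :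
    leak31 eA eB e P v = mutInfo (fun q : M1 × Z => (Fintype.card M1 : ℝ)⁻¹ * T1c eB P v q.1 q.2) := by
  unfold leak31
  congr 1
  funext q
  rw [← T1c_eq eA eB e, ← Finset.mul_sum, mul_inv, mul_assoc]

variable {pU : U → ℝ} {QV : U → V → ℝ}

lemma wC_pmf (hp : IsPMF pU) (hQ : IsChannel QV) :
    IsPMF (fun c : A → U × (B → V) => wC pU QV c) := ⟨wC_nonneg hp hQ, wC_sum hp hQ⟩

lemma E_leak3 (hp : IsPMF pU) (hQ : IsChannel QV) {P : V → Z → ℝ} (hP : IsChannel P) (eA : A ≃ A2 × A0) (eB : B ≃ M1 × B2 × B0) (e : M2 ≃ A2 × B2) :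
    ∑ c : A → U × (B → V), wC pU QV c * (Real.log 2 * leak3 eA eB e P (fun a => (c a).2)) ≤
      Lam2 pU QV P (Fintype.card (A0 × B0)) (Fintype.card A0) := by
  have _i1 : Nonempty M2 := e.nonempty
  have _i2 : Nonempty A := eA.nonempty
  have _i3 : Nonempty B := eB.nonempty
  have hN : (0 : ℝ) < Fintype.card (M1 × M2) := by exact_mod_cast Fintype.card_pos
  calc _ ≤ ∑ c : A → U × (B → V), wC pU QV c * ((Fintype.card (M1 × M2) : ℝ)⁻¹ * ∑ m, ∑ z,
        Tc eA eB e P (fun a => (c a).2) m z * Real.log (Tc eA eB e P (fun a => (c a).2) m z / PRz pU QV P z)) := by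
        refine Finset.sum_le_sum fun c _ => ?_
        by_cases h0 : wC pU QV c = 0
        · rw [h0, zero_mul, zero_mul]
        refine mul_le_mul_of_nonneg_left ?_ (wC_nonneg hp hQ c)
        rw [leak3_eq]
        refine mi_KL _ (Tc_chan eA eB e hP _) _ (PRz_pmf hp hQ hP) fun m z hz => ?_
        unfold Tc
        rw [Finset.sum_eq_zero fun j _ => ?_, mul_zero]
        have hs := wC_supp c h0 (eA.symm ((e m.2).1, j.1)) (eB.symm (m.1, (e m.2).2, j.2))
        exact PU_zero hQ hP hs.2 (PR_zero hp hQ hP hs.1 hz)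
    _ = (Fintype.card (M1 × M2) : ℝ)⁻¹ * ∑ m : M1 × M2, ∑ c : A → U × (B → V), wC pU QV c * ∑ z,
        Tc eA eB e P (fun a => (c a).2) m z * Real.log (Tc eA eB e P (fun a => (c a).2) m z / PRz pU QV P z) := by
        rw [Finset.sum_comm, Finset.mul_sum]
        refine Finset.sum_congr rfl fun c _ => ?_
        rw [← Finset.mul_sum]; ring
    _ ≤ (Fintype.card (M1 × M2) : ℝ)⁻¹ * ∑ m : M1 × M2, Lam2 pU QV P (Fintype.card (A0 × B0)) (Fintype.card A0) := by
        refine mul_le_mul_of_nonneg_left (Finset.sum_le_sum fun m _ => ?_) (by positivity)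
        refine leakL2 hp hQ hP (fun a0 => eA.symm ((e m.2).1, a0)) ?_ (fun b0 => eB.symm (m.1, (e m.2).2, b0)) ?_
        · intro x y h; simpa using h
        · intro x y h; simpa using h
    _ = _ := by
        rw [Finset.sum_const, Finset.card_univ, nsmul_eq_mul, ← mul_assoc, inv_mul_cancel₀ hN.ne', one_mul]

lemma E_leak31 (hp : IsPMF pU) (hQ : IsChannel QV) {P : V → Z → ℝ} (hP : IsChannel P) (eA : A ≃ A2 × A0) (eB : B ≃ M1 × B2 × B0) (e : M2 ≃ A2 × B2) :
    ∑ c : A → U × (B → V), wC pU QV c * (Real.log 2 * leak31 eA eB e P (fun a => (c a).2)) ≤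
      Lam1 pU QV P (Fintype.card (B2 × B0)) := by
  have _i2 : Nonempty A := eA.nonempty
  have hN : (0 : ℝ) < Fintype.card M1 := by exact_mod_cast Fintype.card_pos
  have hA : (0 : ℝ) < Fintype.card A := by exact_mod_cast Fintype.card_pos
  calc _ ≤ ∑ c : A → U × (B → V), wC pU QV c * ((Fintype.card M1 : ℝ)⁻¹ * ∑ m : M1,
        ((Fintype.card A : ℝ)⁻¹ * ∑ a, ∑ z,
        ((Fintype.card (B2 × B0) : ℝ)⁻¹ * ∑ b : B2 × B0, P ((c a).2 (eB.symm (m, b.1, b.2))) z) *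
          Real.log (((Fintype.card (B2 × B0) : ℝ)⁻¹ * ∑ b : B2 × B0, P ((c a).2 (eB.symm (m, b.1, b.2))) z) / PUz QV P (c a).1 z))) := by
        refine Finset.sum_le_sum fun c _ => ?_
        by_cases h0 : wC pU QV c = 0
        · rw [h0, zero_mul, zero_mul]
        refine mul_le_mul_of_nonneg_left ?_ (wC_nonneg hp hQ c)
        rw [leak31_eq]
        have hz1 : ∀ (k : M1) a z, PUz QV P (c a).1 z = 0 → (Fintype.card (B2 × B0) : ℝ)⁻¹ * ∑ b : B2 × B0, P ((c a).2 (eB.symm (k, b.1, b.2))) z = 0 := by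
          intro k a z hz
          rw [Finset.sum_eq_zero fun j _ => ?_, mul_zero]
          exact PU_zero hQ hP (wC_supp c h0 a (eB.symm (k, j.1, j.2))).2 hz
        have hGp : IsPMF (fun z => (Fintype.card A : ℝ)⁻¹ * ∑ a, PUz QV P (c a).1 z) :=
          avg_chan (fun a => PUz QV P (c a).1) (fun a => PUz_chan hQ hP _)
        refine (mi_KL _ (T1c_chan eB hP _) _ hGp fun m z hz => ?_).trans ?_
        · unfold T1c
          rw [Finset.sum_eq_zero fun a _ => ?_, mul_zero]
          rcases mul_eq_zero.1 hz with h | h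
          · exact absurd h (by positivity)
          · exact hz1 m a z (sum_eq_zero_imp (fun a => (PUz_chan hQ hP (c a).1).1 z) h a)
        · refine mul_le_mul_of_nonneg_left (Finset.sum_le_sum fun m _ => ?_) (by positivity)
          unfold T1c
          exact KL_convex (fun a z => (Fintype.card (B2 × B0) : ℝ)⁻¹ * ∑ b : B2 × B0, P ((c a).2 (eB.symm (m, b.1, b.2))) z)
            (fun a z => PUz QV P (c a).1 z)
            (fun a z => mul_nonneg (by positivity) (Finset.sum_nonneg fun j _ => (hP _).1 z))
            (fun a z => (PUz_chan hQ hP _).1 z) (fun a z => hz1 m a z)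
    _ = (Fintype.card M1 : ℝ)⁻¹ * ∑ m : M1, (Fintype.card A : ℝ)⁻¹ * ∑ a : A,
        ∑ c : A → U × (B → V), wC pU QV c * ∑ z,
        ((Fintype.card (B2 × B0) : ℝ)⁻¹ * ∑ b : B2 × B0, P ((c a).2 (eB.symm (m, b.1, b.2))) z) *
          Real.log (((Fintype.card (B2 × B0) : ℝ)⁻¹ * ∑ b : B2 × B0, P ((c a).2 (eB.symm (m, b.1, b.2))) z) / PUz QV P (c a).1 z) := by
        rw [Finset.sum_congr rfl fun c _ => mul_left_comm _ _ _, ← Finset.mul_sum]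
        congr 1
        rw [Finset.sum_congr rfl fun c _ => Finset.mul_sum _ _ _, Finset.sum_comm]
        refine Finset.sum_congr rfl fun m _ => ?_
        rw [Finset.sum_congr rfl fun c _ => mul_left_comm _ _ _, ← Finset.mul_sum]
        congr 1
        rw [Finset.sum_congr rfl fun c _ => Finset.mul_sum _ _ _, Finset.sum_comm]
    _ ≤ (Fintype.card M1 : ℝ)⁻¹ * ∑ m : M1, (Fintype.card A : ℝ)⁻¹ * ∑ a : A, Lam1 pU QV P (Fintype.card (B2 × B0)) := by
        refine mul_le_mul_of_nonneg_left (Finset.sum_le_sum fun m _ => mul_le_mul_of_nonneg_left (Finset.sum_le_sum fun a _ => ?_) (by positivity)) (by positivity)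
        have hinj : Function.Injective (fun b : B2 × B0 => eB.symm (m, b.1, b.2)) := by
          intro x y h
          have h' : (m, x.1, x.2) = (m, y.1, y.2) := eB.symm.injective h
          exact congrArg Prod.snd h'
        exact leakL1 hp hQ hP a (fun b : B2 × B0 => eB.symm (m, b.1, b.2)) hinj
    _ = _ := by
        simp only [Finset.sum_const, Finset.card_univ, nsmul_eq_mul]
        rw [← mul_assoc, ← mul_assoc, inv_mul_cancel₀ hN.ne', one_mul, ← mul_assoc, inv_mul_cancel₀ hA.ne', one_mul]

def dec3 (eA : A ≃ A2 × A0) (eB : B ≃ M1 × B2 × B0) (e : M2 ≃ A2 × B2) (d : Y → A × B) (y : Y) : M1 × M2 :=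
  ((eB (d y).2).1, e.symm ((eA (d y).1).1, (eB (d y).2).2.1))

lemma E_err3 [Nonempty (A × B)] (hp : IsPMF pU) (hQ : IsChannel QV) {P : V → Y → ℝ} (hP : IsChannel P) (eA : A ≃ A2 × A0) (eB : B ≃ M1 × B2 × B0) (e : M2 ≃ A2 × B2) {τ1 τ2 : ℝ}
    (h1 : 0 < τ1) (h2 : 0 < τ2) :
    ∑ c : A → U × (B → V), wC pU QV c * err3 eA eB e P (fun a => (c a).2) (dec3 eA eB e (decI pU QV P τ1 τ2 c)) ≤
      Pi1 pU QV P τ1 + Pi2 pU QV P τ2 + ((Fintype.card B : ℝ) - 1) * τ1⁻¹ +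
        ((Fintype.card A : ℝ) - 1) * (Fintype.card B) * τ2⁻¹ := by
  have _i1 : Nonempty M2 := e.nonempty
  have _i2 : Nonempty A := eA.nonempty
  have _i3 : Nonempty B := eB.nonempty
  set E := Pi1 pU QV P τ1 + Pi2 pU QV P τ2 + ((Fintype.card B : ℝ) - 1) * τ1⁻¹ +
        ((Fintype.card A : ℝ) - 1) * (Fintype.card B) * τ2⁻¹ with hE
  have hN : (0 : ℝ) < (Fintype.card M1 : ℝ) * Fintype.card M2 := by
    have a1 : 0 < Fintype.card M1 := Fintype.card_pos
    have a2 : 0 < Fintype.card M2 := Fintype.card_pos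
    positivity
  have hJ : (0 : ℝ) < Fintype.card (A0 × B0) := by exact_mod_cast Fintype.card_pos
  calc _ ≤ ∑ c : A → U × (B → V), wC pU QV c * (((Fintype.card M1 : ℝ) * Fintype.card M2)⁻¹ * ∑ m : M1 × M2,
        (Fintype.card (A0 × B0) : ℝ)⁻¹ * ∑ j : A0 × B0, ∑ y, P ((c (eA.symm ((e m.2).1, j.1))).2 (eB.symm (m.1, (e m.2).2, j.2))) y *
          (if decI pU QV P τ1 τ2 c y ≠ (eA.symm ((e m.2).1, j.1), eB.symm (m.1, (e m.2).2, j.2)) then (1 : ℝ) else 0)) := by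
        refine Finset.sum_le_sum fun c _ => mul_le_mul_of_nonneg_left ?_ (wC_nonneg hp hQ c)
        unfold err3
        rw [Finset.mul_sum]
        refine Finset.sum_le_sum fun m _ => ?_
        rw [Finset.sum_comm, Finset.mul_sum, Finset.mul_sum]
        refine Finset.sum_le_sum fun y _ => ?_
        have hnn : ∀ j : A0 × B0, 0 ≤ P ((c (eA.symm ((e m.2).1, j.1))).2 (eB.symm (m.1, (e m.2).2, j.2))) y *
          (if decI pU QV P τ1 τ2 c y ≠ (eA.symm ((e m.2).1, j.1), eB.symm (m.1, (e m.2).2, j.2)) then (1 : ℝ) else 0) := fun j =>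
          mul_nonneg ((hP _).1 y) (by split_ifs <;> norm_num)
        by_cases hd : dec3 eA eB e (decI pU QV P τ1 τ2 c) y = m
        · rw [if_neg (not_not.2 hd)]
          exact mul_nonneg (by positivity) (mul_nonneg (by positivity) (Finset.sum_nonneg fun j _ => hnn j))
        · rw [if_pos hd]
          unfold Tc
          refine mul_le_mul_of_nonneg_left (mul_le_mul_of_nonneg_left (Finset.sum_le_sum fun j _ => ?_) (by positivity)) (by positivity)
          rw [if_pos, mul_one]
          intro h
          apply hd
          unfold dec3
          rw [h]
          simp
    _ = ((Fintype.card M1 : ℝ) * Fintype.card M2)⁻¹ * ∑ m : M1 × M2, (Fintype.card (A0 × B0) : ℝ)⁻¹ * ∑ j : A0 × B0,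
        ∑ c : A → U × (B → V), wC pU QV c * ∑ y, P ((c (eA.symm ((e m.2).1, j.1))).2 (eB.symm (m.1, (e m.2).2, j.2))) y *
          (if decI pU QV P τ1 τ2 c y ≠ (eA.symm ((e m.2).1, j.1), eB.symm (m.1, (e m.2).2, j.2)) then (1 : ℝ) else 0) := by
        rw [Finset.sum_congr rfl fun c _ => mul_left_comm _ _ _, ← Finset.mul_sum]
        congr 1
        rw [Finset.sum_congr rfl fun c _ => Finset.mul_sum _ _ _, Finset.sum_comm]
        refine Finset.sum_congr rfl fun m _ => ?_
        rw [Finset.sum_congr rfl fun c _ => mul_left_comm _ _ _, ← Finset.mul_sum]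
        congr 1
        rw [Finset.sum_congr rfl fun c _ => Finset.mul_sum _ _ _, Finset.sum_comm]
    _ ≤ ((Fintype.card M1 : ℝ) * Fintype.card M2)⁻¹ * ∑ m : M1 × M2, (Fintype.card (A0 × B0) : ℝ)⁻¹ * ∑ j : A0 × B0, E := by
        refine mul_le_mul_of_nonneg_left (Finset.sum_le_sum fun m _ => mul_le_mul_of_nonneg_left (Finset.sum_le_sum fun j _ => ?_) (by positivity)) (by positivity)
        exact err_bound hp hQ hP h1 h2 _ _
    _ = _ := by
        rw [Finset.sum_const, Finset.sum_const, Finset.card_univ, Finset.card_univ, nsmul_eq_mul, nsmul_eq_mul]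
        rw [← mul_assoc (Fintype.card (A0 × B0) : ℝ)⁻¹, inv_mul_cancel₀ hJ.ne', one_mul, ← mul_assoc]
        rw [Fintype.card_prod (α := M1) (β := M2)]
        push_cast
        rw [inv_mul_cancel₀ hN.ne', one_mul]

/-- One-shot existence. -/
lemma oneshot (hp : IsPMF pU) (hQ : IsChannel QV) {PY : V → Y → ℝ} (hY : IsChannel PY) {P1 : V → Z1 → ℝ} (hP1 : IsChannel P1)
    {P2 : V → Z2 → ℝ} (hP2 : IsChannel P2) (eA : A ≃ A2 × A0) (eB : B ≃ M1 × B2 × B0) (e : M2 ≃ A2 × B2) {τ1 τ2 s t : ℝ}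
    (h1 : 0 < τ1) (h2 : 0 < τ2) (hs : 0 ≤ s)
    (ht : Pi1 pU QV PY τ1 + Pi2 pU QV PY τ2 + ((Fintype.card B : ℝ) - 1) * τ1⁻¹ +
        ((Fintype.card A : ℝ) - 1) * (Fintype.card B) * τ2⁻¹ +
        s * Lam1 pU QV P1 (Fintype.card (B2 × B0)) + s * Lam2 pU QV P2 (Fintype.card (A0 × B0)) (Fintype.card A0) ≤ t) :
    ∃ (v : A → B → V) (dec : Y → M1 × M2),
      err3 eA eB e PY v dec ≤ t ∧ s * (Real.log 2 * leak31 eA eB e P1 v) ≤ t ∧ s * (Real.log 2 * leak3 eA eB e P2 v) ≤ t := by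
  have _i1 : Nonempty M2 := e.nonempty
  have _i2 : Nonempty A := eA.nonempty
  have _i3 : Nonempty B := eB.nonempty
  have hl2 : 0 < Real.log 2 := by positivity
  obtain ⟨c, hc⟩ := avg_exists (fun c : A → U × (B → V) => wC pU QV c)
    (fun c => err3 eA eB e PY (fun a => (c a).2) (dec3 eA eB e (decI pU QV PY τ1 τ2 c)) +
      s * (Real.log 2 * leak31 eA eB e P1 (fun a => (c a).2)) + s * (Real.log 2 * leak3 eA eB e P2 (fun a => (c a).2))) (wC_pmf hp hQ) t (by
      simp only [mul_add, Finset.sum_add_distrib]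
      simp only [mul_left_comm _ s, ← Finset.mul_sum]
      have i1 := E_err3 hp hQ hY eA eB e h1 h2
      have i2 := mul_le_mul_of_nonneg_left (E_leak31 hp hQ hP1 eA eB e) hs
      have i3 := mul_le_mul_of_nonneg_left (E_leak3 hp hQ hP2 eA eB e) hs
      linarith)
  refine ⟨fun a => (c a).2, dec3 eA eB e (decI pU QV PY τ1 τ2 c), ?_⟩
  have n1 : 0 ≤ err3 eA eB e PY (fun a => (c a).2) (dec3 eA eB e (decI pU QV PY τ1 τ2 c)) := by
    unfold err3
    refine Finset.sum_nonneg fun m _ => Finset.sum_nonneg fun y _ => ?_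
    split_ifs
    · exact mul_nonneg (by positivity) ((Tc_chan eA eB e hY _ m).1 y)
    · exact le_rfl
  have n2 : 0 ≤ s * (Real.log 2 * leak31 eA eB e P1 (fun a => (c a).2)) := by
    rw [leak31_eq]
    exact mul_nonneg hs (mul_nonneg hl2.le (mi_nonneg _ (T1c_chan eB hP1 _)))
  have n3 : 0 ≤ s * (Real.log 2 * leak3 eA eB e P2 (fun a => (c a).2)) := by
    rw [leak3_eq]
    exact mul_nonneg hs (mul_nonneg hl2.le (mi_nonneg _ (Tc_chan eA eB e hP2 _)))
  refine ⟨?_, ?_, ?_⟩ <;> linarith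
end oneshot3

section moments
variable {n : ℕ} {S : Type*} [Fintype S]

lemma prodF_sum (w : S → ℝ) (hw : IsPMF w) : ∑ ss : Fin n → S, ∏ j, w (ss j) = 1 := by
  rw [← Fintype.prod_sum]; simp [hw.2]
lemma prodF1 (w : S → ℝ) (hw : IsPMF w) (i : Fin n) (g : S → ℝ) :
    ∑ ss : Fin n → S, (∏ j, w (ss j)) * g (ss i) = ∑ s, w s * g s := by
  convert prod_law1 (fun _ : Fin n => w) (fun _ => hw.2) i g
lemma prodF2 (w : S → ℝ) (hw : IsPMF w) {i i' : Fin n} (h : i ≠ i') (g : S → S → ℝ) :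
    ∑ ss : Fin n → S, (∏ j, w (ss j)) * g (ss i) (ss i') = ∑ s, w s * ∑ s', w s' * g s s' := by
  convert prod_law2 (fun _ : Fin n => w) (fun _ => hw.2) h g

def mean (w g : S → ℝ) : ℝ := ∑ s, w s * g s
def vari (w g : S → ℝ) : ℝ := ∑ s, w s * (g s - mean w g) ^ 2

lemma vari_nonneg {w : S → ℝ} (hw : IsPMF w) (g : S → ℝ) : 0 ≤ vari w g :=
  Finset.sum_nonneg fun s _ => mul_nonneg (hw.1 s) (sq_nonneg _)

lemma mom2 (w : S → ℝ) (hw : IsPMF w) (g : S → ℝ) :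
    ∑ ss : Fin n → S, (∏ j, w (ss j)) * (∑ i, g (ss i) - n * mean w g) ^ 2 = n * vari w g := by
  have e : ∀ ss : Fin n → S, (∑ i, g (ss i) - n * mean w g) ^ 2 =
      ∑ i, ∑ i', (g (ss i) - mean w g) * (g (ss i') - mean w g) := by
    intro ss
    rw [← Finset.sum_mul_sum, Finset.sum_sub_distrib]
    simp only [Finset.sum_const, Finset.card_univ, Fintype.card_fin, nsmul_eq_mul]
    ring
  simp only [e, Finset.mul_sum]
  rw [Finset.sum_comm]
  have e2 : ∀ i : Fin n, ∑ ss : Fin n → S, ∑ i', (∏ j, w (ss j)) * ((g (ss i) - mean w g) * (g (ss i') - mean w g)) = vari w g := by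
    intro i
    rw [Finset.sum_comm, Finset.sum_eq_single i]
    · rw [prodF1 w hw i (fun s => (g s - mean w g) * (g s - mean w g))]
      unfold vari
      refine Finset.sum_congr rfl fun s _ => by ring
    · intro i' _ hi
      rw [prodF2 w hw (Ne.symm hi) (fun s s' => (g s - mean w g) * (g s' - mean w g))]
      refine Finset.sum_eq_zero fun s _ => ?_
      have : ∑ s', w s' * ((g s - mean w g) * (g s' - mean w g)) = 0 := by
        have : ∀ s', w s' * ((g s - mean w g) * (g s' - mean w g)) = (g s - mean w g) * (w s' * g s' - w s' * mean w g) := by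
          intro s'; ring
        simp only [this, ← Finset.mul_sum, Finset.sum_sub_distrib, ← Finset.sum_mul, hw.2]
        unfold mean; ring
      rw [this, mul_zero]
    · simp
  rw [Finset.sum_congr rfl fun i _ => e2 i]
  simp

lemma cheb (w : S → ℝ) (hw : IsPMF w) (g : S → ℝ) (hn : 0 < n) {δ : ℝ} (hδ : 0 < δ) (F : (Fin n → S) → ℝ)
    (h0 : ∀ ss, F ss ≤ 1) (hF : ∀ ss, (∀ i, w (ss i) ≠ 0) → (n * (mean w g - δ) ≤ ∑ i, g (ss i)) → F ss ≤ 0) :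
    ∑ ss : Fin n → S, (∏ j, w (ss j)) * F ss ≤ vari w g / (n * δ ^ 2) := by
  have hn' : (0 : ℝ) < n := by exact_mod_cast hn
  have : vari w g / (n * δ ^ 2) = ((n * δ) ^ 2)⁻¹ * (n * vari w g) := by field_simp
  rw [this, ← mom2 w hw g, Finset.mul_sum]
  refine Finset.sum_le_sum fun ss _ => ?_
  by_cases hz : ∏ j, w (ss j) = 0
  · simp [hz]
  have hz' : ∀ i, w (ss i) ≠ 0 := fun i h => hz (Finset.prod_eq_zero (Finset.mem_univ i) h)
  rw [mul_left_comm]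
  refine mul_le_mul_of_nonneg_left ?_ (Finset.prod_nonneg fun i _ => hw.1 _)
  by_cases hc : n * (mean w g - δ) ≤ ∑ i, g (ss i)
  · exact (hF ss hz' hc).trans (by positivity)
  · refine (h0 ss).trans ?_
    rw [inv_mul_eq_div, one_le_div (by positivity)]
    push Not at hc
    have : n * δ ≤ n * mean w g - ∑ i, g (ss i) := by nlinarith
    have h2 : 0 ≤ n * δ := by positivity
    nlinarith

lemma absdev (w : S → ℝ) (hw : IsPMF w) (g : S → ℝ) (hn : 0 < n) {δ : ℝ} (hδ : 0 < δ) :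
    ∑ ss : Fin n → S, (∏ j, w (ss j)) * |∑ i, g (ss i) - n * mean w g| ≤ vari w g / δ + n * δ := by
  have hn' : (0 : ℝ) < n := by exact_mod_cast hn
  have : vari w g / δ + n * δ = (n * δ)⁻¹ * (n * vari w g) + n * δ * 1 := by field_simp
  rw [this, ← mom2 w hw g, ← prodF_sum (n := n) w hw, Finset.mul_sum, Finset.mul_sum, ← Finset.sum_add_distrib]
  refine Finset.sum_le_sum fun ss _ => ?_
  have hp : 0 ≤ ∏ j, w (ss j) := Finset.prod_nonneg fun i _ => hw.1 _
  generalize hx : ∑ i, g (ss i) - n * mean w g = x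
  have hk : 0 < n * δ := by positivity
  generalize n * δ = k at hk
  have : |x| ≤ k⁻¹ * x ^ 2 + k := by
    rw [inv_mul_eq_div, ← sub_le_iff_le_add, le_div_iff₀ hk, ← sq_abs]
    nlinarith [sq_nonneg (|x| - k), abs_nonneg x, sq_nonneg |x|]
  calc _ ≤ (∏ j, w (ss j)) * (k⁻¹ * x ^ 2 + k) := mul_le_mul_of_nonneg_left this hp
    _ = _ := by ring

lemma lam_gen (w : S → ℝ) (hw : IsPMF w) (g g' : S → ℝ) (hn : 0 < n) {δ : ℝ} (hδ : 0 < δ) (L L' : ℝ) (F : (Fin n → S) → ℝ)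
    (hF : ∀ ss, (∀ i, w (ss i) ≠ 0) → F ss ≤ Real.log (1 + Real.exp (∑ i, g (ss i) - L) + Real.exp (∑ i, g' (ss i) - L'))) :
    ∑ ss : Fin n → S, (∏ j, w (ss j)) * F ss ≤ Real.log 3 + (max (n * mean w g - L) 0 + (vari w g / δ + n * δ)) +
      (max (n * mean w g' - L') 0 + (vari w g' / δ + n * δ)) := by
  have hmax : ∀ a b : ℝ, Real.log (1 + Real.exp a + Real.exp b) ≤ Real.log 3 + max a 0 + max b 0 := by
    intro a b
    rw [Real.log_le_iff_le_exp (by positivity), Real.exp_add, Real.exp_add, Real.exp_log (by norm_num)]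
    have a1 : Real.exp a ≤ Real.exp (max a 0) := Real.exp_le_exp.2 (le_max_left _ _)
    have b1 : Real.exp b ≤ Real.exp (max b 0) := Real.exp_le_exp.2 (le_max_left _ _)
    have a2 : 1 ≤ Real.exp (max a 0) := Real.one_le_exp (le_max_right _ _)
    have b2 : 1 ≤ Real.exp (max b 0) := Real.one_le_exp (le_max_right _ _)
    nlinarith [mul_nonneg (sub_nonneg.2 a2) (sub_nonneg.2 b2)]
  have hm2 : ∀ x m L : ℝ, max (x - L) 0 ≤ max (m - L) 0 + |x - m| := by
    intro x m L
    refine max_le ?_ (by positivity)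
    have := le_abs_self (x - m)
    have := le_max_left (m - L) 0
    linarith
  calc _ ≤ ∑ ss : Fin n → S, (∏ j, w (ss j)) * ((Real.log 3 + max (n * mean w g - L) 0 + max (n * mean w g' - L') 0) +
        (|∑ i, g (ss i) - n * mean w g| + |∑ i, g' (ss i) - n * mean w g'|)) := by
        refine Finset.sum_le_sum fun ss _ => ?_
        by_cases hz : ∏ j, w (ss j) = 0
        · simp [hz]
        have hz' : ∀ i, w (ss i) ≠ 0 := fun i h => hz (Finset.prod_eq_zero (Finset.mem_univ i) h)
        refine mul_le_mul_of_nonneg_left ?_ (Finset.prod_nonneg fun i _ => hw.1 _)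
        refine (hF ss hz').trans ((hmax _ _).trans ?_)
        have := hm2 (∑ i, g (ss i)) (n * mean w g) L
        have := hm2 (∑ i, g' (ss i)) (n * mean w g') L'
        linarith
    _ ≤ _ := by
        simp only [mul_add _ _ (|_| + |_|), Finset.sum_add_distrib, ← Finset.sum_mul, prodF_sum w hw, one_mul]
        simp only [mul_add _ |_| |_|, Finset.sum_add_distrib]
        have := absdev w hw g hn hδ
        have := absdev w hw g' hn hδ
        linarith
end moments

section nletter
variable {n : ℕ} {U V Z : Type*} [Fintype U] [Fintype V] [Fintype Z]

def pmfN (n : ℕ) (p : U → ℝ) (us : Fin n → U) : ℝ := ∏ i, p (us i)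
def chN (n : ℕ) (Q : U → V → ℝ) (us : Fin n → U) (vs : Fin n → V) : ℝ := ∏ i, Q (us i) (vs i)

lemma pmfN_pmf {p : U → ℝ} (hp : IsPMF p) : IsPMF (pmfN n p) :=
  ⟨fun us => Finset.prod_nonneg fun i _ => hp.1 _, prodF_sum p hp⟩
lemma chN_chan {Q : U → V → ℝ} (hQ : IsChannel Q) : IsChannel (chN n Q) := fun us =>
  ⟨fun vs => Finset.prod_nonneg fun i _ => (hQ _).1 _, by
    unfold chN; rw [← Fintype.prod_sum (fun i v => Q (us i) v)]; simp [(hQ _).2]⟩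

lemma PUz_N (QV : U → V → ℝ) (P : V → Z → ℝ) (us : Fin n → U) (zs : Fin n → Z) :
    PUz (chN n QV) (chN n P) us zs = ∏ i, PUz QV P (us i) (zs i) := by
  unfold PUz chN
  rw [Fintype.prod_sum]
  refine Finset.sum_congr rfl fun vs _ => by rw [← Finset.prod_mul_distrib]
lemma PRz_N (pU : U → ℝ) (QV : U → V → ℝ) (P : V → Z → ℝ) (zs : Fin n → Z) :
    PRz (pmfN n pU) (chN n QV) (chN n P) zs = ∏ i, PRz pU QV P (zs i) := by
  unfold PRz
  simp only [PUz_N, pmfN]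
  rw [Fintype.prod_sum]
  refine Finset.sum_congr rfl fun vs _ => by rw [← Finset.prod_mul_distrib]

/-- single letter joint law -/
def om (pU : U → ℝ) (QV : U → V → ℝ) (P : V → Z → ℝ) (s : U × V × Z) : ℝ := pU s.1 * QV s.1 s.2.1 * P s.2.1 s.2.2

lemma om_sum (pU : U → ℝ) (QV : U → V → ℝ) (P : V → Z → ℝ) (F : U → V → Z → ℝ) :
    ∑ s : U × V × Z, om pU QV P s * F s.1 s.2.1 s.2.2 = ∑ u, ∑ v, pU u * QV u v * ∑ z, P v z * F u v z := by
  simp only [Fintype.sum_prod_type, om, Finset.mul_sum, mul_assoc]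

lemma om_pmf {pU : U → ℝ} {QV : U → V → ℝ} {P : V → Z → ℝ} (hp : IsPMF pU) (hQ : IsChannel QV) (hP : IsChannel P) :
    IsPMF (om pU QV P) := by
  refine ⟨fun s => mul_nonneg (mul_nonneg (hp.1 _) ((hQ _).1 _)) ((hP _).1 _), ?_⟩
  have := om_sum pU QV P (fun _ _ _ => 1)
  simpa [(hP _).2, ← Finset.mul_sum, (hQ _).2, hp.2] using this

def tripleE (n : ℕ) (U V Z : Type*) : (Fin n → U × V × Z) ≃ (Fin n → U) × (Fin n → V) × (Fin n → Z) where
  toFun s := (fun i => (s i).1, fun i => (s i).2.1, fun i => (s i).2.2)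
  invFun t := fun i => (t.1 i, t.2.1 i, t.2.2 i)
  left_inv _ := rfl
  right_inv _ := rfl

lemma reindexN (pU : U → ℝ) (QV : U → V → ℝ) (P : V → Z → ℝ) (F : (Fin n → U) → (Fin n → V) → (Fin n → Z) → ℝ) :
    ∑ us, ∑ vs, pmfN n pU us * chN n QV us vs * ∑ zs, chN n P vs zs * F us vs zs =
      ∑ ss : Fin n → U × V × Z, (∏ j, om pU QV P (ss j)) * F (fun i => (ss i).1) (fun i => (ss i).2.1) (fun i => (ss i).2.2) := by
  rw [← (tripleE n U V Z).symm.sum_comp, Fintype.sum_prod_type]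
  refine Finset.sum_congr rfl fun us _ => ?_
  rw [Fintype.sum_prod_type]
  refine Finset.sum_congr rfl fun vs _ => ?_
  rw [Finset.mul_sum]
  refine Finset.sum_congr rfl fun zs _ => ?_
  simp only [tripleE, Equiv.coe_fn_symm_mk, om, Finset.prod_mul_distrib, pmfN, chN]
  ring

variable {pU : U → ℝ} {QV : U → V → ℝ} {P : V → Z → ℝ}

def g1 (QV : U → V → ℝ) (P : V → Z → ℝ) (s : U × V × Z) : ℝ := Real.log (P s.2.1 s.2.2 / PUz QV P s.1 s.2.2)
def g2 (pU : U → ℝ) (QV : U → V → ℝ) (P : V → Z → ℝ) (s : U × V × Z) : ℝ := Real.log (P s.2.1 s.2.2 / PRz pU QV P s.2.2)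
def g0 (pU : U → ℝ) (QV : U → V → ℝ) (P : V → Z → ℝ) (s : U × V × Z) : ℝ := Real.log (PUz QV P s.1 s.2.2 / PRz pU QV P s.2.2)

lemma om_supp (hp : IsPMF pU) (hQ : IsChannel QV) (hP : IsChannel P) {s : U × V × Z} (h : om pU QV P s ≠ 0) :
    0 < P s.2.1 s.2.2 ∧ 0 < PUz QV P s.1 s.2.2 ∧ 0 < PRz pU QV P s.2.2 := by
  unfold om at h
  have hP0 := right_ne_zero_of_mul h
  have hq := right_ne_zero_of_mul (left_ne_zero_of_mul h)
  have hu := left_ne_zero_of_mul (left_ne_zero_of_mul h)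
  have hU : PUz QV P s.1 s.2.2 ≠ 0 := fun h => hP0 (PU_zero hQ hP hq h)
  have hR : PRz pU QV P s.2.2 ≠ 0 := fun h => hU (PR_zero hp hQ hP hu h)
  exact ⟨lt_of_le_of_ne ((hP _).1 _) hP0.symm, lt_of_le_of_ne ((PUz_chan hQ hP _).1 _) hU.symm,
    lt_of_le_of_ne ((PRz_pmf hp hQ hP).1 _) hR.symm⟩

lemma exp_sum_log {f g : Fin n → ℝ} (hf : ∀ i, 0 < f i) (hg : ∀ i, 0 < g i) :
    Real.exp (∑ i, Real.log (f i / g i)) = (∏ i, f i) / ∏ i, g i := by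
  rw [Real.exp_sum, ← Finset.prod_div_distrib]
  exact Finset.prod_congr rfl fun i _ => Real.exp_log (div_pos (hf i) (hg i))

def I1 (pU : U → ℝ) (QV : U → V → ℝ) (P : V → Z → ℝ) : ℝ := mean (om pU QV P) (g1 QV P)
def I2 (pU : U → ℝ) (QV : U → V → ℝ) (P : V → Z → ℝ) : ℝ := mean (om pU QV P) (g2 pU QV P)
def I0 (pU : U → ℝ) (QV : U → V → ℝ) (P : V → Z → ℝ) : ℝ := mean (om pU QV P) (g0 pU QV P)

lemma Pi1_N (hp : IsPMF pU) (hQ : IsChannel QV) (hP : IsChannel P) (hn : 0 < n) {δ : ℝ} (hδ : 0 < δ) :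
    Pi1 (pmfN n pU) (chN n QV) (chN n P) (Real.exp (n * (I1 pU QV P - δ))) ≤ vari (om pU QV P) (g1 QV P) / (n * δ ^ 2) := by
  unfold Pi1
  rw [reindexN pU QV P (fun us vs zs => if chN n P vs zs < Real.exp (n * (I1 pU QV P - δ)) * PUz (chN n QV) (chN n P) us zs then 1 else 0)]
  refine cheb _ (om_pmf hp hQ hP) _ hn hδ _ (fun ss => by split_ifs <;> norm_num) fun ss hs hc => ?_
  rw [if_neg]
  rw [not_lt, PUz_N]
  have h := fun i => om_supp hp hQ hP (hs i)
  have := Real.exp_le_exp.2 hc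
  simp only [g1] at this
  rw [exp_sum_log (fun i => (h i).1) (fun i => (h i).2.1), le_div_iff₀ (Finset.prod_pos fun i _ => (h i).2.1)] at this
  exact this

lemma Pi2_N (hp : IsPMF pU) (hQ : IsChannel QV) (hP : IsChannel P) (hn : 0 < n) {δ : ℝ} (hδ : 0 < δ) :
    Pi2 (pmfN n pU) (chN n QV) (chN n P) (Real.exp (n * (I2 pU QV P - δ))) ≤ vari (om pU QV P) (g2 pU QV P) / (n * δ ^ 2) := by
  unfold Pi2
  rw [reindexN pU QV P (fun us vs zs => if chN n P vs zs < Real.exp (n * (I2 pU QV P - δ)) * PRz (pmfN n pU) (chN n QV) (chN n P) zs then 1 else 0)]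
  refine cheb _ (om_pmf hp hQ hP) _ hn hδ _ (fun ss => by split_ifs <;> norm_num) fun ss hs hc => ?_
  rw [if_neg]
  rw [not_lt, PRz_N]
  have h := fun i => om_supp hp hQ hP (hs i)
  have := Real.exp_le_exp.2 hc
  simp only [g2] at this
  rw [exp_sum_log (fun i => (h i).1) (fun i => (h i).2.2), le_div_iff₀ (Finset.prod_pos fun i _ => (h i).2.2)] at this
  exact this

lemma Lam1_N (hp : IsPMF pU) (hQ : IsChannel QV) (hP : IsChannel P) (hn : 0 < n) {δ : ℝ} (hδ : 0 < δ) {N : ℝ} (hN : 0 < N) :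
    Lam1 (pmfN n pU) (chN n QV) (chN n P) N ≤ Real.log 3 +
      2 * (max (n * I1 pU QV P - Real.log N) 0 + (vari (om pU QV P) (g1 QV P) / δ + n * δ)) := by
  unfold Lam1
  rw [reindexN pU QV P (fun us vs zs => Real.log (x1 (chN n QV) (chN n P) N us vs zs))]
  refine (lam_gen (om pU QV P) (om_pmf hp hQ hP) (g1 QV P) (g1 QV P) hn hδ (Real.log N) (Real.log N) _ fun ss hs => ?_).trans
    (le_of_eq (by unfold I1; ring))
  have h := fun i => om_supp hp hQ hP (hs i)
  have e1 : Real.exp (∑ i, g1 QV P (ss i) - Real.log N) = (∏ i, P (ss i).2.1 (ss i).2.2) / (N * ∏ i, PUz QV P (ss i).1 (ss i).2.2) := by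
    rw [Real.exp_sub, Real.exp_log hN]
    simp only [g1]
    rw [exp_sum_log (fun i => (h i).1) (fun i => (h i).2.1), div_div, mul_comm N]
  have e2 : x1 (chN n QV) (chN n P) N (fun i => (ss i).1) (fun i => (ss i).2.1) (fun i => (ss i).2.2) =
      1 + Real.exp (∑ i, g1 QV P (ss i) - Real.log N) := by
    unfold x1; rw [e1, PUz_N]; rfl
  simp only [e2]
  refine Real.log_le_log (by positivity) (by linarith [Real.exp_pos (∑ i, g1 QV P (ss i) - Real.log N)])

lemma Lam2_N (hp : IsPMF pU) (hQ : IsChannel QV) (hP : IsChannel P) (hn : 0 < n) {δ : ℝ} (hδ : 0 < δ) {N M : ℝ} (hN : 0 < N) (hM : 0 < M) :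
    Lam2 (pmfN n pU) (chN n QV) (chN n P) N M ≤ Real.log 3 +
      (max (n * I2 pU QV P - Real.log N) 0 + (vari (om pU QV P) (g2 pU QV P) / δ + n * δ)) +
      (max (n * I0 pU QV P - Real.log M) 0 + (vari (om pU QV P) (g0 pU QV P) / δ + n * δ)) := by
  unfold Lam2
  rw [reindexN pU QV P (fun us vs zs => Real.log (x2 (pmfN n pU) (chN n QV) (chN n P) N M us vs zs))]
  refine lam_gen (om pU QV P) (om_pmf hp hQ hP) (g2 pU QV P) (g0 pU QV P) hn hδ (Real.log N) (Real.log M) _ fun ss hs => le_of_eq ?_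
  have h := fun i => om_supp hp hQ hP (hs i)
  have e1 : Real.exp (∑ i, g2 pU QV P (ss i) - Real.log N) = (∏ i, P (ss i).2.1 (ss i).2.2) / (N * ∏ i, PRz pU QV P (ss i).2.2) := by
    rw [Real.exp_sub, Real.exp_log hN]
    simp only [g2]
    rw [exp_sum_log (fun i => (h i).1) (fun i => (h i).2.2), div_div, mul_comm N]
  have e2 : Real.exp (∑ i, g0 pU QV P (ss i) - Real.log M) = (∏ i, PUz QV P (ss i).1 (ss i).2.2) / (M * ∏ i, PRz pU QV P (ss i).2.2) := by
    rw [Real.exp_sub, Real.exp_log hM]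
    simp only [g0]
    rw [exp_sum_log (fun i => (h i).2.1) (fun i => (h i).2.2), div_div, mul_comm M]
  unfold x2; rw [e1, e2, PUz_N, PRz_N]; rfl
end nletter

section infoq
variable {U V Y Z : Type*} [Fintype U] [Fintype V] [Fintype Y] [Fintype Z]
variable {pU : U → ℝ} {QV : U → V → ℝ} {P : V → Z → ℝ}

lemma I1_eq : I1 pU QV P = ∑ u, ∑ v, pU u * QV u v * ∑ z, P v z * Real.log (P v z / PUz QV P u z) :=
  om_sum pU QV P (fun u v z => Real.log (P v z / PUz QV P u z))
lemma I2_eq : I2 pU QV P = ∑ u, ∑ v, pU u * QV u v * ∑ z, P v z * Real.log (P v z / PRz pU QV P z) :=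
  om_sum pU QV P (fun u v z => Real.log (P v z / PRz pU QV P z))
lemma I0_eq : I0 pU QV P = ∑ u, pU u * ∑ z, PUz QV P u z * Real.log (PUz QV P u z / PRz pU QV P z) := by
  refine (om_sum pU QV P (fun u v z => Real.log (PUz QV P u z / PRz pU QV P z))).trans ?_
  refine Finset.sum_congr rfl fun u _ => ?_
  simp only [mul_assoc]
  rw [← Finset.mul_sum]
  congr 1
  simp only [Finset.mul_sum]
  rw [Finset.sum_comm]
  refine Finset.sum_congr rfl fun z _ => ?_
  conv_rhs => arg 1; unfold PUz
  rw [Finset.sum_mul]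
  refine Finset.sum_congr rfl fun v _ => by ring

lemma I_add (hp : IsPMF pU) (hQ : IsChannel QV) (hP : IsChannel P) : I2 pU QV P = I1 pU QV P + I0 pU QV P := by
  unfold I2 I1 I0 mean
  rw [← Finset.sum_add_distrib]
  refine Finset.sum_congr rfl fun s _ => ?_
  by_cases h : om pU QV P s = 0
  · simp [h]
  obtain ⟨h1, h2, h3⟩ := om_supp hp hQ hP h
  unfold g1 g2 g0
  rw [Real.log_div h1.ne' h3.ne', Real.log_div h1.ne' h2.ne', Real.log_div h2.ne' h3.ne']; ring

lemma I1_nonneg (hp : IsPMF pU) (hQ : IsChannel QV) (hP : IsChannel P) : 0 ≤ I1 pU QV P := by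
  rw [I1_eq]
  refine Finset.sum_nonneg fun u _ => Finset.sum_nonneg fun v _ => ?_
  by_cases h : QV u v = 0
  · simp [h]
  refine mul_nonneg (mul_nonneg (hp.1 u) ((hQ u).1 v)) ?_
  have := logsum (P v) (PUz QV P u) (hP v).1 (PUz_chan hQ hP u).1 (fun z hz => PU_zero hQ hP h hz)
  rw [(hP v).2, (PUz_chan hQ hP u).2] at this
  simpa using this

lemma I0_nonneg (hp : IsPMF pU) (hQ : IsChannel QV) (hP : IsChannel P) : 0 ≤ I0 pU QV P := by
  rw [I0_eq]
  refine Finset.sum_nonneg fun u _ => ?_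
  by_cases h : pU u = 0
  · simp [h]
  refine mul_nonneg (hp.1 u) ?_
  have := logsum (PUz QV P u) (PRz pU QV P) (PUz_chan hQ hP u).1 (PRz_pmf hp hQ hP).1 (fun z hz => PR_zero hp hQ hP h hz)
  rw [(PUz_chan hQ hP u).2, (PRz_pmf hp hQ hP).2] at this
  simpa using this

lemma PUz_deg {PY : V → Y → ℝ} {q : Y → Z → ℝ} (h : ∀ v z, P v z = ∑ y, PY v y * q y z) (u : U) (z : Z) :
    PUz QV P u z = ∑ y, PUz QV PY u y * q y z := by
  unfold PUz
  simp only [h, Finset.mul_sum, Finset.sum_mul]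
  rw [Finset.sum_comm]
  refine Finset.sum_congr rfl fun y _ => Finset.sum_congr rfl fun v _ => by ring

/-- unnormalised form of the mutual information -/
lemma dp_form {T : Type*} [Fintype T] (p : T → ℝ) (hp : ∀ t, 0 ≤ p t) (P : T → Z → ℝ) (hP : IsChannel P) :
    ∑ t, ∑ z, (p t * P t z) * Real.log ((p t * P t z) / ∑ t', p t' * P t' z) =
      (∑ t, p t * ∑ z, P t z * Real.log (P t z / ∑ t', p t' * P t' z)) + ∑ t, p t * Real.log (p t) := by
  rw [← Finset.sum_add_distrib]
  refine Finset.sum_congr rfl fun t _ => ?_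
  have : p t * Real.log (p t) = p t * ∑ z, P t z * Real.log (p t) := by rw [← Finset.sum_mul, (hP t).2, one_mul]
  rw [this, ← mul_add, ← Finset.sum_add_distrib, Finset.mul_sum]
  refine Finset.sum_congr rfl fun z _ => ?_
  by_cases h1 : p t = 0
  · simp [h1]
  by_cases h2 : P t z = 0
  · simp [h2]
  have h3 : ∑ t', p t' * P t' z ≠ 0 := fun h => mul_ne_zero h1 h2
    (sum_eq_zero_imp (fun t' => mul_nonneg (hp t') ((hP t').1 z)) h t)
  rw [Real.log_div (mul_ne_zero h1 h2) h3, Real.log_mul h1 h2, Real.log_div h2 h3]; ring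

lemma dp_form_le {T : Type*} [Fintype T] (p : T → ℝ) (hp : ∀ t, 0 ≤ p t) {PY : T → Y → ℝ} (hY : IsChannel PY)
    {P : T → Z → ℝ} (hP : IsChannel P) {q : Y → Z → ℝ} (hq : IsChannel q) (h : ∀ v z, P v z = ∑ y, PY v y * q y z) :
    ∑ t, p t * ∑ z, P t z * Real.log (P t z / ∑ t', p t' * P t' z) ≤
    ∑ t, p t * ∑ z, PY t z * Real.log (PY t z / ∑ t', p t' * PY t' z) := by
  have := dataproc (fun t y => p t * PY t y) (fun t y => mul_nonneg (hp t) ((hY t).1 y)) q hq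
  have e : ∀ t z, ∑ y, p t * PY t y * q y z = p t * P t z := by
    intro t z; rw [h, Finset.mul_sum]; exact Finset.sum_congr rfl fun y _ => by ring
  simp only [e] at this
  rw [dp_form p hp P hP, dp_form p hp PY hY] at this
  linarith

lemma I0_dp (hp : IsPMF pU) (hQ : IsChannel QV) (hP : IsChannel P) {PY : V → Y → ℝ} (hY : IsChannel PY)
    {q : Y → Z → ℝ} (hq : IsChannel q) (h : ∀ v z, P v z = ∑ y, PY v y * q y z) : I0 pU QV P ≤ I0 pU QV PY := by
  rw [I0_eq, I0_eq]
  exact dp_form_le pU hp.1 (PUz_chan hQ hY) (PUz_chan hQ hP) hq (PUz_deg h)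

lemma I1_dp (hp : IsPMF pU) (hQ : IsChannel QV) (hP : IsChannel P) {PY : V → Y → ℝ} (hY : IsChannel PY)
    {q : Y → Z → ℝ} (hq : IsChannel q) (h : ∀ v z, P v z = ∑ y, PY v y * q y z) : I1 pU QV P ≤ I1 pU QV PY := by
  rw [I1_eq, I1_eq]
  refine Finset.sum_le_sum fun u _ => ?_
  simp only [mul_assoc]
  rw [← Finset.mul_sum, ← Finset.mul_sum]
  exact mul_le_mul_of_nonneg_left (dp_form_le (QV u) (hQ u).1 hY hP hq h) (hp.1 u)

lemma cmi_I1 (hp : IsPMF pU) (hQ : IsChannel QV) (hP : IsChannel P) :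
    Real.log 2 * condMutInfo (fun t : V × Z × U => pU t.2.2 * QV t.2.2 t.1 * P t.1 t.2.1) = I1 pU QV P := by
  have hl : Real.log 2 ≠ 0 := by positivity
  unfold condMutInfo
  have e1 : ∀ u, ∑ v, pU u * QV u v = pU u := by
    intro u; simp only [← Finset.mul_sum, mul_one, (hQ u).2]
  have e2 : ∀ u v, ∑ z, pU u * QV u v * P v z = pU u * QV u v := by
    intro u v; simp only [← Finset.mul_sum, (hP _).2, mul_one]
  have e3 : ∀ u z, ∑ v, pU u * QV u v * P v z = pU u * PUz QV P u z := by
    intro u z; simp only [mul_assoc, ← Finset.mul_sum]; rfl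
  simp only [e2, e3, e1]
  simp only [Fintype.sum_prod_type]
  rw [I1_eq, Finset.mul_sum]
  rw [Finset.sum_comm (γ := U)]
  refine Finset.sum_congr rfl fun v _ => ?_
  rw [Finset.sum_comm, Finset.mul_sum]
  refine Finset.sum_congr rfl fun u _ => ?_
  rw [Finset.mul_sum, Finset.mul_sum]
  refine Finset.sum_congr rfl fun z _ => ?_
  by_cases h : pU u * QV u v * P v z = 0
  · rw [h, zero_mul, mul_zero, ← mul_assoc, h, zero_mul]
  have h1 := left_ne_zero_of_mul (left_ne_zero_of_mul h)
  have h2 := right_ne_zero_of_mul (left_ne_zero_of_mul h)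
  have : pU u * (pU u * QV u v * P v z) / (pU u * QV u v * (pU u * PUz QV P u z)) = P v z / PUz QV P u z := by
    have h3 : PUz QV P u z ≠ 0 := fun hz => right_ne_zero_of_mul h (PU_zero hQ hP h2 hz)
    field_simp
  rw [this, Real.logb]
  field_simp

lemma mi_I2 (hp : IsPMF pU) (hQ : IsChannel QV) (hP : IsChannel P) :
    Real.log 2 * mutInfo (fun q : V × Z => ∑ u, pU u * QV u q.1 * P q.1 q.2) = I2 pU QV P := by
  have hl : Real.log 2 ≠ 0 := by positivity
  unfold mutInfo
  simp only [← Finset.sum_mul]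
  have e2 : ∀ v, ∑ z, (∑ u, pU u * QV u v) * P v z = ∑ u, pU u * QV u v := by
    intro v; simp only [← Finset.mul_sum, (hP _).2, mul_one]
  have e3 : ∀ z, ∑ v, (∑ u, pU u * QV u v) * P v z = PRz pU QV P z := by
    intro z; unfold PRz PUz
    simp only [Finset.sum_mul, Finset.mul_sum]
    rw [Finset.sum_comm]
    refine Finset.sum_congr rfl fun u _ => Finset.sum_congr rfl fun v _ => by ring
  simp only [e2, e3]
  rw [Fintype.sum_prod_type, I2_eq, Finset.sum_comm (γ := U), Finset.mul_sum]
  refine Finset.sum_congr rfl fun v _ => ?_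
  rw [← Finset.sum_mul, Finset.mul_sum, Finset.mul_sum]
  refine Finset.sum_congr rfl fun z _ => ?_
  by_cases h : ∑ u, pU u * QV u v = 0
  · simp [h]
  dsimp only
  rw [mul_div_mul_left _ _ h, Real.logb]
  field_simp
end infoq

section factor
variable {U V X : Type*} [Fintype U] [Fintype V] [Fintype X]
open Classical

lemma norm_chan {A B : Type*} [Fintype B] [Nonempty B] (f : A → B → ℝ) (hf : ∀ a b, 0 ≤ f a b) :
    ∃ Q : A → B → ℝ, IsChannel Q ∧ ∀ a b, f a b = (∑ b', f a b') * Q a b := by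
  refine ⟨fun a b => if ∑ b', f a b' = 0 then (if b = Classical.arbitrary B then 1 else 0) else f a b / ∑ b', f a b', fun a => ?_, fun a b => ?_⟩
  · have hs := Finset.sum_nonneg fun b (_ : b ∈ Finset.univ) => hf a b
    by_cases h : ∑ b', f a b' = 0
    · simp only [h, if_true]
      refine ⟨fun b => by dsimp only; split_ifs <;> norm_num, ?_⟩
      rw [Finset.sum_eq_single (Classical.arbitrary B)]
      · rw [if_pos rfl]
      · intro b _ hb; exact if_neg hb
      · simp
    · simp only [h, if_false]
      refine ⟨fun b => div_nonneg (hf a b) hs, ?_⟩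
      rw [← Finset.sum_div, div_self h]
  · by_cases h : ∑ b', f a b' = 0
    · rw [h, zero_mul]; exact sum_eq_zero_imp (hf a) h b
    · simp only [h, if_false]; field_simp

lemma factor (p : U × V × X → ℝ) (hp : IsPMF p)
    (hM : ∀ u v x, p (u, v, x) * (∑ u', ∑ x', p (u', v, x')) = (∑ x', p (u, v, x')) * (∑ u', p (u', v, x))) :
    ∃ (pU : U → ℝ) (QV : U → V → ℝ) (QX : V → X → ℝ), IsPMF pU ∧ IsChannel QV ∧ IsChannel QX ∧
      ∀ u v x, p (u, v, x) = pU u * QV u v * QX v x := by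
  have hne : Nonempty (U × V × X) := by
    by_contra h
    rw [not_nonempty_iff] at h
    have := hp.2
    simp at this
  obtain ⟨u0, v0, x0⟩ := hne.some
  have : Nonempty V := ⟨v0⟩
  have : Nonempty X := ⟨x0⟩
  obtain ⟨QV, hQV, eV⟩ := norm_chan (fun u v => ∑ x, p (u, v, x)) (fun u v => Finset.sum_nonneg fun x _ => hp.1 _)
  obtain ⟨QX, hQX, eX⟩ := norm_chan (fun v x => ∑ u, p (u, v, x)) (fun v x => Finset.sum_nonneg fun u _ => hp.1 _)
  refine ⟨fun u => ∑ v, ∑ x, p (u, v, x), QV, QX, ⟨fun u => Finset.sum_nonneg fun v _ => Finset.sum_nonneg fun x _ => hp.1 _, ?_⟩, hQV, hQX, ?_⟩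
  · have := hp.2; simpa [Fintype.sum_prod_type] using this
  · intro u v x
    rw [← eV u v]
    have hs : ∀ u', 0 ≤ ∑ x', p (u', v, x') := fun u' => Finset.sum_nonneg fun x _ => hp.1 _
    by_cases h : ∑ u', ∑ x', p (u', v, x') = 0
    · have h1 := sum_eq_zero_imp hs h u
      rw [h1, zero_mul]
      exact sum_eq_zero_imp (fun x => hp.1 (u, v, x)) h1 x
    · have h1 := hM u v x
      have h2 : ∑ u, p (u, v, x) = (∑ x', ∑ u, p (u, v, x')) * QX v x := eX v x
      rw [Finset.sum_comm (s := Finset.univ) (t := Finset.univ) (f := fun x' u => p (u, v, x'))] at h2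
      rw [h2] at h1
      have : p (u, v, x) * (∑ u', ∑ x', p (u', v, x')) = ((∑ x', p (u, v, x')) * QX v x) * (∑ u', ∑ x', p (u', v, x')) := by
        rw [h1]; ring
      exact mul_right_cancel₀ h this
end factor

section encoder
variable {n K1 : ℕ} {V X O A2 A0 B2 B0 A B : Type*} [Fintype V] [Fintype X] [Fintype O]
  [Fintype A2] [Fintype A0] [Fintype B2] [Fintype B0] [Fintype A] [Fintype B]

lemma enc_out {M1 M2 : Type*} [Fintype M1] [Fintype M2] (eA : A ≃ A2 × A0) (eB : B ≃ M1 × B2 × B0) (e : M2 ≃ A2 × B2)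
    (QX : V → X → ℝ) (WO : X → O → ℝ) (v : A → B → (Fin n → V)) (m : M1 × M2) (zs : Fin n → O) (k : ℝ) :
    ∑ xs, k * Tc eA eB e (chN n QX) v m xs * ∏ i, WO (xs i) (zs i) = k * Tc eA eB e (chN n (PUz QX WO)) v m zs := by
  have : ∀ vs : Fin n → V, chN n (PUz QX WO) vs zs = ∑ xs, chN n QX vs xs * ∏ i, WO (xs i) (zs i) := by
    intro vs
    exact (PUz_N QX WO vs zs).symm
  unfold Tc
  simp only [this, mul_assoc]
  rw [← Finset.mul_sum]
  congr 1
  rw [← Finset.mul_sum]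
  congr 1
  simp only [Finset.sum_mul]
  rw [Finset.sum_comm]
end encoder

section block
variable {𝒳 𝒴 𝒵₁ 𝒵₂ : Type} [Fintype 𝒳] [Fintype 𝒴] [Fintype 𝒵₁] [Fintype 𝒵₂]
variable {U V : Type*} [Fintype U] [Fintype V]

lemma card_ne (a : ℕ) (h : 0 < a) : Nonempty (Fin a) := ⟨⟨0, h⟩⟩

lemma codeN {pU : U → ℝ} {QV : U → V → ℝ} {QX : V → 𝒳 → ℝ} (hp : IsPMF pU) (hQ : IsChannel QV) (hX : IsChannel QX)
    (W : 𝒳 → 𝒴 × 𝒵₁ × 𝒵₂ → ℝ) (hW : IsChannel W) (n k1 a2 a0 b2 b0 : ℕ)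
    (h1 : 0 < k1) (h2 : 0 < a2) (h3 : 0 < a0) (h4 : 0 < b2) (h5 : 0 < b0) {τ1 τ2 s t : ℝ}
    (ht1 : 0 < τ1) (ht2 : 0 < τ2) (hs : 0 ≤ s)
    (ht : Pi1 (pmfN n pU) (chN n QV) (chN n (PUz QX (WY W))) τ1 + Pi2 (pmfN n pU) (chN n QV) (chN n (PUz QX (WY W))) τ2 +
        ((k1 * (b2 * b0) : ℝ) - 1) * τ1⁻¹ +
        ((a2 * a0 : ℝ) - 1) * (k1 * (b2 * b0)) * τ2⁻¹ +
        s * Lam1 (pmfN n pU) (chN n QV) (chN n (PUz QX (WZ1 W))) ((b2 * b0 : ℕ) : ℝ) +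
        s * Lam2 (pmfN n pU) (chN n QV) (chN n (PUz QX (WZ2 W))) ((a0 * b0 : ℕ) : ℝ) (a0 : ℝ) ≤ t) :
    ∃ enc : Fin k1 × Fin (a2 * b2) → (Fin n → 𝒳) → ℝ, IsChannel enc ∧
      ∃ dec : (Fin n → 𝒴) → Fin k1 × Fin (a2 * b2),
        errProb W enc dec ≤ t ∧ s * (Real.log 2 * leakMZ2 W enc) ≤ t ∧ s * (Real.log 2 * leakM1Z1 W enc) ≤ t := by
  have _ := card_ne _ h1
  have _ := card_ne _ h2
  have _ := card_ne _ h3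
  have _ := card_ne _ h4
  have _ := card_ne _ h5
  obtain ⟨v, dec, g1, g2, g3⟩ := oneshot (pmfN_pmf (n := n) hp) (chN_chan (n := n) hQ)
    (chN_chan (n := n) (PUz_chan hX (WY_chan hW))) (chN_chan (n := n) (PUz_chan hX (WZ1_chan hW)))
    (chN_chan (n := n) (PUz_chan hX (WZ2_chan hW)))
    (Equiv.refl (Fin a2 × Fin a0)) (Equiv.refl (Fin k1 × Fin b2 × Fin b0)) (finProdFinEquiv (m := a2) (n := b2)).symm
    (τ1 := τ1) (τ2 := τ2) (s := s) (t := t) ht1 ht2 hs (by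
      simpa only [Fintype.card_prod, Fintype.card_fin, Nat.cast_mul] using ht)
  refine ⟨fun m => Tc (Equiv.refl (Fin a2 × Fin a0)) (Equiv.refl (Fin k1 × Fin b2 × Fin b0)) (finProdFinEquiv (m := a2) (n := b2)).symm (chN n QX) v m,
    Tc_chan _ _ _ (chN_chan hX) v, dec, ?_, ?_, ?_⟩
  · rw [err_eq]
    simp only [enc_out]
    unfold err3 at g1
    simp only [Fintype.card_fin] at g1
    convert g1
  · rw [leak2_eq]
    simp only [enc_out]
    unfold leak3 at g3
    simpa only [Fintype.card_fin] using g3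
  · rw [leak1_eq]
    simp only [enc_out]
    unfold leak31 at g2
    simpa only [Fintype.card_fin] using g2
end block

section asymp

/-- Codebook size of exponential rate `ρ`. -/
def sz (n : ℕ) (ρ : ℝ) : ℕ := ⌊Real.exp (n * ρ)⌋₊

lemma sz_pos (n : ℕ) {ρ : ℝ} (h : 0 ≤ ρ) : 0 < sz n ρ :=
  Nat.floor_pos.2 (Real.one_le_exp (by positivity))

lemma sz_one (n : ℕ) {ρ : ℝ} (h : 0 ≤ ρ) : (1 : ℝ) ≤ sz n ρ := by exact_mod_cast sz_pos n h

lemma sz_le (n : ℕ) (ρ : ℝ) : (sz n ρ : ℝ) ≤ Real.exp (n * ρ) := Nat.floor_le (Real.exp_pos _).le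

lemma sz_log (n : ℕ) {ρ : ℝ} (h : 0 ≤ ρ) : n * ρ - Real.log 2 ≤ Real.log (sz n ρ) := by
  have h1 := Nat.lt_floor_add_one (Real.exp (n * ρ))
  have h2 := sz_one n h
  have h3 : Real.exp (n * ρ) ≤ sz n ρ * 2 := by unfold sz at *; linarith
  have h4 := Real.log_le_log (Real.exp_pos _) h3
  rw [Real.log_exp, Real.log_mul (by linarith) (by norm_num)] at h4
  linarith

lemma tail_bound {n : ℕ} {θ I δ x : ℝ} (hx1 : 1 ≤ x) (hI : 0 ≤ I)
    (hx : x ≤ Real.exp (n * ((1 - θ) * I))) (hδ : 0 < δ) (hc : I = 0 ∨ δ ≤ θ * I / 2) :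
    (x - 1) * (Real.exp (n * (I - δ)))⁻¹ ≤ Real.exp (-(n * δ)) := by
  rcases hc with h | h
  · subst h
    have : x = 1 := by simp at hx; linarith
    rw [this]; simp; positivity
  · rw [← Real.exp_neg]
    calc (x - 1) * Real.exp (-(n * (I - δ))) ≤ Real.exp (n * ((1 - θ) * I)) * Real.exp (-(n * (I - δ))) := by
          apply mul_le_mul_of_nonneg_right (by linarith) (Real.exp_pos _).le
      _ = Real.exp (n * ((1 - θ) * I) + -(n * (I - δ))) := (Real.exp_add _ _).symm
      _ ≤ _ := by
          apply Real.exp_le_exp.2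
          have : (n : ℝ) * (2 * δ) ≤ n * (θ * I) := mul_le_mul_of_nonneg_left (by linarith) (by positivity)
          linarith

lemma exp_small {n : ℕ} {δ : ℝ} (hn : 0 < n) (hδ : 0 < δ) : Real.exp (-(n * δ)) ≤ 1 / δ / n := by
  have hn' : (0 : ℝ) < n := by exact_mod_cast hn
  rw [Real.exp_neg, div_div, ← one_div]
  apply one_div_le_one_div_of_le (by positivity)
  have := Real.add_one_le_exp (n * δ)
  linarith

lemma choose_pos (c η : ℝ) (hη : 0 < η) : ∃ θ, 0 < θ ∧ θ ≤ 1 ∧ θ * c ≤ η := by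
  by_cases h : c ≤ η
  · exact ⟨1, one_pos, le_refl 1, by linarith⟩
  · push Not at h
    have hc : 0 < c := hη.trans h
    exact ⟨η / c, by positivity, (div_le_one hc).2 h.le, by rw [div_mul_cancel₀ _ hc.ne']⟩

lemma choose_delta {θ a a' η : ℝ} (hθ : 0 < θ) (ha : 0 ≤ a) (ha' : 0 ≤ a') (hη : 0 < η) :
    ∃ δ, 0 < δ ∧ δ ≤ η ∧ (a = 0 ∨ δ ≤ θ * a / 2) ∧ (a' = 0 ∨ δ ≤ θ * a' / 2) := by
  have key : ∀ a : ℝ, 0 ≤ a → ∃ δ, 0 < δ ∧ (a = 0 ∨ δ ≤ θ * a / 2) := by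
    intro a ha
    rcases ha.eq_or_lt with h | h
    · exact ⟨1, one_pos, Or.inl h.symm⟩
    · exact ⟨θ * a / 2, by positivity, Or.inr le_rfl⟩
  obtain ⟨d1, p1, q1⟩ := key a ha
  obtain ⟨d2, p2, q2⟩ := key a' ha'
  refine ⟨min η (min d1 d2), by positivity, min_le_left _ _, ?_, ?_⟩
  · exact q1.imp id fun h => le_trans (le_trans (min_le_right _ _) (min_le_left _ _)) h
  · exact q2.imp id fun h => le_trans (le_trans (min_le_right _ _) (min_le_right _ _)) h

end asymp

section fin
variable {𝒳 𝒴 𝒵₁ 𝒵₂ : Type} [Fintype 𝒳] [Fintype 𝒴] [Fintype 𝒵₁] [Fintype 𝒵₂]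
variable {U V : Type*} [Fintype U] [Fintype V]

/-- rate bookkeeping for the codebook sizes -/
lemma rate_aux {n : ℕ} {θ r ε ρ R : ℝ} (hθ1 : θ ≤ 1) (hr : r = Real.log 2 * R) (hrρ : r ≤ ρ)
    (hθr : θ * r ≤ Real.log 2 * (ε / 2)) (hn : 4 ≤ n * ε) {L : ℝ} (hL : n * ((1 - θ) * ρ) - 2 * Real.log 2 ≤ L) :
    (n : ℝ) * (R - ε) ≤ L / Real.log 2 := by
  have hl : 0 < Real.log 2 := by positivity
  rw [le_div_iff₀ hl]
  have h1 : (1 - θ) * r ≤ (1 - θ) * ρ := mul_le_mul_of_nonneg_left hrρ (by linarith)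
  have h2 : Real.log 2 * (R - ε / 2) ≤ (1 - θ) * ρ := by rw [hr] at *; linarith
  have h3 : (n : ℝ) * (Real.log 2 * (R - ε / 2)) ≤ n * ((1 - θ) * ρ) := mul_le_mul_of_nonneg_left h2 (by positivity)
  have h4 : 4 * Real.log 2 ≤ n * ε * Real.log 2 := mul_le_mul_of_nonneg_right hn hl.le
  linarith

lemma achiev_core {pU : U → ℝ} {QV : U → V → ℝ} {QX : V → 𝒳 → ℝ} (hp : IsPMF pU) (hQ : IsChannel QV) (hX : IsChannel QX)
    (W : 𝒳 → 𝒴 × 𝒵₁ × 𝒵₂ → ℝ) (hW : IsChannel W) {a b c d e R1 R2 : ℝ}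
    (ha : a = I1 pU QV (PUz QX (WY W))) (hb : b = I1 pU QV (PUz QX (WZ1 W))) (hc : c = I1 pU QV (PUz QX (WZ2 W)))
    (hd : d = I0 pU QV (PUz QX (WZ2 W))) (he : e = I0 pU QV (PUz QX (WY W)))
    (hcb : c ≤ b) (hde : d ≤ e) (hR1 : 0 ≤ R1) (hR2 : 0 ≤ R2) (h1 : Real.log 2 * R1 ≤ a - b)
    (h2 : Real.log 2 * (R1 + R2) ≤ a + e - (c + d)) : Achievable W R1 R2 := by
  have hl : 0 < Real.log 2 := by positivity
  have hl1 : Real.log 2 ≤ 1 := by have := Real.log_two_lt_d9; linarith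
  have cY := PUz_chan hX (WY_chan hW)
  have c1 := PUz_chan hX (WZ1_chan hW)
  have c2 := PUz_chan hX (WZ2_chan hW)
  have a0 : 0 ≤ a := ha ▸ I1_nonneg hp hQ cY
  have c0 : 0 ≤ c := hc ▸ I1_nonneg hp hQ c2
  have d0 : 0 ≤ d := hd ▸ I0_nonneg hp hQ c2
  have e0 : 0 ≤ e := d0.trans hde
  have b0 : 0 ≤ b := c0.trans hcb
  have i2Y : I2 pU QV (PUz QX (WY W)) = a + e := by rw [ha, he]; exact I_add hp hQ cY
  have i2Z : I2 pU QV (PUz QX (WZ2 W)) = c + d := by rw [hc, hd]; exact I_add hp hQ c2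
  intro ε hε
  obtain ⟨r1, hr1⟩ : ∃ r1, r1 = Real.log 2 * R1 := ⟨_, rfl⟩
  obtain ⟨r2, hr2⟩ : ∃ r2, r2 = Real.log 2 * R2 := ⟨_, rfl⟩
  have r1n : 0 ≤ r1 := hr1 ▸ by positivity
  have r2n : 0 ≤ r2 := hr2 ▸ by positivity
  have h1' : r1 ≤ a - b := hr1 ▸ h1
  have h2' : r1 + r2 ≤ a + e - (c + d) := by rw [hr1, hr2]; linarith
  obtain ⟨α, hα⟩ : ∃ α, α = max (r2 - (b - c)) 0 := ⟨_, rfl⟩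
  have α0 : 0 ≤ α := hα ▸ le_max_right _ _
  have α1 : r2 ≤ α + (b - c) := by have := le_max_left (r2 - (b - c)) 0; rw [← hα] at this; linarith
  have α2 : r1 + (b - c) + c + α + d ≤ a + e := by
    rcases max_choice (r2 - (b - c)) 0 with h | h <;> rw [← hα] at h <;> rw [h] <;> linarith
  obtain ⟨η, hη⟩ : ∃ η, η = ε * Real.log 2 := ⟨_, rfl⟩
  have η0 : 0 < η := hη ▸ by positivity
  obtain ⟨θ, θ0, θ1, hθ⟩ := choose_pos (2 * b + c + 2 * d + r1 + r2) (η / 4) (by positivity)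
  have tb := mul_nonneg θ0.le b0
  have tc := mul_nonneg θ0.le c0
  have td := mul_nonneg θ0.le d0
  have tr1 := mul_nonneg θ0.le r1n
  have tr2 := mul_nonneg θ0.le r2n
  have hθ1 : θ * (2 * b + c + 2 * d) ≤ η / 4 := by linarith
  have hθ2 : θ * r1 ≤ Real.log 2 * (ε / 2) := by rw [hη] at *; linarith
  have hθ3 : θ * r2 ≤ Real.log 2 * (ε / 2) := by rw [hη] at *; linarith
  obtain ⟨δ, δ0, hδ, hδ1, hδ2⟩ := choose_delta (θ := θ) (a := a) (a' := a + e) (η := η / 16) θ0 a0 (by linarith) (by positivity)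
  obtain ⟨s1, hs1⟩ : ∃ s, s = vari (om pU QV (PUz QX (WY W))) (g1 QV (PUz QX (WY W))) := ⟨_, rfl⟩
  obtain ⟨s2, hs2⟩ : ∃ s, s = vari (om pU QV (PUz QX (WY W))) (g2 pU QV (PUz QX (WY W))) := ⟨_, rfl⟩
  obtain ⟨s3, hs3⟩ : ∃ s, s = vari (om pU QV (PUz QX (WZ1 W))) (g1 QV (PUz QX (WZ1 W))) := ⟨_, rfl⟩
  obtain ⟨s4, hs4⟩ : ∃ s, s = vari (om pU QV (PUz QX (WZ2 W))) (g2 pU QV (PUz QX (WZ2 W))) := ⟨_, rfl⟩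
  obtain ⟨s5, hs5⟩ : ∃ s, s = vari (om pU QV (PUz QX (WZ2 W))) (g0 pU QV (PUz QX (WZ2 W))) := ⟨_, rfl⟩
  obtain ⟨C, hC⟩ : ∃ C, C = s1 / δ ^ 2 + s2 / δ ^ 2 + 1 / δ + 1 / δ + (Real.log 3 + 4 * Real.log 2 + 2 * (s3 / δ)) +
    (Real.log 3 + 3 * Real.log 2 + s4 / δ + s5 / δ) := ⟨_, rfl⟩
  obtain ⟨n, hn⟩ := exists_nat_gt (max (2 * C / η) (4 / ε))
  have hnC : 2 * C / η < n := (le_max_left _ _).trans_lt hn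
  have hnE : 4 / ε < n := (le_max_right _ _).trans_lt hn
  have n0 : (0 : ℝ) < n := lt_trans (by positivity) hnE
  have n0' : 0 < n := by exact_mod_cast n0
  have hnE' : 4 ≤ n * ε := ((div_lt_iff₀ hε).1 hnE).le
  have hnC' : C / n ≤ η / 2 := by
    rw [div_le_iff₀ n0]
    rw [div_lt_iff₀ η0] at hnC
    linarith
  have t0 : 0 ≤ 1 - θ := by linarith
  have ρ1 : 0 ≤ (1 - θ) * r1 := by positivity
  have ρ2 : 0 ≤ (1 - θ) * α := by positivity
  have ρ3 : 0 ≤ (1 - θ) * d := by positivity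
  have ρ4 : 0 ≤ (1 - θ) * (b - c) := mul_nonneg t0 (by linarith)
  have ρ5 : 0 ≤ (1 - θ) * c := by positivity
  obtain ⟨k1, hk1⟩ : ∃ k, k = sz n ((1 - θ) * r1) := ⟨_, rfl⟩
  obtain ⟨x2, hx2⟩ : ∃ k, k = sz n ((1 - θ) * α) := ⟨_, rfl⟩
  obtain ⟨x0, hx0⟩ : ∃ k, k = sz n ((1 - θ) * d) := ⟨_, rfl⟩
  obtain ⟨y2, hy2⟩ : ∃ k, k = sz n ((1 - θ) * (b - c)) := ⟨_, rfl⟩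
  obtain ⟨y0, hy0⟩ : ∃ k, k = sz n ((1 - θ) * c) := ⟨_, rfl⟩
  have pk1 : 0 < k1 := hk1 ▸ sz_pos n ρ1
  have px2 : 0 < x2 := hx2 ▸ sz_pos n ρ2
  have px0 : 0 < x0 := hx0 ▸ sz_pos n ρ3
  have py2 : 0 < y2 := hy2 ▸ sz_pos n ρ4
  have py0 : 0 < y0 := hy0 ▸ sz_pos n ρ5
  have qk1 : (1 : ℝ) ≤ k1 := by exact_mod_cast pk1
  have qx2 : (1 : ℝ) ≤ x2 := by exact_mod_cast px2
  have qx0 : (1 : ℝ) ≤ x0 := by exact_mod_cast px0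
  have qy2 : (1 : ℝ) ≤ y2 := by exact_mod_cast py2
  have qy0 : (1 : ℝ) ≤ y0 := by exact_mod_cast py0
  have lk1 : n * ((1 - θ) * r1) - Real.log 2 ≤ Real.log k1 := hk1 ▸ sz_log n ρ1
  have lx2 : n * ((1 - θ) * α) - Real.log 2 ≤ Real.log x2 := hx2 ▸ sz_log n ρ2
  have lx0 : n * ((1 - θ) * d) - Real.log 2 ≤ Real.log x0 := hx0 ▸ sz_log n ρ3
  have ly2 : n * ((1 - θ) * (b - c)) - Real.log 2 ≤ Real.log y2 := hy2 ▸ sz_log n ρ4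
  have ly0 : n * ((1 - θ) * c) - Real.log 2 ≤ Real.log y0 := hy0 ▸ sz_log n ρ5
  have uk1 : (k1 : ℝ) ≤ Real.exp (n * ((1 - θ) * r1)) := hk1 ▸ sz_le n _
  have ux2 : (x2 : ℝ) ≤ Real.exp (n * ((1 - θ) * α)) := hx2 ▸ sz_le n _
  have ux0 : (x0 : ℝ) ≤ Real.exp (n * ((1 - θ) * d)) := hx0 ▸ sz_le n _
  have uy2 : (y2 : ℝ) ≤ Real.exp (n * ((1 - θ) * (b - c))) := hy2 ▸ sz_le n _
  have uy0 : (y0 : ℝ) ≤ Real.exp (n * ((1 - θ) * c)) := hy0 ▸ sz_le n _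
  have Bone : (1 : ℝ) ≤ k1 * (y2 * y0) := one_le_mul_of_one_le_of_one_le qk1 (one_le_mul_of_one_le_of_one_le qy2 qy0)
  have Aone : (1 : ℝ) ≤ x2 * x0 := one_le_mul_of_one_le_of_one_le qx2 qx0
  have Bexp : (k1 * (y2 * y0) : ℝ) ≤ Real.exp (n * ((1 - θ) * (r1 + b))) := by
    have : Real.exp (n * ((1 - θ) * (r1 + b))) = Real.exp (n * ((1 - θ) * r1)) *
        (Real.exp (n * ((1 - θ) * (b - c))) * Real.exp (n * ((1 - θ) * c))) := by
      rw [← Real.exp_add, ← Real.exp_add]; congr 1; ring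
    rw [this]; gcongr
  have Aexp : (x2 * x0 : ℝ) ≤ Real.exp (n * ((1 - θ) * (α + d))) := by
    have : Real.exp (n * ((1 - θ) * (α + d))) = Real.exp (n * ((1 - θ) * α)) * Real.exp (n * ((1 - θ) * d)) := by
      rw [← Real.exp_add]; congr 1; ring
    rw [this]; gcongr
  have mono : ∀ p q : ℝ, p ≤ q → Real.exp (n * ((1 - θ) * p)) ≤ Real.exp (n * ((1 - θ) * q)) := by
    intro p q h
    exact Real.exp_le_exp.2 (mul_le_mul_of_nonneg_left (mul_le_mul_of_nonneg_left h t0) n0.le)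
  have E1 := tail_bound Bone a0 (Bexp.trans (mono _ _ (by linarith))) δ0 hδ1
  have E2 : ((x2 * x0 : ℝ) - 1) * (k1 * (y2 * y0)) * (Real.exp (n * (a + e - δ)))⁻¹ ≤ Real.exp (-(n * δ)) := by
    have hABexp : (x2 * x0 : ℝ) * (k1 * (y2 * y0)) ≤ Real.exp (n * ((1 - θ) * (a + e))) := by
      refine le_trans (mul_le_mul Aexp Bexp (by positivity) (Real.exp_pos _).le) ?_
      rw [← Real.exp_add, ← mul_add, ← mul_add]
      exact mono _ _ (by linarith)
    have := tail_bound (one_le_mul_of_one_le_of_one_le Aone Bone) (by linarith) hABexp δ0 hδ2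
    refine le_trans (mul_le_mul_of_nonneg_right ?_ (by positivity)) this
    linarith
  have E3 := exp_small n0' δ0
  have P1b := Pi1_N hp hQ cY n0' δ0
  have P2b := Pi2_N hp hQ cY n0' δ0
  rw [← ha, ← hs1] at P1b
  rw [i2Y, ← hs2] at P2b
  have npos1 : (0 : ℝ) < ((y2 * y0 : ℕ) : ℝ) := by exact_mod_cast Nat.mul_pos py2 py0
  have npos2 : (0 : ℝ) < ((x0 * y0 : ℕ) : ℝ) := by exact_mod_cast Nat.mul_pos px0 py0
  have L1b := Lam1_N hp hQ c1 n0' δ0 npos1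
  have L2b := Lam2_N hp hQ c2 n0' δ0 npos2 (lt_of_lt_of_le one_pos qx0)
  rw [← hb, ← hs3] at L1b
  rw [i2Z, ← hd, ← hs4, ← hs5] at L2b
  have nz : ∀ {x : ℝ}, 1 ≤ x → x ≠ 0 := fun h => by linarith
  have log1 : Real.log ((y2 * y0 : ℕ) : ℝ) = Real.log y2 + Real.log y0 := by
    rw [Nat.cast_mul, Real.log_mul (nz qy2) (nz qy0)]
  have log2' : Real.log ((x0 * y0 : ℕ) : ℝ) = Real.log x0 + Real.log y0 := by
    rw [Nat.cast_mul, Real.log_mul (nz qx0) (nz qy0)]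
  have m1 : max (n * b - Real.log ((y2 * y0 : ℕ) : ℝ)) 0 ≤ n * (θ * b) + 2 * Real.log 2 := by
    rw [log1]; apply max_le
    · linarith
    · positivity
  have m2 : max (n * (c + d) - Real.log ((x0 * y0 : ℕ) : ℝ)) 0 ≤ n * (θ * (c + d)) + 2 * Real.log 2 := by
    rw [log2']; apply max_le
    · linarith
    · positivity
  have m3 : max (n * d - Real.log (x0 : ℝ)) 0 ≤ n * (θ * d) + Real.log 2 := by
    apply max_le
    · linarith
    · positivity
  have F1 : (1 / n : ℝ) * Lam1 (pmfN n pU) (chN n QV) (chN n (PUz QX (WZ1 W))) ((y2 * y0 : ℕ) : ℝ) ≤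
      (Real.log 3 + 4 * Real.log 2 + 2 * (s3 / δ)) / n + 2 * (θ * b) + 2 * δ := by
    rw [one_div, inv_mul_le_iff₀ n0]
    refine L1b.trans ?_
    have : (n : ℝ) * ((Real.log 3 + 4 * Real.log 2 + 2 * (s3 / δ)) / n + 2 * (θ * b) + 2 * δ) =
      (Real.log 3 + 4 * Real.log 2 + 2 * (s3 / δ)) + n * (2 * (θ * b)) + n * (2 * δ) := by
      rw [mul_add, mul_add, mul_div_cancel₀ _ n0.ne']
    rw [this]; linarith
  have F2 : (1 / n : ℝ) * Lam2 (pmfN n pU) (chN n QV) (chN n (PUz QX (WZ2 W))) ((x0 * y0 : ℕ) : ℝ) (x0 : ℝ) ≤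
      (Real.log 3 + 3 * Real.log 2 + s4 / δ + s5 / δ) / n + θ * (c + 2 * d) + 2 * δ := by
    rw [one_div, inv_mul_le_iff₀ n0]
    refine L2b.trans ?_
    have : (n : ℝ) * ((Real.log 3 + 3 * Real.log 2 + s4 / δ + s5 / δ) / n + θ * (c + 2 * d) + 2 * δ) =
      (Real.log 3 + 3 * Real.log 2 + s4 / δ + s5 / δ) + n * (θ * (c + 2 * d)) + n * (2 * δ) := by
      rw [mul_add, mul_add, mul_div_cancel₀ _ n0.ne']
    rw [this]; linarith
  have G1 : s1 / (n * δ ^ 2) = s1 / δ ^ 2 / n := by rw [div_div, mul_comm]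
  have G2 : s2 / (n * δ ^ 2) = s2 / δ ^ 2 / n := by rw [div_div, mul_comm]
  rw [G1] at P1b
  rw [G2] at P2b
  have hCn : C / n = s1 / δ ^ 2 / n + s2 / δ ^ 2 / n + 1 / δ / n + 1 / δ / n + (Real.log 3 + 4 * Real.log 2 + 2 * (s3 / δ)) / n +
    (Real.log 3 + 3 * Real.log 2 + s4 / δ + s5 / δ) / n := by
    rw [hC]; simp only [add_div]
  obtain ⟨enc, henc, dec, o1, o2, o3⟩ := codeN hp hQ hX W hW n k1 x2 x0 y2 y0 pk1 px2 px0 py2 py0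
    (τ1 := Real.exp (n * (a - δ))) (τ2 := Real.exp (n * (a + e - δ))) (s := 1 / n) (t := η)
    (Real.exp_pos _) (Real.exp_pos _) (by positivity) (by linarith)
  have fin : ∀ L : ℝ, (1 / n : ℝ) * (Real.log 2 * L) ≤ η → L ≤ n * ε := by
    intro L h
    rw [one_div, inv_mul_le_iff₀ n0, hη] at h
    have : Real.log 2 * L ≤ Real.log 2 * (n * ε) := by linarith
    exact le_of_mul_le_mul_left this hl
  refine ⟨n, n0', k1, x2 * y2, pk1, Nat.mul_pos px2 py2, ?_, ?_, enc, henc, dec, ?_, fin _ o2, fin _ o3⟩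
  · exact rate_aux θ1 hr1 le_rfl hθ2 hnE' (by linarith)
  · refine rate_aux (ρ := α + (b - c)) θ1 hr2 α1 hθ3 hnE' ?_
    rw [Nat.cast_mul, Real.log_mul (nz qx2) (nz qy2)]
    linarith
  · refine o1.trans ?_
    rw [hη]
    exact mul_le_of_le_one_right hε.le hl1

lemma achiev (W : 𝒳 → 𝒴 × 𝒵₁ × 𝒵₂ → ℝ) (hW : IsChannel W)
    (hdeg₁ : DegradedZ1Z2 W) (hdeg₂ : DegradedYZ2 W) {R1 R2 : ℝ} (hR1 : 0 ≤ R1) (hR2 : 0 ≤ R2)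
    (pUVX : U × V × 𝒳 → ℝ) (hp : IsPMF pUVX)
    (hM : ∀ u v x, pUVX (u, v, x) * (∑ u', ∑ x', pUVX (u', v, x')) =
            (∑ x', pUVX (u, v, x')) * (∑ u', pUVX (u', v, x)))
    (h1 : R1 ≤ condMutInfo (fun t : V × 𝒴 × U => ∑ x, pUVX (t.2.2, t.1, x) * WY W x t.2.1) -
            condMutInfo (fun t : V × 𝒵₁ × U => ∑ x, pUVX (t.2.2, t.1, x) * WZ1 W x t.2.1))
    (h2 : R1 + R2 ≤ mutInfo (fun q : V × 𝒴 => ∑ u, ∑ x, pUVX (u, q.1, x) * WY W x q.2) -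
            mutInfo (fun q : V × 𝒵₂ => ∑ u, ∑ x, pUVX (u, q.1, x) * WZ2 W x q.2)) : Achievable W R1 R2 := by
  have hl : 0 < Real.log 2 := by positivity
  obtain ⟨pU, QV, QX, hpU, hQ, hX, hf⟩ := factor pUVX hp hM
  have cY := PUz_chan hX (WY_chan hW)
  have c1 := PUz_chan hX (WZ1_chan hW)
  have c2 := PUz_chan hX (WZ2_chan hW)
  have e1 : ∀ {O : Type} (WO : 𝒳 → O → ℝ) u v z, ∑ x, pUVX (u, v, x) * WO x z = pU u * QV u v * PUz QX WO v z := by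
    intro O WO u v z
    unfold PUz
    rw [Finset.mul_sum]
    refine Finset.sum_congr rfl fun x _ => ?_
    rw [hf, mul_assoc]
  simp only [e1] at h1 h2
  have h1' := mul_le_mul_of_nonneg_left h1 hl.le
  have h2' := mul_le_mul_of_nonneg_left h2 hl.le
  rw [mul_sub, cmi_I1 hpU hQ cY, cmi_I1 hpU hQ c1] at h1'
  rw [mul_sub, mi_I2 hpU hQ cY, mi_I2 hpU hQ c2, I_add hpU hQ cY, I_add hpU hQ c2] at h2'
  obtain ⟨qY, hqY, gY⟩ := degY hdeg₂
  obtain ⟨qZ, hqZ, gZ⟩ := degZ hdeg₁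
  exact achiev_core hpU hQ hX W hW rfl rfl rfl rfl rfl (I1_dp hpU hQ c2 c1 hqZ (PUz_deg gZ))
    (I0_dp hpU hQ c2 cY hqY (PUz_deg gY)) hR1 hR2 h1' h2'
end fin

/-- for a discrete memoryless two-level security wiretap channel with
`X → Z₁ → Z₂` and `X → Y → Z₂`, the secrecy capacity region is exactly the set of
nonnegative pairs with `R₁ ≤ I(V;Y|U) − I(V;Z₁|U)` and `R₁ + R₂ ≤ I(V;Y) − I(V;Z₂)`
for some `p(u,v,x)`, with `U, V` auxiliary random variables on finite alphabets
satisfying `U → V → X → (Y,Z₁,Z₂)`. -/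
theorem stmt4_capacity_region_degraded_YZ2
    (W : 𝒳 → 𝒴 × 𝒵₁ × 𝒵₂ → ℝ) (hW : IsChannel W)
    (hdeg₁ : DegradedZ1Z2 W) (hdeg₂ : DegradedYZ2 W) :
    {R : ℝ × ℝ | 0 ≤ R.1 ∧ 0 ≤ R.2 ∧ Achievable W R.1 R.2} =
    {R : ℝ × ℝ | 0 ≤ R.1 ∧ 0 ≤ R.2 ∧
      ∃ (kU kV : ℕ) (pUVX : Fin kU × Fin kV × 𝒳 → ℝ), IsPMF pUVX ∧
        -- Markov chain U → V → X
        (∀ u v x,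
          pUVX (u, v, x) * (∑ u', ∑ x', pUVX (u', v, x')) =
            (∑ x', pUVX (u, v, x')) * (∑ u', pUVX (u', v, x))) ∧
        R.1 ≤
          condMutInfo (fun t : Fin kV × 𝒴 × Fin kU =>
              ∑ x, pUVX (t.2.2, t.1, x) * WY W x t.2.1) -
            condMutInfo (fun t : Fin kV × 𝒵₁ × Fin kU =>
              ∑ x, pUVX (t.2.2, t.1, x) * WZ1 W x t.2.1) ∧
        R.1 + R.2 ≤
          mutInfo (fun q : Fin kV × 𝒴 => ∑ u, ∑ x, pUVX (u, q.1, x) * WY W x q.2) -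
            mutInfo (fun q : Fin kV × 𝒵₂ => ∑ u, ∑ x, pUVX (u, q.1, x) * WZ2 W x q.2)} := by
  have hl : 0 < Real.log 2 := by positivity
  ext R
  simp only [Set.mem_setOf_eq]
  constructor
  · rintro ⟨h1, h2, hA⟩
    obtain ⟨t, ht, g1, g2⟩ := converse hW hdeg₁ hdeg₂ R.1 R.2 hA
    obtain ⟨kU, kV, p, hp, hM, i1, i2⟩ := fromK2 hW t ht
    refine ⟨h1, h2, kU, kV, p, hp, hM, ?_, ?_⟩
    · rw [← i1] at g1
      exact le_of_mul_le_mul_left g1 hl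
    · rw [← i2] at g2
      exact le_of_mul_le_mul_left g2 hl
  · rintro ⟨h1, h2, kU, kV, p, hp, hM, i1, i2⟩
    exact ⟨h1, h2, achiev W hW hdeg₁ hdeg₂ h1 h2 p hp hM i1 i2⟩
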